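/- An integral non-degenerate surface S ⊂ P^r, r ≥ 5, satisfies dim G_{1,2}(S) < 8 if and only if S is a cone or a rational normal scroll of degree 4 in P^5 (equivalently, a surface of minimal degree 4 in P^5 other than the Veronese surface). -/

import Mathlib

open Submodule

noncomputable section

/-- Polynomial functions on a complex module: the subalgebra of functions generated by
the linear functionals. -/
def PolyFun (W : Type*) [AddCommGroup W] [Module ℂ W] : Subalgebra ℂ (W → ℂ) :=
  Algebra.adjoin ℂ {f : W → ℂ | IsLinearMap ℂ f}

/-- A subset of a complex module is algebraic (Zariski closed) if it is the common zero
set of a family of polynomial functions. -/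
def IsAlgSet {W : Type*} [AddCommGroup W] [Module ℂ W] (X : Set W) : Prop :=
  ∃ S : Set (W → ℂ), S ⊆ (PolyFun W : Set (W → ℂ)) ∧ X = {x | ∀ f ∈ S, f x = 0}

/-- Zariski closure. -/
def zcl {W : Type*} [AddCommGroup W] [Module ℂ W] (A : Set W) : Set W :=
  ⋂₀ {Y | IsAlgSet Y ∧ A ⊆ Y}

/-- Irreducible algebraic set. -/
def IsIrrAlg {W : Type*} [AddCommGroup W] [Module ℂ W] (X : Set W) : Prop :=
  X.Nonempty ∧ IsAlgSet X ∧
    ∀ Y Z : Set W, IsAlgSet Y → IsAlgSet Z → X ⊆ Y ∪ Z → X ⊆ Y ∨ X ⊆ Z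

/-- Dimension of an (affine) algebraic set: the supremum of the lengths of strict chains
of irreducible algebraic subsets contained in it. -/
def adim {W : Type*} [AddCommGroup W] [Module ℂ W] (X : Set W) : ℕ∞ :=
  sSup {d : ℕ∞ | ∃ n : ℕ, d = (n : ℕ∞) ∧
    ∃ c : Fin (n + 1) → Set W, StrictMono c ∧ ∀ i, IsIrrAlg (c i) ∧ c i ⊆ X}

/-- Projective dimension of a cone: one less than the dimension of the affine cone. -/
def pdim {W : Type*} [AddCommGroup W] [Module ℂ W] (X : Set W) : ℕ∞ := adim X - 1

/-- A cone in a complex module (the affine cone of a projective set). -/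
def IsCone {W : Type*} [AddCommGroup W] [Module ℂ W] (X : Set W) : Prop :=
  (0 : W) ∈ X ∧ ∀ (c : ℂ) (x : W), x ∈ X → c • x ∈ X

/-- The affine cone of an integral projective variety: an irreducible algebraic cone,
different from the origin alone. -/
def IsProjVar {W : Type*} [AddCommGroup W] [Module ℂ W] (X : Set W) : Prop :=
  IsAlgSet X ∧ IsCone X ∧ IsIrrAlg X ∧ X ≠ {0}

/-- Non-degenerate: the cone spans the ambient space. -/
def Nondeg {W : Type*} [AddCommGroup W] [Module ℂ W] (X : Set W) : Prop :=
  Submodule.span ℂ X = ⊤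

/-- The projective set is a cone over some vertex: there is a point `v` (vertex) of the
variety such that the variety is a union of lines through the vertex. -/
def IsConeVar {W : Type*} [AddCommGroup W] [Module ℂ W] (X : Set W) : Prop :=
  ∃ v ∈ X, v ≠ 0 ∧ ∀ x ∈ X, ∀ a b : ℂ, a • v + b • x ∈ X

/-- Affine cone of the `k`-th secant variety `S_k(X)`: the Zariski closure of the union
of the linear spans of `k+1` points of `X`. -/
def Sec {W : Type*} [AddCommGroup W] [Module ℂ W] (X : Set W) (k : ℕ) : Set W :=
  zcl (⋃ p ∈ {p : Fin (k + 1) → W | ∀ i, p i ∈ X},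
    (Submodule.span ℂ (Set.range p) : Set W))

/-- Plücker points of the spans of `(k+1)`-tuples of points of `X`: the raw affine cone
over the image of the span map `Φ : X^{k+1} ⇢ G(k,r)` in Plücker coordinates. -/
def GkConePre {W : Type*} [AddCommGroup W] [Module ℂ W] (X : Set W) (k : ℕ) :
    Set (ExteriorAlgebra ℂ W) :=
  {w | ∃ p : Fin (k + 1) → W, (∀ i, p i ∈ X) ∧ w = ExteriorAlgebra.ιMulti ℂ (k + 1) p}

/-- Affine cone over `G_k(X)` (in Plücker coordinates): Zariski closure of the cone over
the image of the span map. -/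
def GkCone {W : Type*} [AddCommGroup W] [Module ℂ W] (X : Set W) (k : ℕ) :
    Set (ExteriorAlgebra ℂ W) :=
  zcl (GkConePre X k)

/-- `G_k(X)` as a set of `(k+1)`-dimensional subspaces (projective `k`-planes): those
whose Plücker point lies in the closure of the image of the span map. -/
def Gk {W : Type*} [AddCommGroup W] [Module ℂ W] (X : Set W) (k : ℕ) :
    Set (Submodule ℂ W) :=
  {U | Module.finrank ℂ U = k + 1 ∧
    ∀ p : Fin (k + 1) → W, (∀ i, p i ∈ U) →
      ExteriorAlgebra.ιMulti ℂ (k + 1) p ∈ GkCone X k}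

/-- Raw cone of Plücker points of `h`-planes contained in some `(k+1)`-secant `k`-plane. -/
def GhkConePre {W : Type*} [AddCommGroup W] [Module ℂ W] (X : Set W) (h k : ℕ) :
    Set (ExteriorAlgebra ℂ W) :=
  {w | ∃ (p : Fin (k + 1) → W) (q : Fin (h + 1) → W), (∀ i, p i ∈ X) ∧
    (∀ j, q j ∈ Submodule.span ℂ (Set.range p)) ∧
    w = ExteriorAlgebra.ιMulti ℂ (h + 1) q}

/-- Affine cone over `G_{h,k}(X)` in Plücker coordinates. -/
def GhkCone {W : Type*} [AddCommGroup W] [Module ℂ W] (X : Set W) (h k : ℕ) :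
    Set (ExteriorAlgebra ℂ W) :=
  zcl (GhkConePre X h k)


/-- Affine cone over the rational normal scroll `S(2,2) ⊂ P^5` (the quadric `P^1 × P^1`
embedded by divisors of type `(2,1)`). -/
def ScrollS22 : Set (Fin 6 → ℂ) :=
  zcl (Set.range fun x : (ℂ × ℂ) × (ℂ × ℂ) =>
    ![x.2.1 * x.1.1 ^ 2, x.2.1 * x.1.1 * x.1.2, x.2.1 * x.1.2 ^ 2,
      x.2.2 * x.1.1 ^ 2, x.2.2 * x.1.1 * x.1.2, x.2.2 * x.1.2 ^ 2])

/-- Affine cone over the rational normal scroll `S(1,3) ⊂ P^5`. -/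
def ScrollS13 : Set (Fin 6 → ℂ) :=
  zcl (Set.range fun x : (ℂ × ℂ) × (ℂ × ℂ) =>
    ![x.2.1 * x.1.1, x.2.1 * x.1.2, x.2.2 * x.1.1 ^ 3,
      x.2.2 * x.1.1 ^ 2 * x.1.2, x.2.2 * x.1.1 * x.1.2 ^ 2, x.2.2 * x.1.2 ^ 3])

/-- Algebraic independence of functions on a set of points. -/
def IndepOn {W : Type*} {d : ℕ} (f : Fin d → W → ℂ) (X : Set W) : Prop :=
  ∀ F : MvPolynomial (Fin d) ℂ, (∀ x ∈ X, MvPolynomial.eval (fun i => f i x) F = 0) → F = 0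

section DimUpper

variable {W : Type*} [AddCommGroup W] [Module ℂ W]

lemma polyFun_of_linear {f : W → ℂ} (hf : IsLinearMap ℂ f) : f ∈ PolyFun W :=
  Algebra.subset_adjoin hf

lemma polyFun_of_dual (f : Module.Dual ℂ W) : (fun x => f x) ∈ PolyFun W :=
  polyFun_of_linear f.isLinear

lemma polyFun_eval {σ : Type*} {f : σ → W → ℂ} (hf : ∀ i, f i ∈ PolyFun W)
    (F : MvPolynomial σ ℂ) :
    (fun x => MvPolynomial.eval (fun i => f i x) F) ∈ PolyFun W := by
  induction F using MvPolynomial.induction_on with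
  | C a => simp only [MvPolynomial.eval_C]; exact (PolyFun W).algebraMap_mem a
  | add p q hp hq => simp only [map_add]; exact (PolyFun W).add_mem hp hq
  | mul_X p i hp =>
    simp only [map_mul, MvPolynomial.eval_X]; exact (PolyFun W).mul_mem hp (hf i)

lemma isAlgSet_zeros {f : W → ℂ} (hf : f ∈ PolyFun W) : IsAlgSet {x | f x = 0} :=
  ⟨{f}, by simpa using hf, by simp⟩

lemma subset_zcl (A : Set W) : A ⊆ zcl A := fun _ hx _ hY => hY.2 hx

lemma zcl_subset {A Y : Set W} (hY : IsAlgSet Y) (h : A ⊆ Y) : zcl A ⊆ Y :=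
  fun _ hx => hx Y ⟨hY, h⟩

lemma zcl_vanish {A : Set W} {f : W → ℂ} (hf : f ∈ PolyFun W) (h : ∀ x ∈ A, f x = 0) :
    ∀ x ∈ zcl A, f x = 0 :=
  fun _ hx => zcl_subset (isAlgSet_zeros hf) h hx

lemma isAlgSet_zcl (A : Set W) : IsAlgSet (zcl A) := by
  refine ⟨{f | f ∈ PolyFun W ∧ ∀ x ∈ A, f x = 0}, fun f hf => hf.1, ?_⟩
  apply Set.Subset.antisymm
  · intro x hx f hf
    exact zcl_vanish hf.1 hf.2 x hx
  · rintro x hx Y ⟨⟨T, hT, rfl⟩, hA⟩ f hf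
    exact hx f ⟨hT hf, fun y hy => hA hy f hf⟩

lemma IsAlgSet.exists_not_vanish {X : Set W} (hX : IsAlgSet X) {x : W} (hx : x ∉ X) :
    ∃ f ∈ PolyFun W, (∀ y ∈ X, f y = 0) ∧ f x ≠ 0 := by
  obtain ⟨T, hT, rfl⟩ := hX
  simp only [Set.mem_ofPred_eq, not_forall] at hx
  obtain ⟨f, hf, hfx⟩ := hx
  exact ⟨f, hT hf, fun y hy => hy f hf, hfx⟩

lemma IsIrrAlg.vanish_or {X : Set W} (hX : IsIrrAlg X) {f g : W → ℂ} (hf : f ∈ PolyFun W)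
    (hg : g ∈ PolyFun W) (h : ∀ x ∈ X, f x * g x = 0) :
    (∀ x ∈ X, f x = 0) ∨ (∀ x ∈ X, g x = 0) :=
  hX.2.2 _ _ (isAlgSet_zeros hf) (isAlgSet_zeros hg) fun x hx => mul_eq_zero.1 (h x hx)

lemma IndepOn.zcl_iff {d : ℕ} {f : Fin d → W → ℂ} (hf : ∀ i, f i ∈ PolyFun W) {A : Set W} :
    IndepOn f (zcl A) ↔ IndepOn f A := by
  refine ⟨fun h F hF => h F (zcl_vanish (polyFun_eval hf F) hF), fun h F hF => h F ?_⟩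
  exact fun x hx => hF x (subset_zcl A hx)

lemma exists_indepOn_of_chain (n : ℕ) (c : Fin (n + 1) → Set W) (hc : StrictMono c)
    (hi : ∀ i, IsIrrAlg (c i)) :
    ∃ f : Fin n → W → ℂ, (∀ i, f i ∈ PolyFun W) ∧ IndepOn f (c (Fin.last n)) := by
  induction n with
  | zero =>
    refine ⟨Fin.elim0, fun i => i.elim0, fun F hF => ?_⟩
    obtain ⟨x, hx⟩ := (hi (Fin.last 0)).1
    have := hF x hx
    rw [MvPolynomial.eq_C_of_isEmpty F] at this ⊢
    simpa using this
  | succ n ih =>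
    obtain ⟨f, hf, hind⟩ := ih (c ∘ Fin.castSucc) (hc.comp (Fin.strictMono_castSucc))
      (fun i => hi _)
    simp only [Function.comp] at hind
    have hlt : c (Fin.castSucc (Fin.last n)) < c (Fin.last (n + 1)) :=
      hc (Fin.castSucc_lt_last _)
    obtain ⟨x, hx, hx'⟩ := Set.exists_of_ssubset hlt
    obtain ⟨g, hg, hg0, hgx⟩ := (hi _).2.1.exists_not_vanish hx'
    have hfg : ∀ i, (Fin.cons g f : Fin (n + 1) → W → ℂ) i ∈ PolyFun W := by
      intro i
      refine Fin.cases ?_ (fun j => ?_) i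
      · simpa using hg
      · simpa using hf j
    refine ⟨Fin.cons g f, hfg, ?_⟩
    have hev : ∀ (F : MvPolynomial (Fin (n + 1)) ℂ) (y : W),
        MvPolynomial.eval (fun i => (Fin.cons g f : Fin (n + 1) → W → ℂ) i y) F =
        Polynomial.eval (g y) (Polynomial.map (MvPolynomial.eval fun i => f i y)
          (MvPolynomial.finSuccEquiv ℂ n F)) := by
      intro F y
      rw [← MvPolynomial.eval_eq_eval_mv_eval']
      congr 2
      funext i
      refine Fin.cases ?_ (fun j => ?_) i <;> simp
    have key : ∀ (k : ℕ) (P : Polynomial (MvPolynomial (Fin n) ℂ)), P.natDegree ≤ k →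
        (∀ y ∈ c (Fin.last (n + 1)), Polynomial.eval (g y)
          (Polynomial.map (MvPolynomial.eval fun i => f i y) P) = 0) → P = 0 := by
      intro k
      induction k with
      | zero =>
        intro P hP h
        rw [Polynomial.eq_C_of_natDegree_le_zero hP] at h ⊢
        simp only [Polynomial.map_C, Polynomial.eval_C] at h
        rw [hind _ fun y hy => h y (hlt.le hy), Polynomial.C_0]
      | succ k ihk =>
        intro P hP h
        have h0 : P.coeff 0 = 0 := by
          refine hind _ fun y hy => ?_
          have := h y (hlt.le hy)
          rwa [hg0 y hy, ← Polynomial.coeff_zero_eq_eval_zero, Polynomial.coeff_map] at this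
        have hP' : P = P.divX * Polynomial.X := by
          conv_lhs => rw [← Polynomial.divX_mul_X_add P, h0]
          simp
        have : P.divX = 0 := by
          apply ihk
          · rw [Polynomial.natDegree_divX_eq_natDegree_tsub_one]; omega
          · have := (hi (Fin.last (n + 1))).vanish_or (f := g)
              (g := fun y => Polynomial.eval (g y)
                (Polynomial.map (MvPolynomial.eval fun i => f i y) P.divX)) hg ?_ ?_
            · exact this.resolve_left fun hh => hgx (hh x hx)
            · have := polyFun_eval hfg ((MvPolynomial.finSuccEquiv ℂ n).symm P.divX)
              simpa [hev] using this
            · intro y hy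
              have := h y hy
              rw [hP'] at this
              simpa [mul_comm] using this
        rw [hP', this, zero_mul]
    intro F hF
    have := key _ (MvPolynomial.finSuccEquiv ℂ n F) le_rfl fun y hy => by
      rw [← hev]; exact hF y hy
    simpa using this

lemma exists_indepOn_of_le_adim {X : Set W} {d : ℕ} (hd : 0 < d)
    (h : (d : ℕ∞) ≤ adim X) :
    ∃ f : Fin d → W → ℂ, (∀ i, f i ∈ PolyFun W) ∧ IndepOn f X := by
  have h' : ((d - 1 : ℕ) : ℕ∞) < adim X := lt_of_lt_of_le (by exact_mod_cast (by omega)) h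
  obtain ⟨_, ⟨n, rfl, c, hc, hi⟩, hlt⟩ := lt_sSup_iff.1 h'
  have hn : d ≤ n := by have : d - 1 < n := by exact_mod_cast hlt
                        omega
  let c' : Fin (d + 1) → Set W := fun i => c (Fin.castLE (by omega) i)
  obtain ⟨f, hf, hind⟩ := exists_indepOn_of_chain d c'
    (fun i j hij => hc (by simpa using hij)) (fun i => (hi _).1)
  exact ⟨f, hf, fun F hF => hind F fun x hx => hF x ((hi _).2 hx)⟩

end DimUpper

section DimLower

open MvPolynomial

lemma aeval_fin_succ {R : Type*} [CommRing R] [Algebra ℂ R] {d : ℕ} (f : Fin (d + 1) → R)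
    (F : MvPolynomial (Fin (d + 1)) ℂ) :
    aeval f F = Polynomial.eval₂ (aeval fun i => f i.succ : MvPolynomial (Fin d) ℂ →ₐ[ℂ] R)
      (f 0) (finSuccEquiv ℂ d F) := by
  induction F using MvPolynomial.induction_on with
  | C a => simp [finSuccEquiv_apply]
  | add p q hp hq => simp [hp, hq]
  | mul_X p i hp =>
    rw [map_mul, map_mul, Polynomial.eval₂_mul, hp, aeval_X]
    congr 1
    refine Fin.cases ?_ (fun j => ?_) i <;> simp [finSuccEquiv_X_zero, finSuccEquiv_X_succ]

open scoped TensorProduct in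
lemma exists_prime_ne_bot {R : Type} [CommRing R] [Algebra ℂ R] [Algebra.FiniteType ℂ R]
    {d : ℕ} (f : Fin (d + 1) → R) (hf : ∀ F : MvPolynomial (Fin (d + 1)) ℂ, aeval f F = 0 → F = 0) :
    ∃ q : Ideal R, q.IsPrime ∧ q ≠ ⊥ ∧
      ∀ F : MvPolynomial (Fin d) ℂ, aeval (fun i => f i.succ) F ∈ q → F = 0 := by
  let P := MvPolynomial (Fin d) ℂ
  let φ : P →ₐ[ℂ] R := aeval fun i => f i.succ
  have hφ : Function.Injective φ := by
    rw [injective_iff_map_eq_zero]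
    intro F hF
    have := hf ((finSuccEquiv ℂ d).symm (Polynomial.C F)) (by
      rw [aeval_fin_succ]; simpa using hF)
    simpa using this
  let : Algebra P R := φ.toAlgebra
  have : IsScalarTower ℂ P R := IsScalarTower.of_algebraMap_eq fun x => (φ.commutes x).symm
  have : Algebra.FiniteType P R := Algebra.FiniteType.of_restrictScalars_finiteType ℂ P R
  let K := FractionRing P
  have hinj : Function.Injective (algebraMap P R) := hφ
  have : Nontrivial (K ⊗[P] R) := by
    have h1 : Function.Injective (LinearMap.lTensor K (Algebra.linearMap P R)) :=
      Module.Flat.lTensor_preserves_injective_linearMap _ hinj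
    have h2 := (TensorProduct.rid P K).symm.injective
    exact (h1.comp h2).nontrivial
  obtain ⟨m, hm⟩ := Ideal.exists_maximal (K ⊗[P] R)
  let L := (K ⊗[P] R) ⧸ m
  let : Field L := Ideal.Quotient.field m
  have : Algebra.FiniteType K L := inferInstance
  have : Module.Finite K L := finite_of_finite_type_of_isJacobsonRing K L
  let ψ : R →ₐ[P] L := (Ideal.Quotient.mkₐ P m).comp Algebra.TensorProduct.includeRight
  have hPL : Function.Injective (algebraMap P L) := by
    rw [IsScalarTower.algebraMap_eq P K L]
    exact (algebraMap K L).injective.comp (IsFractionRing.injective P K)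
  refine ⟨RingHom.ker ψ, RingHom.ker_isPrime _, ?_, ?_⟩
  · intro hbot
    have halg : IsAlgebraic P (ψ (f 0)) :=
      (IsFractionRing.isAlgebraic_iff P K L).2 
        ((Algebra.IsAlgebraic.of_finite K L).isAlgebraic _)
    obtain ⟨p, hp0, hp⟩ := halg
    have hmem : Polynomial.aeval (f 0) p ∈ RingHom.ker ψ :=
      (Polynomial.aeval_algHom_apply ψ (f 0) p).symm.trans hp
    rw [hbot, Ideal.mem_bot] at hmem
    apply hp0
    have := hf ((finSuccEquiv ℂ d).symm p) (by
      rw [aeval_fin_succ, AlgEquiv.apply_symm_apply]; exact hmem)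
    simpa using this
  · intro F hF
    have : ψ (algebraMap P R F) = 0 := hF
    rw [ψ.commutes] at this
    exact (map_eq_zero_iff _ hPL).1 this

lemma exists_prime_chain {R : Type} [CommRing R] [Algebra ℂ R] [Algebra.FiniteType ℂ R]
    {d : ℕ} (f : Fin d → R) (I : Ideal R) (hI : I.IsPrime) 
    (hf : ∀ F : MvPolynomial (Fin d) ℂ, aeval f F ∈ I → F = 0) :
    ∃ c : Fin (d + 1) → Ideal R, StrictMono c ∧ (∀ i, (c i).IsPrime) ∧ c 0 = I := by
  induction d generalizing I with
  | zero => exact ⟨fun _ => I, fun i j hij => by omega, fun _ => hI, rfl⟩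
  | succ d ih =>
    have hmk : ∀ {n : ℕ} (g : Fin n → R) (F : MvPolynomial (Fin n) ℂ),
        aeval (fun i => Ideal.Quotient.mk I (g i)) F =
        Ideal.Quotient.mk I (aeval g F) := fun g F => by
      rw [← Ideal.Quotient.mkₐ_eq_mk ℂ I, ← comp_aeval_apply]
    obtain ⟨q, hq, hq0, hqf⟩ := exists_prime_ne_bot (R := R ⧸ I)
      (fun i => Ideal.Quotient.mk I (f i)) (fun F hF => hf F (by
        rwa [hmk, Ideal.Quotient.eq_zero_iff_mem] at hF))
    obtain ⟨c, hc, hcp, hc0⟩ := ih (fun i => f i.succ) (q.comap (Ideal.Quotient.mk I))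
      inferInstance (fun F hF => hqf F (by
        rw [hmk (fun i => f i.succ)]; exact hF))
    refine ⟨Fin.cons I c, ?_, ?_, by simp⟩
    · rw [Fin.strictMono_iff_lt_succ]
      intro i
      refine Fin.cases ?_ (fun j => ?_) i
      · simp only [Fin.castSucc_zero, Fin.cons_zero, Fin.cons_succ, hc0]
        refine lt_of_le_of_ne ?_ ?_
        · intro x hx
          rw [Ideal.mem_comap, Ideal.Quotient.eq_zero_iff_mem.2 hx]
          exact q.zero_mem
        · intro h
          apply hq0
          rw [eq_bot_iff]
          intro x hx
          obtain ⟨y, rfl⟩ := Ideal.Quotient.mk_surjective x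
          have : y ∈ I := h ▸ (Ideal.mem_comap.2 hx)
          exact Ideal.Quotient.eq_zero_iff_mem.2 this
      · simp only [Fin.cons_succ]
        rw [← Fin.succ_castSucc, Fin.cons_succ]
        exact hc (Fin.castSucc_lt_succ)
    · intro i
      refine Fin.cases ?_ (fun j => ?_) i
      · simpa using hI
      · simpa using hcp j

variable {W : Type*} [AddCommGroup W] [Module ℂ W]

lemma exists_eval_of_polyFun {n : ℕ} (b : Module.Basis (Fin n) ℂ W) {f : W → ℂ}
    (hf : f ∈ PolyFun W) :
    ∃ F : MvPolynomial (Fin n) ℂ, ∀ x, f x = eval (fun i => b.repr x i) F := by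
  induction hf using Algebra.adjoin_induction with
  | mem f hf =>
    refine ⟨∑ i, C (f (b i)) * X i, fun x => ?_⟩
    let f' : W →ₗ[ℂ] ℂ := hf.mk' f
    change f' x = _
    have e := congrArg f' (b.sum_repr x)
    rw [map_sum] at e
    rw [← e]
    simp [f', IsLinearMap.mk'_apply, mul_comm]
  | algebraMap r => exact ⟨C r, fun x => by simp⟩
  | add f g _ _ hf hg =>
    obtain ⟨F, hF⟩ := hf
    obtain ⟨G, hG⟩ := hg
    exact ⟨F + G, fun x => by simp [hF, hG]⟩
  | mul f g _ _ hf hg =>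
    obtain ⟨F, hF⟩ := hf
    obtain ⟨G, hG⟩ := hg
    exact ⟨F * G, fun x => by simp [hF, hG]⟩

lemma polyFun_basis {n : ℕ} (b : Module.Basis (Fin n) ℂ W) (F : MvPolynomial (Fin n) ℂ) :
    (fun x => eval (fun i => b.repr x i) F) ∈ PolyFun W :=
  polyFun_eval (fun i => polyFun_of_dual (b.coord i)) F

/-- Zero set of an ideal in coordinates. -/
def zeroSet {n : ℕ} (b : Module.Basis (Fin n) ℂ W) (I : Ideal (MvPolynomial (Fin n) ℂ)) :
    Set W := {x | ∀ F ∈ I, eval (fun i => b.repr x i) F = 0}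

lemma isAlgSet_zeroSet {n : ℕ} (b : Module.Basis (Fin n) ℂ W)
    (I : Ideal (MvPolynomial (Fin n) ℂ)) : IsAlgSet (zeroSet b I) := by
  refine ⟨{f | ∃ F ∈ I, f = fun x => eval (fun i => b.repr x i) F}, ?_, ?_⟩
  · rintro _ ⟨F, -, rfl⟩
    exact polyFun_basis b F
  · ext x
    simp only [zeroSet, Set.mem_ofPred_eq]
    constructor
    · rintro h _ ⟨F, hF, rfl⟩
      exact h F hF
    · intro h F hF
      exact h _ ⟨F, hF, rfl⟩

lemma mem_of_vanish_zeroSet {n : ℕ} (b : Module.Basis (Fin n) ℂ W)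
    (I : Ideal (MvPolynomial (Fin n) ℂ)) (hI : I.IsPrime) (F : MvPolynomial (Fin n) ℂ)
    (h : ∀ x ∈ zeroSet b I, eval (fun i => b.repr x i) F = 0) : F ∈ I := by
  rw [← IsPrime.vanishingIdeal_zeroLocus (K := ℂ) I, mem_vanishingIdeal_iff]
  intro x hx
  have := h (b.equivFun.symm x) (fun G hG => by
    have h2 := (mem_zeroLocus_iff.1 hx) G hG
    have e : (fun i => b.repr (b.equivFun.symm x) i) = x := by
      funext i; exact congrFun (b.equivFun.apply_symm_apply x) i
    rw [e]; simpa [aeval_eq_eval] using h2)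
  have e : (fun i => b.repr (b.equivFun.symm x) i) = x := by
    funext i; exact congrFun (b.equivFun.apply_symm_apply x) i
  rw [e] at this
  simpa [aeval_eq_eval] using this

lemma isIrrAlg_zeroSet {n : ℕ} (b : Module.Basis (Fin n) ℂ W)
    (I : Ideal (MvPolynomial (Fin n) ℂ)) (hI : I.IsPrime) : IsIrrAlg (zeroSet b I) := by
  refine ⟨?_, isAlgSet_zeroSet b I, ?_⟩
  · by_contra hne
    rw [Set.not_nonempty_iff_eq_empty] at hne
    exact hI.ne_top ((Ideal.eq_top_iff_one _).2
      (mem_of_vanish_zeroSet b I hI 1 (by simp [hne])))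
  · intro Y Z hY hZ hYZ
    by_contra hcon
    rw [not_or, Set.not_subset, Set.not_subset] at hcon
    obtain ⟨⟨y, hy, hyY⟩, z, hz, hzZ⟩ := hcon
    obtain ⟨f, hf, hfY, hfy⟩ := hY.exists_not_vanish hyY
    obtain ⟨g, hg, hgZ, hgz⟩ := hZ.exists_not_vanish hzZ
    obtain ⟨F, hF⟩ := exists_eval_of_polyFun b hf
    obtain ⟨G, hG⟩ := exists_eval_of_polyFun b hg
    have : F * G ∈ I := mem_of_vanish_zeroSet b I hI _ fun x hx => by
      rw [map_mul, ← hF, ← hG]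
      rcases hYZ hx with h | h
      · rw [hfY x h, zero_mul]
      · rw [hgZ x h, mul_zero]
    rcases hI.mem_or_mem this with h | h
    · exact hfy (by rw [hF]; exact hy F h)
    · exact hgz (by rw [hG]; exact hz G h)

lemma le_adim_of_indepOn [Module.Finite ℂ W] {X : Set W} (hX : IsAlgSet X) {d : ℕ}
    {f : Fin d → W → ℂ} (hf : ∀ i, f i ∈ PolyFun W) (hind : IndepOn f X) :
    (d : ℕ∞) ≤ adim X := by
  let b := Module.finBasis ℂ W
  choose G hG using fun i => exists_eval_of_polyFun b (hf i)
  have hGe : ∀ (F : MvPolynomial (Fin d) ℂ) (x : W),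
      eval (fun i => b.repr x i) (aeval G F) = eval (fun i => f i x) F := by
    intro F x
    have : (fun i => f i x) = fun i => eval (fun j => b.repr x j) (G i) := by
      funext i; exact hG i x
    rw [this]
    exact (eval_assoc _ _ _).symm
  let I : Ideal (MvPolynomial (Fin _) ℂ) := vanishingIdeal ℂ (b.equivFun '' X)
  have hI : ∀ F, F ∈ I ↔ ∀ x ∈ X, eval (fun i => b.repr x i) F = 0 := by
    intro F
    simp only [I, mem_vanishingIdeal_iff, Set.forall_mem_image, aeval_eq_eval]
    rfl
  obtain ⟨p, hp, hIp, hdisj⟩ := Ideal.exists_le_prime_disjoint I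
    ((nonZeroDivisors (MvPolynomial (Fin d) ℂ)).map
      (aeval G : MvPolynomial (Fin d) ℂ →ₐ[ℂ] _)) (by
      rw [Set.disjoint_left]
      rintro _ hF ⟨F, hF0, rfl⟩
      refine nonZeroDivisors.ne_zero hF0 (hind F fun x hx => ?_)
      rw [← hGe]
      exact (hI _).1 hF x hx)
  obtain ⟨c, hc, hcp, hc0⟩ := exists_prime_chain G p hp (fun F hF => by
    by_contra hne
    exact Set.disjoint_left.1 hdisj hF ⟨F, mem_nonZeroDivisors_of_ne_zero hne, rfl⟩)
  apply le_sSup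
  refine ⟨d, rfl, fun i => zeroSet b (c i.rev), ?_, ?_⟩
  · intro i j hij
    have hlt : c j.rev < c i.rev := hc (Fin.rev_lt_rev.2 hij)
    refine lt_of_le_of_ne (fun x hx F hF => hx F (hlt.le hF)) fun h => ?_
    obtain ⟨F, hF, hF'⟩ := Set.exists_of_ssubset hlt
    exact hF' (mem_of_vanish_zeroSet b _ (hcp _) F fun x hx => by
      have : x ∈ zeroSet b (c i.rev) := by rw [show zeroSet b (c i.rev) = _ from h]; exact hx
      exact this F hF)
  · intro i
    refine ⟨isIrrAlg_zeroSet b _ (hcp _), fun x hx => ?_⟩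
    by_contra hxX
    obtain ⟨g, hg, hgX, hgx⟩ := hX.exists_not_vanish hxX
    obtain ⟨F, hF⟩ := exists_eval_of_polyFun b hg
    apply hgx
    rw [hF]
    refine hx F ((hc.monotone (Fin.zero_le _)) (hc0 ▸ hIp ((hI F).2 fun y hy => ?_)))
    rw [← hF]
    exact hgX y hy

end DimLower

section DimBound

open MvPolynomial

lemma exists_algebraMap_eq_of_isAlgebraic {D : Type*} [CommRing D] [IsDomain D] [Algebra ℂ D]
    {x : D} (hx : IsAlgebraic ℂ x) : ∃ c : ℂ, algebraMap ℂ D c = x := by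
  have hi := hx.isIntegral
  have h1 := IsAlgClosed.degree_eq_one_of_irreducible ℂ (minpoly.irreducible hi)
  have h2 := minpoly.aeval ℂ x
  rw [Polynomial.eq_X_add_C_of_degree_eq_one h1, (minpoly.monic hi).leadingCoeff] at h2
  refine ⟨-(minpoly ℂ x).coeff 0, ?_⟩
  simp only [map_add, map_one, one_mul, Polynomial.aeval_X, Polynomial.aeval_C] at h2
  rw [map_neg]
  linear_combination -h2

/-- Functions obtained polynomially from `m` parameters `t` and further functions `h`, each
algebraic over one of the parameters, have at most `m` algebraically independent members. -/
lemma not_indepOn_of_params {A : Type*} {ι : Type} [Finite ι] {m : ℕ} (t : Fin m → A → ℂ)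
    (h : ι → A → ℂ) (P : ι → Polynomial (Polynomial ℂ)) (j : ι → Fin m)
    (hP : ∀ i (c : ℂ), (P i).map (Polynomial.evalRingHom c) ≠ 0)
    (hrel : ∀ i a, ((P i).map (Polynomial.evalRingHom (t (j i) a))).eval (h i a) = 0)
    (g : Fin (m + 1) → MvPolynomial (Fin m ⊕ ι) ℂ) :
    ¬ IndepOn (fun i a => eval (Sum.elim (fun k => t k a) fun k => h k a) (g i)) Set.univ := by
  intro hind
  let e : A → Fin m ⊕ ι → ℂ := fun a => Sum.elim (fun k => t k a) fun k => h k a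
  let I : Ideal (MvPolynomial (Fin m ⊕ ι) ℂ) := vanishingIdeal ℂ (Set.range e)
  have hI : ∀ F, F ∈ I ↔ ∀ a, eval (e a) F = 0 := by
    intro F
    simp [I, mem_vanishingIdeal_iff, aeval_eq_eval]
  obtain ⟨p, hp, hIp, hdisj⟩ := Ideal.exists_le_prime_disjoint I
    ((nonZeroDivisors (MvPolynomial (Fin (m + 1)) ℂ)).map
      (aeval g : MvPolynomial (Fin (m + 1)) ℂ →ₐ[ℂ] _)) (by
      rw [Set.disjoint_left]
      rintro _ hF ⟨F, hF0, rfl⟩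
      refine nonZeroDivisors.ne_zero hF0 (hind F fun a _ => ?_)
      exact (eval_assoc _ _ _).trans ((hI _).1 hF a))
  let D := MvPolynomial (Fin m ⊕ ι) ℂ ⧸ p
  let π : MvPolynomial (Fin m ⊕ ι) ℂ →ₐ[ℂ] D := Ideal.Quotient.mkₐ ℂ p
  have hπ : ∀ F, π F = 0 ↔ F ∈ p := fun F => Ideal.Quotient.eq_zero_iff_mem
  have halg : AlgebraicIndependent ℂ (fun i => π (g i)) := by
    rw [algebraicIndependent_iff]
    intro F hF
    by_contra hne
    have hmem : aeval g F ∈ p := by rw [← hπ, ← hF, ← comp_aeval_apply]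
    exact Set.disjoint_left.1 hdisj hmem ⟨F, mem_nonZeroDivisors_of_ne_zero hne, rfl⟩
  let s : Set D := Set.range fun k : Fin m => π (X (Sum.inl k))
  let B := Algebra.adjoin ℂ s
  have hh : ∀ i, IsAlgebraic B (π (X (Sum.inr i))) := by
    intro i
    let tj : B := ⟨π (X (Sum.inl (j i))), Algebra.subset_adjoin ⟨j i, rfl⟩⟩
    let θ : Polynomial ℂ →ₐ[ℂ] B := Polynomial.aeval tj
    have hmem : π ((P i).eval₂ (Polynomial.aeval (X (Sum.inl (j i)) :
        MvPolynomial (Fin m ⊕ ι) ℂ)).toRingHom (X (Sum.inr i))) = 0 := by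
      rw [hπ]
      refine hIp ((hI _).2 fun a => ?_)
      rw [← hrel i a, Polynomial.eval_map, Polynomial.hom_eval₂]
      simp only [eval_X, e, Sum.elim_inr]
      congr 1
      ext x <;> simp
    have hrel' : (P i).eval₂ ((algebraMap B D).comp θ.toRingHom) (π (X (Sum.inr i))) = 0 := by
      rw [← hmem]
      change _ = π.toRingHom _
      rw [Polynomial.hom_eval₂]
      congr 1
      ext x
      · simp [θ]
      · simp [θ, tj, B]
    rw [← Polynomial.eval₂_map] at hrel'
    by_cases htr : Transcendental ℂ tj
    · refine ⟨(P i).map θ.toRingHom, ?_, hrel'⟩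
      intro h0
      have hinj : Function.Injective θ.toRingHom := transcendental_iff_injective.1 htr
      rw [Polynomial.map_eq_zero_iff hinj] at h0
      apply hP i 0
      rw [h0, Polynomial.map_zero]
    · obtain ⟨c, hc⟩ := exists_algebraMap_eq_of_isAlgebraic (not_not.1 htr)
      have hθ : θ.toRingHom = (algebraMap ℂ B).comp (Polynomial.evalRingHom c) := by
        ext x
        · exact congrArg _ ((θ.commutes x).trans (by simp))
        · simp [θ, hc]
      refine ⟨(P i).map θ.toRingHom, ?_, hrel'⟩
      rw [hθ, ← Polynomial.map_map, Polynomial.map_ne_zero_iff (algebraMap ℂ B).injective]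
      exact hP i c
  have hall : Algebra.IsAlgebraic B D := by
    refine ⟨fun x => ?_⟩
    obtain ⟨F, rfl⟩ := Ideal.Quotient.mk_surjective x
    change IsAlgebraic B (π F)
    induction F using MvPolynomial.induction_on with
    | C a =>
      have : π (C a) = algebraMap B D (algebraMap ℂ B a) := by
        rw [← IsScalarTower.algebraMap_apply]; exact π.commutes a
      rw [this]
      exact isAlgebraic_algebraMap _
    | add p q hp hq => rw [map_add]; exact hp.add hq
    | mul_X p i hp =>
      rw [map_mul]
      refine hp.mul ?_
      rcases i with i | i
      · exact isAlgebraic_algebraMap (⟨_, Algebra.subset_adjoin ⟨i, rfl⟩⟩ : B)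
      · exact hh i
  have h1 := halg.lift_cardinalMk_le_trdeg
  have h2 : Algebra.trdeg ℂ D ≤ Cardinal.mk s := Algebra.IsAlgebraic.trdeg_le_cardinalMk ℂ s
  have h3 : Cardinal.mk s ≤ m := by
    have := Cardinal.mk_range_le (f := fun k : Fin m => π (X (Sum.inl k)))
    simpa using this
  have h4 : ((m + 1 : ℕ) : Cardinal) ≤ m := by
    refine le_trans ?_ (h2.trans h3)
    simpa using h1
  have h5 : m + 1 ≤ m := by exact_mod_cast h4
  omega

/-- Polynomial functions of `m` parameters. -/
lemma not_indepOn_of_poly {A : Type*} {m : ℕ} (t : Fin m → A → ℂ)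
    (g : Fin (m + 1) → MvPolynomial (Fin m) ℂ) :
    ¬ IndepOn (fun i a => eval (fun k => t k a) (g i)) Set.univ := by
  have := not_indepOn_of_params (ι := Empty) t (fun k => k.elim) (fun k => k.elim)
    (fun k => k.elim) (fun k => k.elim) (fun k => k.elim) (fun i => rename Sum.inl (g i))
  simpa [eval_rename, Function.comp_def] using this

variable {W : Type*} [AddCommGroup W] [Module ℂ W]

/-- The closure of an image of an affine space under a polynomial map is irreducible. -/
lemma isIrrAlg_zcl_range {σ : Type*} (φ : (σ → ℂ) → W)
    (hφ : ∀ f ∈ PolyFun W, ∃ F : MvPolynomial σ ℂ, ∀ x, f (φ x) = eval x F) :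
    IsIrrAlg (zcl (Set.range φ)) := by
  refine ⟨⟨φ 0, subset_zcl _ ⟨0, rfl⟩⟩, isAlgSet_zcl _, ?_⟩
  intro Y Z hY hZ hYZ
  by_contra hcon
  rw [not_or] at hcon
  have h1 : ¬ Set.range φ ⊆ Y := fun h => hcon.1 (zcl_subset hY h)
  have h2 : ¬ Set.range φ ⊆ Z := fun h => hcon.2 (zcl_subset hZ h)
  rw [Set.not_subset] at h1 h2
  obtain ⟨_, ⟨y, rfl⟩, hy⟩ := h1
  obtain ⟨_, ⟨z, rfl⟩, hz⟩ := h2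
  obtain ⟨f, hf, hfY, hfy⟩ := hY.exists_not_vanish hy
  obtain ⟨g, hg, hgZ, hgz⟩ := hZ.exists_not_vanish hz
  obtain ⟨F, hF⟩ := hφ f hf
  obtain ⟨G, hG⟩ := hφ g hg
  have : F * G = 0 := by
    apply MvPolynomial.funext
    intro x
    rw [map_mul, ← hF, ← hG, map_zero]
    rcases hYZ (subset_zcl _ ⟨x, rfl⟩) with h | h
    · rw [hfY _ h, zero_mul]
    · rw [hgZ _ h, mul_zero]
  rcases mul_eq_zero.1 this with h | h
  · exact hfy (by rw [hF, h, map_zero])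
  · exact hgz (by rw [hG, h, map_zero])

end DimBound

section AffineModel

open MvPolynomial

variable {r : ℕ} {S : Set (Fin (r + 1) → ℂ)}

lemma polyFun_mvEval {n : ℕ} (F : MvPolynomial (Fin n) ℂ) :
    (fun x : Fin n → ℂ => eval x F) ∈ PolyFun (Fin n → ℂ) :=
  polyFun_eval (f := fun i (x : Fin n → ℂ) => x i)
    (fun i => polyFun_of_linear (LinearMap.proj i : (Fin n → ℂ) →ₗ[ℂ] ℂ).isLinear) F

lemma exists_mvEval_of_polyFun {n : ℕ} {f : (Fin n → ℂ) → ℂ} (hf : f ∈ PolyFun (Fin n → ℂ)) :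
    ∃ F : MvPolynomial (Fin n) ℂ, ∀ x, f x = eval x F := by
  obtain ⟨F, hF⟩ := exists_eval_of_polyFun (Pi.basisFun ℂ (Fin n)) hf
  exact ⟨F, fun x => by simpa using hF x⟩

lemma aeval_mul_of_isHomogeneous {σ A : Type*} [CommRing A] [Algebra ℂ A]
    {F : MvPolynomial σ ℂ} {n : ℕ} (hF : F.IsHomogeneous n) (c : A) (g : σ → A) :
    aeval (fun i => c * g i) F = c ^ n * aeval g F := by
  rw [aeval_def, aeval_def, eval₂_eq, eval₂_eq, Finset.mul_sum]
  refine Finset.sum_congr rfl fun d hd => ?_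
  have h := hF (mem_support_iff.1 hd)
  change Finsupp.weight (fun _ => 1) d = n at h
  rw [← Finsupp.degree_eq_weight_one, Finsupp.degree_apply] at h
  rw [← h]
  simp only [mul_pow, Finset.prod_mul_distrib, Finset.prod_pow_eq_pow_sum]
  ring

lemma eval_aeval {σ τ : Type*} (x : τ → ℂ) (g : σ → MvPolynomial τ ℂ) (P : MvPolynomial σ ℂ) :
    eval x (aeval g P) = eval (fun i => eval x (g i)) P :=
  (eval_assoc g x P).symm

lemma algHom_aeval {σ B C : Type*} [CommRing B] [CommRing C] [Algebra ℂ B] [Algebra ℂ C]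
    (φ : B →ₐ[ℂ] C) (g : σ → B) (P : MvPolynomial σ ℂ) :
    φ (aeval g P) = aeval (fun i => φ (g i)) P :=
  comp_aeval_apply g φ P

lemma eval_smul_of_isHomogeneous {σ : Type*} {F : MvPolynomial σ ℂ} {n : ℕ}
    (hF : F.IsHomogeneous n) (c : ℂ) (x : σ → ℂ) : eval (c • x) F = c ^ n * eval x F := by
  exact aeval_mul_of_isHomogeneous hF c x

lemma eval_smul_point {σ : Type*} (F : MvPolynomial σ ℂ) (c : ℂ) (x : σ → ℂ) :
    eval (c • x) F = ∑ i ∈ Finset.range (F.totalDegree + 1),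
      c ^ i * eval x (homogeneousComponent i F) := by
  conv_lhs => rw [← sum_homogeneousComponent F]
  rw [map_sum]
  exact Finset.sum_congr rfl fun i _ =>
    eval_smul_of_isHomogeneous (homogeneousComponent_isHomogeneous i F) c x

lemma homogeneousComponent_vanish {σ : Type*} {X : Set (σ → ℂ)}
    (hX : ∀ (c : ℂ) (x : σ → ℂ), x ∈ X → c • x ∈ X) {F : MvPolynomial σ ℂ}
    (hF : ∀ x ∈ X, eval x F = 0) (k : ℕ) :
    ∀ x ∈ X, eval x (homogeneousComponent k F) = 0 := by
  intro x hx
  by_cases hk : k < F.totalDegree + 1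
  · let P : Polynomial ℂ := ∑ i ∈ Finset.range (F.totalDegree + 1),
      Polynomial.C (eval x (homogeneousComponent i F)) * Polynomial.X ^ i
    have hP : P = 0 := by
      refine Polynomial.funext fun c => ?_
      have := hF _ (hX c x hx)
      rw [eval_smul_point] at this
      simpa only [P, Polynomial.eval_finsetSum, Polynomial.eval_mul, Polynomial.eval_C,
        Polynomial.eval_pow, Polynomial.eval_X, Polynomial.eval_zero, mul_comm] using this
    have := congrArg (fun Q => Polynomial.coeff Q k) hP
    simp only [P, Polynomial.finsetSum_coeff, Polynomial.coeff_C_mul, Polynomial.coeff_X_pow,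
      Polynomial.coeff_zero] at this
    rw [Finset.sum_eq_single k] at this
    · simpa using this
    · intro b _ hb; simp [Ne.symm hb]
    · intro h; simp [hk] at h
  · rw [homogeneousComponent_eq_zero _ _ (by omega), map_zero]

lemma exists_homogenization (F : MvPolynomial (Fin (r + 1)) ℂ) :
    ∃ N₀ : ℕ, ∀ N ≥ N₀, ∃ G : MvPolynomial (Fin (r + 1)) ℂ, ∀ x : Fin (r + 1) → ℂ, x 0 ≠ 0 →
      eval x G = x 0 ^ N * eval ((x 0)⁻¹ • x) F := by
  induction F using MvPolynomial.induction_on with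
  | C a => exact ⟨0, fun N _ => ⟨X 0 ^ N * C a, fun x hx => by simp⟩⟩
  | add p q hp hq =>
    obtain ⟨a, ha⟩ := hp
    obtain ⟨b, hb⟩ := hq
    refine ⟨max a b, fun N hN => ?_⟩
    obtain ⟨G, hG⟩ := ha N (le_trans (le_max_left _ _) hN)
    obtain ⟨H, hH⟩ := hb N (le_trans (le_max_right _ _) hN)
    exact ⟨G + H, fun x hx => by rw [map_add, hG x hx, hH x hx, map_add, mul_add]⟩
  | mul_X p i hp =>
    obtain ⟨a, ha⟩ := hp
    refine ⟨a + 1, fun N hN => ?_⟩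
    obtain ⟨G, hG⟩ := ha (N - 1) (by omega)
    obtain ⟨M, rfl⟩ : ∃ M, N = M + 1 := ⟨N - 1, by omega⟩
    refine ⟨G * X i, fun x hx => ?_⟩
    rw [map_mul, hG x hx]
    simp only [Nat.add_sub_cancel, map_mul, eval_X, Pi.smul_apply, smul_eq_mul]
    rw [pow_succ]
    linear_combination (-x 0 ^ M * eval ((x 0)⁻¹ • x) p * x i) * (mul_inv_cancel₀ hx)

lemma exists_coord_ne_zero (hnd : Nondeg S) (i : Fin (r + 1)) : ∃ x ∈ S, x i ≠ 0 := by
  by_contra! h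
  have h1 : (⊤ : Submodule ℂ (Fin (r + 1) → ℂ)) ≤
      LinearMap.ker (LinearMap.proj i : (Fin (r + 1) → ℂ) →ₗ[ℂ] ℂ) := by
    rw [← hnd, span_le]
    exact fun x hx => h x hx
  have := h1 (mem_top (x := Pi.single i (1 : ℂ)))
  simp at this

lemma vanish_or_of_irr (hS : IsIrrAlg S) {F G : MvPolynomial (Fin (r + 1)) ℂ}
    (h : ∀ x ∈ S, eval x F * eval x G = 0) :
    (∀ x ∈ S, eval x F = 0) ∨ (∀ x ∈ S, eval x G = 0) :=
  hS.vanish_or (polyFun_mvEval F) (polyFun_mvEval G) h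

/-- The ideal of the affine chart `x₀ = 1`. -/
def chartIdeal (S : Set (Fin (r + 1) → ℂ)) : Ideal (MvPolynomial (Fin (r + 1)) ℂ) :=
  vanishingIdeal ℂ {x | x ∈ S ∧ x 0 = 1}

lemma mem_chartIdeal {F : MvPolynomial (Fin (r + 1)) ℂ} :
    F ∈ chartIdeal S ↔ ∀ x ∈ S, x 0 = 1 → eval x F = 0 := by
  simp [chartIdeal, mem_vanishingIdeal_iff, aeval_eq_eval]

lemma mem_chartIdeal_iff_of_hom (hS : IsProjVar S) (hnd : Nondeg S)
    {F G : MvPolynomial (Fin (r + 1)) ℂ} {N : ℕ}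
    (hG : ∀ x : Fin (r + 1) → ℂ, x 0 ≠ 0 → eval x G = x 0 ^ N * eval ((x 0)⁻¹ • x) F) :
    F ∈ chartIdeal S ↔ ∀ x ∈ S, eval x G = 0 := by
  rw [mem_chartIdeal]
  constructor
  · intro h
    have := vanish_or_of_irr hS.2.2.1 (F := X 0) (G := G) (fun x hx => ?_)
    · refine this.resolve_left fun h0 => ?_
      obtain ⟨x, hx, hx0⟩ := exists_coord_ne_zero hnd 0
      exact hx0 (by simpa using h0 x hx)
    · by_cases hx0 : x 0 = 0
      · simp [hx0]
      · rw [hG x hx0, h _ (hS.2.1.2 _ _ hx) (by simp [hx0])]; simp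
  · intro h x hx hx0
    have := hG x (by simp [hx0])
    rw [h x hx] at this
    simpa [hx0] using this.symm

lemma chartIdeal_isPrime (hS : IsProjVar S) (hnd : Nondeg S) : (chartIdeal S).IsPrime := by
  refine ⟨?_, ?_⟩
  · rw [Ne, Ideal.eq_top_iff_one, mem_chartIdeal]
    intro h
    obtain ⟨x, hx, hx0⟩ := exists_coord_ne_zero hnd 0
    simpa using h ((x 0)⁻¹ • x) (hS.2.1.2 _ _ hx) (by simp [hx0])
  · intro F G hFG
    obtain ⟨N, hN⟩ := exists_homogenization F
    obtain ⟨M, hM⟩ := exists_homogenization G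
    obtain ⟨F', hF'⟩ := hN N le_rfl
    obtain ⟨G', hG'⟩ := hM M le_rfl
    have := (mem_chartIdeal_iff_of_hom hS hnd (F := F * G) (G := F' * G') (N := N + M)
      (fun x hx => by rw [map_mul, hF' x hx, hG' x hx, map_mul]; ring)).1 hFG
    rw [mem_chartIdeal_iff_of_hom hS hnd hF', mem_chartIdeal_iff_of_hom hS hnd hG']
    exact vanish_or_of_irr hS.2.2.1 fun x hx => by simpa using this x hx

lemma chart_dep (hS : IsProjVar S) (hdim : adim S = 3)
    (G : Fin 3 → MvPolynomial (Fin (r + 1)) ℂ) :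
    ∃ F : MvPolynomial (Fin 3) ℂ, F ≠ 0 ∧ aeval G F ∈ chartIdeal S := by
  by_contra! hcon
  choose N hN using fun i => exists_homogenization (G i)
  obtain ⟨M, hM⟩ : ∃ M, ∀ i, N i ≤ M :=
    ⟨Finset.univ.sup N, fun i => Finset.le_sup (Finset.mem_univ i)⟩
  choose G' hG' using fun i => hN i M (hM i)
  let g : Fin 4 → (Fin (r + 1) → ℂ) → ℂ := Fin.cons (fun x => x 0) fun i x => eval x (G' i)
  have hg : ∀ i, g i ∈ PolyFun (Fin (r + 1) → ℂ) := by
    intro i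
    refine Fin.cases ?_ (fun j => ?_) i
    · simpa [g] using polyFun_mvEval (X 0 : MvPolynomial (Fin (r + 1)) ℂ)
    · simpa [g] using polyFun_mvEval (G' j)
  have hind : IndepOn g S := by
    intro P hP
    have hX : (X 0 : MvPolynomial (Fin 4) ℂ) ≠ 0 := X_ne_zero 0
    have : P * X 0 = 0 := by
      refine MvPolynomial.funext fun v => ?_
      rw [map_mul, eval_X, map_zero, mul_eq_zero]
      by_cases hv : v 0 = 0
      · exact Or.inr hv
      left
      let Q : MvPolynomial (Fin 3) ℂ :=
        aeval (Fin.cons (C (v 0)) fun i => C (v 0 ^ M) * X i : Fin 4 → MvPolynomial (Fin 3) ℂ) P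
      have hQe : ∀ u : Fin 3 → ℂ, eval u Q = eval (Fin.cons (v 0) fun i => v 0 ^ M * u i) P := by
        intro u
        simp only [Q]
        rw [eval_aeval]
        congr 1
        congr 1
        funext i
        refine Fin.cases ?_ (fun j => ?_) i <;> simp
      have hQ : Q = 0 := by
        by_contra hQ
        apply hcon Q hQ
        rw [mem_chartIdeal]
        intro y hy hy0
        rw [eval_aeval, hQe]
        have := hP (v 0 • y) (hS.2.1.2 _ _ hy)
        convert this using 3
        funext i
        refine Fin.cases ?_ (fun j => ?_) i
        · simp [g, hy0]
        · simp [g, hG' j (v 0 • y) (by simpa [hy0] using hv), hy0, hv, smul_smul]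
      have := hQe fun i => (v 0 ^ M)⁻¹ * v i.succ
      rw [hQ, map_zero] at this
      rw [this]
      congr 2
      funext i
      refine Fin.cases ?_ (fun j => ?_) i
      · simp
      · simp [hv]
    exact (mul_eq_zero.1 this).resolve_right hX
  have := le_adim_of_indepOn hS.1 hg hind
  rw [hdim] at this
  exact absurd this (by decide)

/-- The coordinate ring of the affine chart `x₀ = 1`. -/
def ChartRing (S : Set (Fin (r + 1) → ℂ)) : Type :=
  MvPolynomial (Fin (r + 1)) ℂ ⧸ chartIdeal S

instance : CommRing (ChartRing S) :=
  inferInstanceAs (CommRing (MvPolynomial (Fin (r + 1)) ℂ ⧸ chartIdeal S))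

instance : Algebra ℂ (ChartRing S) :=
  inferInstanceAs (Algebra ℂ (MvPolynomial (Fin (r + 1)) ℂ ⧸ chartIdeal S))

/-- The quotient map onto the chart ring. -/
def chartMk (S : Set (Fin (r + 1) → ℂ)) : MvPolynomial (Fin (r + 1)) ℂ →ₐ[ℂ] ChartRing S :=
  Ideal.Quotient.mkₐ ℂ (chartIdeal S)

lemma chartMk_surjective : Function.Surjective (chartMk S) := Ideal.Quotient.mk_surjective

lemma chartMk_eq_zero {F : MvPolynomial (Fin (r + 1)) ℂ} : chartMk S F = 0 ↔ F ∈ chartIdeal S :=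
  Ideal.Quotient.eq_zero_iff_mem

lemma chartRing_isDomain (hS : IsProjVar S) (hnd : Nondeg S) : IsDomain (ChartRing S) :=
  (Ideal.Quotient.isDomain_iff_prime _).2 (chartIdeal_isPrime hS hnd)

/-- Evaluation of chart functions at a point of the chart. -/
def chartEval {y : Fin (r + 1) → ℂ} (hy : y ∈ S) (hy0 : y 0 = 1) : ChartRing S →ₐ[ℂ] ℂ :=
  Ideal.Quotient.liftₐ (chartIdeal S) (aeval y) fun _ hF => mem_chartIdeal.1 hF y hy hy0

lemma chartEval_mk {y : Fin (r + 1) → ℂ} (hy : y ∈ S) (hy0 : y 0 = 1)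
    (F : MvPolynomial (Fin (r + 1)) ℂ) :
    chartEval hy hy0 (chartMk S F) = eval y F := rfl

lemma three_le_trdeg_chartRing_polynomial (hS : IsProjVar S) (hnd : Nondeg S) (hdim : adim S = 3) :
    3 ≤ Algebra.trdeg ℂ (Polynomial (ChartRing S)) := by
  obtain ⟨f, hf, hind⟩ := exists_indepOn_of_le_adim (X := S) (d := 3) (by norm_num)
    (by rw [hdim]; rfl)
  choose F hF using fun i => exists_mvEval_of_polyFun (hf i)
  let Ψ : MvPolynomial (Fin (r + 1)) ℂ →ₐ[ℂ] Polynomial (ChartRing S) :=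
    aeval fun i => Polynomial.C (chartMk S (X i)) * Polynomial.X
  have hΨ : ∀ (H : MvPolynomial (Fin (r + 1)) ℂ), Ψ H = 0 → ∀ x ∈ S, eval x H = 0 := by
    intro H hH
    refine (vanish_or_of_irr hS.2.2.1 (F := X 0) (G := H) fun x hx => ?_).resolve_left fun h0 => ?_
    · by_cases hx0 : x 0 = 0
      · simp [hx0]
      · let e : Polynomial (ChartRing S) →+* ℂ := Polynomial.eval₂RingHom
          (chartEval (hS.2.1.2 (x 0)⁻¹ x hx) (by simp [hx0])).toRingHom (x 0)
        have he : e.comp Ψ.toRingHom = eval x := by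
          refine MvPolynomial.ringHom_ext (fun c => ?_) fun i => ?_
          · simp [e, Ψ, Polynomial.algebraMap_apply]
          · simp only [e, Ψ, AlgHom.toRingHom_eq_coe, RingHom.comp_apply, RingHom.coe_coe, aeval_X,
              Polynomial.coe_eval₂RingHom, Polynomial.eval₂_mul, Polynomial.eval₂_C,
              Polynomial.eval₂_X, chartEval_mk, eval_X, Pi.smul_apply, smul_eq_mul]
            field_simp
        have := congrArg (fun g => g H) he
        simp only [RingHom.comp_apply] at this
        rw [← this, show Ψ.toRingHom H = 0 from hH]
        simp
    · obtain ⟨x, hx, hx0⟩ := exists_coord_ne_zero hnd 0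
      exact hx0 (by simpa using h0 x hx)
  have hai : AlgebraicIndependent ℂ fun i => Ψ (F i) := by
    rw [algebraicIndependent_iff]
    intro P hP
    refine hind P fun x hx => ?_
    have hP' : Ψ (aeval F P) = 0 := (algHom_aeval (C := Polynomial (ChartRing S)) Ψ F P).trans hP
    have := hΨ _ hP' x hx
    rw [eval_aeval] at this
    simpa only [hF] using this
  simpa using hai.lift_cardinalMk_le_trdeg

lemma exists_trBasis_chartRing (hS : IsProjVar S) (hnd : Nondeg S) (hdim : adim S = 3) :
    ∃ a : Fin 2 → ChartRing S, IsTranscendenceBasis ℂ a := by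
  have := chartRing_isDomain hS hnd
  have h3 := three_le_trdeg_chartRing_polynomial hS hnd hdim
  rw [← trdeg_add_eq ℂ (ChartRing S),
    Polynomial.trdeg_of_isDomain] at h3
  obtain ⟨s, hs⟩ := exists_isTranscendenceBasis ℂ (ChartRing S)
  rw [← hs.cardinalMk_eq_trdeg] at h3
  have hlt : Cardinal.mk s < 3 := by
    by_contra! hge
    have : Cardinal.lift.{0} (Cardinal.mk (Fin 3)) ≤ Cardinal.lift.{0} (Cardinal.mk s) := by
      simpa using hge
    obtain ⟨e⟩ := Cardinal.lift_mk_le'.1 this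
    have hi := hs.1.comp e e.injective
    choose G hG using fun i => chartMk_surjective ((((↑) : s → ChartRing S) ∘ e) i)
    obtain ⟨F, hF0, hF⟩ := chart_dep hS hdim G
    apply hF0
    apply (algebraicIndependent_iff.1 hi)
    rw [← chartMk_eq_zero, algHom_aeval] at hF
    rw [← hF]
    congr 2
    funext i
    exact (hG i).symm
  have hfin : Finite s := Cardinal.lt_aleph0_iff_finite.1 (hlt.trans (by simp))
  have hc : Nat.card s = 2 := by
    have e : Cardinal.mk s = (Nat.card s : Cardinal) := (Nat.cast_card (α := s)).symm
    rw [e] at hlt h3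
    have h1 : Nat.card s < 3 := by exact_mod_cast hlt
    have h2 : 3 ≤ Nat.card s + 1 := by exact_mod_cast h3
    omega
  let e : Fin 2 ≃ s := (Finite.equivFinOfCardEq hc).symm
  exact ⟨fun i => (e i : ChartRing S), (isTranscendenceBasis_equiv e).2 hs⟩

lemma chart_hom_iff (hS : IsProjVar S) (hnd : Nondeg S) {F : MvPolynomial (Fin (r + 1)) ℂ}
    {N : ℕ} (hF : F.IsHomogeneous N) :
    aeval (fun i => (chartMk S (X i))) F = 0 ↔ ∀ x ∈ S, eval x F = 0 := by
  rw [← algHom_aeval, aeval_X_left_apply, chartMk_eq_zero]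
  refine mem_chartIdeal_iff_of_hom hS hnd (N := N) fun x hx => ?_
  rw [eval_smul_of_isHomogeneous hF, ← mul_assoc, ← mul_pow, mul_inv_cancel₀ hx, one_pow, one_mul]

end AffineModel

section Derivations

open MvPolynomial TensorProduct

lemma exists_derivation_of_isTranscendenceBasis {K : Type} [Field K] [Algebra ℂ K] {ι : Type}
    {a : ι → K} (ha : IsTranscendenceBasis ℂ a) (v : ι → K) :
    ∃ D : Derivation ℂ K K, ∀ j, D (a j) = v j := by
  let P := MvPolynomial ι ℂ
  let φ : P →ₐ[ℂ] K := aeval a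
  have hφ : Function.Injective φ := ha.1
  let : Algebra P K := φ.toAlgebra
  have : IsScalarTower ℂ P K := IsScalarTower.of_algebraMap_eq fun x => (φ.commutes x).symm
  have : FaithfulSMul P K := (faithfulSMul_iff_algebraMap_injective P K).2 hφ
  let F := FractionRing P
  let : Algebra F K := FractionRing.liftAlgebra P K
  have : IsScalarTower P F K := FractionRing.isScalarTower_liftAlgebra P K
  have : Algebra.IsAlgebraic P K := by
    have h := ha.isAlgebraic
    refine ⟨fun x => ?_⟩
    obtain ⟨p, hp0, hp⟩ := h.isAlgebraic x
    let e : P ≃ₐ[ℂ] Algebra.adjoin ℂ (Set.range a) := ha.1.aevalEquiv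
    refine ⟨p.map (e.symm : _ →+* P), ?_, ?_⟩
    · rwa [Ne, Polynomial.map_eq_zero_iff e.symm.injective]
    · have hc : (algebraMap P K).comp (e.symm : _ →+* P) =
          algebraMap (Algebra.adjoin ℂ (Set.range a)) K := by
        ext y
        obtain ⟨q, rfl⟩ := e.surjective y
        simp only [RingHom.comp_apply, RingHom.coe_coe, AlgEquiv.symm_apply_apply]
        exact (ha.1.algebraMap_aevalEquiv q).symm
      rw [Polynomial.aeval_def, Polynomial.eval₂_map, hc]
      exact hp
  have : Algebra.IsAlgebraic F K := IsFractionRing.comap_isAlgebraic_iff.1 this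
  have : Algebra.FormallyEtale F K := Algebra.FormallyEtale.of_isSeparable F K
  have : Algebra.FormallyEtale P F := Algebra.FormallyEtale.of_isLocalization (nonZeroDivisors P)
  have : Algebra.FormallyEtale P K := Algebra.FormallyEtale.comp P F K
  let e := KaehlerDifferential.tensorKaehlerEquivOfFormallyEtale ℂ P K
  let d : Derivation ℂ P K := mkDerivation ℂ v
  let l : K ⊗[P] Ω[P⁄ℂ] →ₗ[K] K := d.liftKaehlerDifferential.liftBaseChange K
  refine ⟨(l ∘ₗ e.symm.toLinearMap).compDer (KaehlerDifferential.D ℂ K), fun j => ?_⟩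
  have hX : algebraMap P K (X j) = a j := aeval_X a j
  have : e.symm (KaehlerDifferential.D ℂ K (a j)) = 1 ⊗ₜ KaehlerDifferential.D ℂ P (X j) := by
    rw [← hX]
    exact KaehlerDifferential.tensorKaehlerEquivOfFormallyEtale_symm_D_algebraMap ℂ P K (X j)
  change l (e.symm (KaehlerDifferential.D ℂ K (a j))) = v j
  rw [this, LinearMap.liftBaseChange_tmul, one_smul, Derivation.liftKaehlerDifferential_comp_D]
  exact mkDerivation_X ℂ v j

end Derivations

section Model

open MvPolynomial

/-- A ring of functions on an open part of a surface chart, with two commuting directions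
of differentiation and the coordinate functions of a local lift to the cone. -/
structure IsSurfModel {r : ℕ} (S : Set (Fin (r + 1) → ℂ)) {A : Type} [CommRing A] [Algebra ℂ A]
    (D : Fin 2 → Derivation ℂ A A) (f : Fin (r + 1) → A) : Prop where
  sep : ∀ a : A, a ≠ 0 → ∃ χ : A →ₐ[ℂ] ℂ, χ a ≠ 0
  dep : ∀ g : Fin 3 → A, ∃ F : MvPolynomial (Fin 3) ℂ, F ≠ 0 ∧ aeval g F = 0
  hom : ∀ (F : MvPolynomial (Fin (r + 1)) ℂ) (N : ℕ), F.IsHomogeneous N →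
    (aeval f F = 0 ↔ ∀ x ∈ S, eval x F = 0)
  jet : ∃ lam : Fin 3 → Fin (r + 1) → A, ∀ a,
    (∑ i, lam a i * f i = if a = 0 then 1 else 0) ∧
    (∑ i, lam a i * D 0 (f i) = if a = 1 then 1 else 0) ∧
    (∑ i, lam a i * D 1 (f i) = if a = 2 then 1 else 0)

lemma exists_algHom_ne_zero {A : Type} [CommRing A] [IsDomain A] [Algebra ℂ A]
    [Algebra.FiniteType ℂ A] {a : A} (ha : a ≠ 0) : ∃ χ : A →ₐ[ℂ] ℂ, χ a ≠ 0 := by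
  let B := Localization.Away a
  have : Nontrivial B := (IsLocalization.isDomain_of_le_nonZeroDivisors B
    (powers_le_nonZeroDivisors_of_noZeroDivisors ha)).toNontrivial
  obtain ⟨m, hm⟩ := Ideal.exists_maximal B
  let L := B ⧸ m
  let : Field L := Ideal.Quotient.field m
  have : Algebra.FiniteType ℂ B :=
    inferInstanceAs (Algebra.FiniteType ℂ (Localization (Submonoid.powers a)))
  have : Module.Finite ℂ L := finite_of_finite_type_of_isJacobsonRing ℂ L
  have hs : Function.Bijective (algebraMap ℂ L) :=
    IsAlgClosed.algebraMap_bijective_of_isIntegral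
  let e : ℂ ≃ₐ[ℂ] L := AlgEquiv.ofBijective (Algebra.ofId ℂ L) hs
  let ψ : A →ₐ[ℂ] L := (Ideal.Quotient.mkₐ ℂ m).comp (IsScalarTower.toAlgHom ℂ A B)
  refine ⟨e.symm.toAlgHom.comp ψ, ?_⟩
  have hu : IsUnit (ψ a) :=
    (IsLocalization.Away.algebraMap_isUnit (S := B) a).map (Ideal.Quotient.mkₐ ℂ m)
  simpa using hu.ne_zero

/-- Restriction of a derivation to a stable subalgebra. -/
def restrictDerivation {K : Type} [Field K] [Algebra ℂ K] (D : Derivation ℂ K K)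
    (B : Subalgebra ℂ K) (h : ∀ x ∈ B, D x ∈ B) : Derivation ℂ B B :=
  Derivation.mk'
    { toFun := fun x => ⟨D x, h x x.2⟩
      map_add' := fun x y => Subtype.ext (by simp)
      map_smul' := fun c x => Subtype.ext (by simp) }
    fun x y => Subtype.ext (by simp)

lemma restrictDerivation_coe {K : Type} [Field K] [Algebra ℂ K] (D : Derivation ℂ K K)
    (B : Subalgebra ℂ K) (h : ∀ x ∈ B, D x ∈ B) (x : B) :
    (restrictDerivation D B h x : K) = D x := rfl

lemma exists_jet_inverse {K : Type} [Field K] [Algebra ℂ K] {n : ℕ} {a : Fin 2 → K}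
    {D : Fin 2 → Derivation ℂ K K} (hD : ∀ i j, D i (a j) = if i = j then 1 else 0)
    {φ : Fin (n + 1) → K} (h0 : φ 0 = 1) (ha : ∀ j, a j ∈ Algebra.adjoin ℂ (Set.range φ)) :
    ∃ lam : Fin 3 → Fin (n + 1) → K, ∀ c,
      (∑ i, lam c i * φ i = if c = 0 then 1 else 0) ∧
      (∑ i, lam c i * D 0 (φ i) = if c = 1 then 1 else 0) ∧
      (∑ i, lam c i * D 1 (φ i) = if c = 2 then 1 else 0) := by
  let v : Fin 3 → Fin (n + 1) → K := ![φ, fun i => D 0 (φ i), fun i => D 1 (φ i)]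
  let T : (Fin 3 → K) →ₗ[K] (Fin (n + 1) → K) := Fintype.linearCombination K v
  have hT : LinearMap.ker T = ⊥ := by
    rw [LinearMap.ker_eq_bot']
    intro c hc
    have hc' : ∀ i, c 0 * φ i + c 1 * D 0 (φ i) + c 2 * D 1 (φ i) = 0 := by
      intro i
      have := congrFun hc i
      simpa [T, v, Fintype.linearCombination_apply, Fin.sum_univ_three] using this
    have c0 : c 0 = 0 := by simpa [h0] using hc' 0
    have hk : ∀ x ∈ Algebra.adjoin ℂ (Set.range φ), c 1 * D 0 x + c 2 * D 1 x = 0 := by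
      intro x hx
      induction hx using Algebra.adjoin_induction with
      | mem x hx => obtain ⟨i, rfl⟩ := hx; simpa [c0] using hc' i
      | algebraMap r => simp
      | add x y _ _ hx hy => simp only [map_add]; linear_combination hx + hy
      | mul x y _ _ hx hy =>
        simp only [Derivation.leibniz, smul_eq_mul]
        linear_combination y * hx + x * hy
    have c1 : c 1 = 0 := by simpa [hD] using hk _ (ha 0)
    have c2 : c 2 = 0 := by simpa [hD] using hk _ (ha 1)
    funext i
    fin_cases i <;> assumption
  obtain ⟨g, hg⟩ := T.exists_leftInverse_of_injective hT
  have key : ∀ c b, ∑ i, g (Pi.single i 1) c * v b i = if c = b then 1 else 0 := by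
    intro c b
    have h1 : T (Pi.single b 1) = v b := by simp [T]
    have h2 : g (v b) = Pi.single b 1 := by
      rw [← h1]; exact LinearMap.congr_fun hg _
    have h3 : g (v b) = ∑ i, v b i • g (Pi.single i 1) := by
      conv_lhs => rw [pi_eq_sum_univ' (v b)]
      simp
    have := congrFun (h3.symm.trans h2) c
    rw [Pi.single_apply] at this
    rw [← this]
    simp [mul_comm]
  exact ⟨fun c i => g (Pi.single i 1) c, fun c => ⟨key c 0, key c 1, key c 2⟩⟩

theorem exists_surfModel {r : ℕ} {S : Set (Fin (r + 1) → ℂ)} (hS : IsProjVar S) (hnd : Nondeg S)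
    (hdim : adim S = 3) :
    ∃ (A : Type) (_ : CommRing A) (_ : IsDomain A) (_ : Algebra ℂ A)
      (D : Fin 2 → Derivation ℂ A A) (f : Fin (r + 1) → A), IsSurfModel S D f := by
  have := chartRing_isDomain hS hnd
  obtain ⟨a, ha⟩ := exists_trBasis_chartRing hS hnd hdim
  let K := FractionRing (ChartRing S)
  let ι : ChartRing S →ₐ[ℂ] K := IsScalarTower.toAlgHom ℂ (ChartRing S) K
  have hι : Function.Injective ι := IsFractionRing.injective (ChartRing S) K
  have : Algebra.IsAlgebraic (ChartRing S) K := IsLocalization.isAlgebraic K (nonZeroDivisors _)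
  have haK : IsTranscendenceBasis ℂ fun i => ι (a i) := ha.algebraMap_comp (A := K)
  choose D hD using fun i : Fin 2 =>
    exists_derivation_of_isTranscendenceBasis haK fun j => if i = j then 1 else 0
  let φ : Fin (r + 1) → K := fun i => ι (chartMk S (X i))
  have hφ : ∀ F, ι (chartMk S F) = aeval φ F := fun F => by
    conv_lhs => rw [← aeval_X_left_apply F, algHom_aeval, algHom_aeval]
  have hmem : ∀ x, ι x ∈ Algebra.adjoin ℂ (Set.range φ) := by
    intro x
    obtain ⟨F, rfl⟩ := chartMk_surjective x
    rw [hφ, Algebra.adjoin_range_eq_range_aeval]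
    exact ⟨F, rfl⟩
  have h0 : φ 0 = 1 := by
    have : chartMk S (X 0) = 1 := by
      rw [← sub_eq_zero, ← map_one (chartMk S), ← map_sub, chartMk_eq_zero, mem_chartIdeal]
      intro x _ hx
      simp [hx]
    simp only [φ, this, map_one]
  obtain ⟨lam, hlam⟩ := exists_jet_inverse hD h0 fun j => hmem _
  obtain ⟨h, hh⟩ := IsLocalization.exist_integer_multiples_of_finite
    (nonZeroDivisors (ChartRing S))
    (Sum.elim (fun p : Fin 2 × Fin (r + 1) => D p.1 (φ p.2))
      fun p : Fin 3 × Fin (r + 1) => lam p.1 p.2 : _ → K)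
  have hιh : ι h ≠ 0 := by
    rw [Ne, map_eq_zero_iff ι hι]
    exact nonZeroDivisors.ne_zero h.2
  let B : Subalgebra ℂ K := Algebra.adjoin ℂ (insert (ι h)⁻¹ (Set.range φ))
  have hB : ∀ x, ι x ∈ B := fun x => Algebra.adjoin_mono (Set.subset_insert _ _) (hmem x)
  have hhB : (ι h)⁻¹ ∈ B := Algebra.subset_adjoin (Set.mem_insert _ _)
  have hBint : ∀ x, IsLocalization.IsInteger (ChartRing S) ((h : ChartRing S) • x) → x ∈ B := by
    rintro x ⟨y, hy⟩
    have : x = (ι h)⁻¹ * ι y := by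
      rw [eq_inv_mul_iff_mul_eq₀ hιh]
      rw [Algebra.smul_def] at hy
      exact hy.symm
    rw [this]
    exact B.mul_mem hhB (hB _)
  have hDφ : ∀ i j, D i (φ j) ∈ B := fun i j => hBint _ (hh (Sum.inl (i, j)))
  have hDι : ∀ i x, x ∈ Algebra.adjoin ℂ (Set.range φ) → D i x ∈ B := by
    intro i x hx
    have hle : Algebra.adjoin ℂ (Set.range φ) ≤ B := Algebra.adjoin_mono (Set.subset_insert _ _)
    induction hx using Algebra.adjoin_induction with
    | mem x hx => obtain ⟨j, rfl⟩ := hx; exact hDφ i j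
    | algebraMap r => simp
    | add x y _ _ hx hy => rw [map_add]; exact B.add_mem hx hy
    | mul x y hx' hy' hx hy =>
      rw [Derivation.leibniz]
      exact B.add_mem (B.mul_mem (hle hx') hy) (B.mul_mem (hle hy') hx)
  have hDB : ∀ i, ∀ x ∈ B, D i x ∈ B := by
    intro i x hx
    induction hx using Algebra.adjoin_induction with
    | mem x hx =>
      rcases hx with rfl | ⟨j, rfl⟩
      · rw [Derivation.leibniz_inv, smul_eq_mul]
        exact B.mul_mem (B.neg_mem (B.pow_mem hhB 2)) (hDι i _ (hmem _))
      · exact hDφ i j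
    | algebraMap r => simp
    | add x y _ _ hx hy => rw [map_add]; exact B.add_mem hx hy
    | mul x y hx' hy' hx hy =>
      rw [Derivation.leibniz]
      exact B.add_mem (B.mul_mem hx' hy) (B.mul_mem hy' hx)
  have hfg : B.FG := Subalgebra.fg_def.2
    ⟨_, (Set.finite_range φ).insert _, rfl⟩
  have : Algebra.FiniteType ℂ B := B.fg_iff_finiteType.1 hfg
  let f : Fin (r + 1) → B := fun i => ⟨φ i, hB _⟩
  refine ⟨B, inferInstance, inferInstance, inferInstance, fun i => restrictDerivation (D i) B (hDB i),
    f, ?_, ?_, ?_, ?_⟩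
  · exact fun a ha => exists_algHom_ne_zero ha
  · intro g
    by_contra! hcon
    have hg : AlgebraicIndependent ℂ fun i => (g i : K) := by
      refine AlgebraicIndependent.map' (f := B.val) ?_ Subtype.val_injective
      rw [algebraicIndependent_iff]
      intro F hF
      by_contra hne
      exact hcon F hne hF
    have h1 := hg.lift_cardinalMk_le_trdeg
    have h2 := haK.lift_cardinalMk_eq_trdeg
    rw [← h2] at h1
    simp at h1
    exact absurd h1 (by norm_num)
  · intro F N hF
    rw [← chart_hom_iff hS hnd hF, ← algHom_aeval, aeval_X_left_apply,
      ← map_eq_zero_iff ι hι, hφ, ← map_eq_zero_iff B.val Subtype.val_injective, algHom_aeval]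
    rfl
  · refine ⟨fun c i => ⟨lam c i, hBint _ (hh (Sum.inr (c, i)))⟩, fun c => ?_⟩
    obtain ⟨e1, e2, e3⟩ := hlam c
    refine ⟨Subtype.ext ?_, Subtype.ext ?_, Subtype.ext ?_⟩
    · simpa [f, apply_ite] using e1
    · simpa [f, apply_ite, restrictDerivation_coe] using e2
    · simpa [f, apply_ite, restrictDerivation_coe] using e3

end Model

section Taylor

open PowerSeries

variable {A : Type} [CommRing A] [Algebra ℂ A]

/-- The Taylor series `∑ Dᵏ a / k! tᵏ` as an additive map. -/
def taylorFun (D : Derivation ℂ A A) : A →ₗ[ℂ] PowerSeries A where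
  toFun a := PowerSeries.mk fun k => ((k.factorial : ℂ)⁻¹) • (D : A →ₗ[ℂ] A)^[k] a
  map_add' a b := by ext k; simp [iterate_map_add]
  map_smul' c a := by
    ext k
    simp only [coeff_mk, RingHom.id_apply, coeff_smul]
    rw [← Module.End.pow_apply, map_smul, smul_comm, Module.End.pow_apply]

lemma derivative_taylorFun (D : Derivation ℂ A A) (a : A) :
    d⁄dX A (taylorFun D a) = taylorFun D (D a) := by
  ext k
  simp only [taylorFun, LinearMap.coe_mk, AddHom.coe_mk, coeff_derivative, coeff_mk,
    Function.iterate_succ, Function.comp_apply, Nat.factorial_succ]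
  have h : ((k : A) + 1) = algebraMap ℂ A ((k : ℂ) + 1) := by simp
  rw [h, mul_comm, ← Algebra.smul_def, smul_smul]
  congr 1
  have : (k : ℂ) + 1 ≠ 0 := Nat.cast_add_one_ne_zero k
  push_cast
  field_simp

lemma taylorFun_mul (D : Derivation ℂ A A) (a b : A) :
    taylorFun D (a * b) = taylorFun D a * taylorFun D b := by
  ext n
  induction n generalizing a b with
  | zero =>
    simp only [coeff_zero_eq_constantCoeff_apply, map_mul]
    simp only [← coeff_zero_eq_constantCoeff_apply]
    simp [taylorFun]
  | succ n ih =>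
    have h1 : coeff n (d⁄dX A (taylorFun D (a * b))) =
        coeff n (d⁄dX A (taylorFun D a * taylorFun D b)) := by
      rw [derivative_taylorFun, Derivation.leibniz, Derivation.leibniz, map_add]
      simp only [smul_eq_mul, map_add, ih, derivative_taylorFun]
    rw [coeff_derivative, coeff_derivative] at h1
    have h2 : IsUnit ((n : A) + 1) := by
      have h : ((n : A) + 1) = algebraMap ℂ A ((n : ℂ) + 1) := by simp
      rw [h]
      exact (IsUnit.mk0 _ (Nat.cast_add_one_ne_zero n)).map _
    exact h2.mul_right_cancel h1

/-- The Taylor series along a derivation, as an algebra homomorphism. -/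
def taylor (D : Derivation ℂ A A) : A →ₐ[ℂ] PowerSeries A :=
  AlgHom.ofLinearMap (taylorFun D)
    (by
      ext k
      cases k with
      | zero => simp [taylorFun]
      | succ k =>
        simp only [taylorFun, LinearMap.coe_mk, AddHom.coe_mk, coeff_mk, Function.iterate_succ,
          Function.comp_apply, coeff_one]
        simp [iterate_map_zero])
    (taylorFun_mul D)

lemma derivative_taylor (D : Derivation ℂ A A) (a : A) :
    d⁄dX A (taylor D a) = taylor D (D a) := derivative_taylorFun D a

lemma coeff_zero_taylor (D : Derivation ℂ A A) (a : A) : coeff 0 (taylor D a) = a := by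
  simp [taylor, taylorFun]

lemma coeff_one_taylor (D : Derivation ℂ A A) (a : A) : coeff 1 (taylor D a) = D a := by
  simp [taylor, taylorFun]

/-- The formal arc through a point in the direction of a derivation. -/
def arc {R : Type} [CommRing R] [Algebra ℂ R] (D : Derivation ℂ A A) (χ : A →ₐ[ℂ] R) :
    A →ₐ[ℂ] PowerSeries R :=
  (PowerSeries.mapAlgHom χ).comp (taylor D)

lemma coeff_arc {R : Type} [CommRing R] [Algebra ℂ R] (D : Derivation ℂ A A) (χ : A →ₐ[ℂ] R)
    (n : ℕ) (a : A) : coeff n (arc D χ a) = χ (coeff n (taylor D a)) := by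
  exact coeff_map _ _ _

lemma derivative_arc {R : Type} [CommRing R] [Algebra ℂ R] (D : Derivation ℂ A A)
    (χ : A →ₐ[ℂ] R) (a : A) : d⁄dX R (arc D χ a) = arc D χ (D a) := by
  ext n
  rw [coeff_derivative, coeff_arc, coeff_arc, ← derivative_taylor, coeff_derivative]
  simp

lemma coeff_zero_arc {R : Type} [CommRing R] [Algebra ℂ R] (D : Derivation ℂ A A)
    (χ : A →ₐ[ℂ] R) (a : A) : coeff 0 (arc D χ a) = χ a := by
  rw [coeff_arc, coeff_zero_taylor]

lemma coeff_one_arc {R : Type} [CommRing R] [Algebra ℂ R] (D : Derivation ℂ A A)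
    (χ : A →ₐ[ℂ] R) (a : A) : coeff 1 (arc D χ a) = χ (D a) := by
  rw [coeff_arc, coeff_one_taylor]

end Taylor

section Separation

open TensorProduct MvPolynomial

/-- The complex points separate the elements of the algebra. -/
def PointSep (A : Type) [CommRing A] [Algebra ℂ A] : Prop :=
  ∀ a : A, a ≠ 0 → ∃ χ : A →ₐ[ℂ] ℂ, χ a ≠ 0

lemma PointSep.tensor {A B : Type} [CommRing A] [Algebra ℂ A] [CommRing B] [Algebra ℂ B]
    (hA : PointSep A) (hB : PointSep B) : PointSep (A ⊗[ℂ] B) := by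
  intro z hz
  let b := Module.Free.chooseBasis ℂ B
  let b' := Algebra.TensorProduct.basis A b
  obtain ⟨i, hi⟩ : ∃ i, b'.repr z i ≠ 0 := by
    by_contra! h
    exact hz ((map_eq_zero_iff b'.repr b'.repr.injective).1 (Finsupp.ext h))
  obtain ⟨χ, hχ⟩ := hA _ hi
  let ψ : A ⊗[ℂ] B →ₐ[ℂ] B := Algebra.TensorProduct.lift ((Algebra.ofId ℂ B).comp χ)
    (AlgHom.id ℂ B) fun _ _ => Commute.all _ _
  have key : ∀ w : A ⊗[ℂ] B, b.repr (ψ w) i = χ (b'.repr w i) := by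
    intro w
    induction w with
    | zero => simp
    | add x y hx hy => simp [hx, hy]
    | tmul x y =>
      rw [Algebra.TensorProduct.basis_repr_tmul]
      simp only [ψ, Algebra.TensorProduct.lift_tmul, AlgHom.comp_apply, AlgHom.id_apply,
        Algebra.ofId_apply, ← Algebra.smul_def]
      simp [Finsupp.smul_apply]
  have hne : ψ z ≠ 0 := by
    intro h
    apply hχ
    rw [← key, h]
    simp
  obtain ⟨η, hη⟩ := hB _ hne
  exact ⟨η.comp ψ, hη⟩

lemma pointSep_mvPolynomial (σ : Type) : PointSep (MvPolynomial σ ℂ) := by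
  intro F hF
  by_contra! h
  refine hF (MvPolynomial.funext fun x => ?_)
  simpa [aeval_eq_eval] using h (aeval x)

lemma exists_product (A P : Type) [CommRing A] [Algebra ℂ A] [CommRing P]
    [Algebra ℂ P] (hA : PointSep A) (hP : PointSep P) :
    ∃ (B : Type) (_ : CommRing B) (_ : Algebra ℂ B) (i : A →ₐ[ℂ] B) (j : P →ₐ[ℂ] B),
      PointSep B ∧ ∀ (R : Type) [CommRing R] [Algebra ℂ R] (φ : A →ₐ[ℂ] R)
        (c : P →ₐ[ℂ] R), ∃ ψ : B →ₐ[ℂ] R, (∀ a, ψ (i a) = φ a) ∧ ∀ x, ψ (j x) = c x := by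
  refine ⟨A ⊗[ℂ] P, inferInstance, inferInstance, Algebra.TensorProduct.includeLeft,
    Algebra.TensorProduct.includeRight, hA.tensor hP, ?_⟩
  intro R _ _ φ c
  refine ⟨Algebra.TensorProduct.lift φ c fun _ _ => Commute.all _ _, ?_, ?_⟩
  · intro a; simp
  · intro x; simp

lemma exists_triple_product (A P : Type) [CommRing A] [Algebra ℂ A] [CommRing P]
    [Algebra ℂ P] (hA : PointSep A) (hP : PointSep P) :
    ∃ (B : Type) (_ : CommRing B) (_ : Algebra ℂ B) (i : Fin 3 → A →ₐ[ℂ] B) (j : P →ₐ[ℂ] B),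
      PointSep B ∧ ∀ (R : Type) [CommRing R] [Algebra ℂ R] (φ : Fin 3 → A →ₐ[ℂ] R)
        (c : P →ₐ[ℂ] R), ∃ ψ : B →ₐ[ℂ] R, (∀ k a, ψ (i k a) = φ k a) ∧ ∀ x, ψ (j x) = c x := by
  obtain ⟨B₁, _, _, i₁, j₁, h₁, u₁⟩ := exists_product A P hA hP
  obtain ⟨B₂, _, _, i₂, j₂, h₂, u₂⟩ := exists_product A B₁ hA h₁
  obtain ⟨B₃, _, _, i₃, j₃, h₃, u₃⟩ := exists_product A B₂ hA h₂
  refine ⟨B₃, inferInstance, inferInstance, ![i₃, j₃.comp i₂, j₃.comp (j₂.comp i₁)],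
    j₃.comp (j₂.comp j₁), h₃, fun R _ _ φ c => ?_⟩
  obtain ⟨ψ₁, a₁, b₁⟩ := u₁ R (φ 2) c
  obtain ⟨ψ₂, a₂, b₂⟩ := u₂ R (φ 1) ψ₁
  obtain ⟨ψ₃, a₃, b₃⟩ := u₃ R (φ 0) ψ₂
  refine ⟨ψ₃, fun k a => ?_, fun x => ?_⟩
  · fin_cases k
    · exact a₃ a
    · exact (b₃ _).trans (a₂ a)
    · exact (b₃ _).trans ((b₂ _).trans (a₁ a))
  · exact (b₃ _).trans ((b₂ _).trans (b₁ x))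

lemma aeval_points_eq_zero {A R σ τ : Type} [CommRing A] [Algebra ℂ A] [CommRing R] [Algebra ℂ R]
    (hA : PointSep A) (f : σ → A) (G : MvPolynomial ((Fin 3 × σ) ⊕ τ) ℂ)
    (hG : ∀ (χ : Fin 3 → A →ₐ[ℂ] ℂ) (c : τ → ℂ),
      aeval (Sum.elim (fun p => χ p.1 (f p.2)) c) G = 0)
    (φ : Fin 3 → A →ₐ[ℂ] R) (c : τ → R) :
    aeval (Sum.elim (fun p => φ p.1 (f p.2)) c) G = 0 := by
  obtain ⟨B, _, _, i, j, hB, hψ⟩ :=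
    exists_triple_product A (MvPolynomial τ ℂ) hA (pointSep_mvPolynomial τ)
  have h1 : aeval (Sum.elim (fun p : Fin 3 × σ => i p.1 (f p.2)) fun k => j (X k)) G = 0 := by
    by_contra hne
    obtain ⟨χ, hχ⟩ := hB _ hne
    apply hχ
    rw [algHom_aeval, ← hG (fun k => χ.comp (i k)) (fun k => χ (j (X k)))]
    refine congrArg (fun v => aeval v G) (funext fun q => ?_)
    rcases q with q | q <;> rfl
  obtain ⟨ψ, hi, hj⟩ := hψ R φ (aeval c)
  have h2 := congrArg ψ h1
  rw [algHom_aeval, map_zero] at h2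
  rw [← h2]
  refine congrArg (fun v => aeval v G) (funext fun q => ?_)
  rcases q with q | q
  · exact (hi _ _).symm
  · exact (aeval_X c q).symm.trans (hj _).symm

/-- A polynomial vanishing along formal arcs in all directions at a point is zero. -/
lemma eq_zero_of_arcs {μ : Type} [Finite μ] (F : MvPolynomial μ ℂ) (g0 : μ → ℂ)
    (h : ∀ w : μ → ℂ, ∃ u : μ → PowerSeries ℂ, (∀ m, PowerSeries.constantCoeff (u m) = w m) ∧
      aeval (fun m => PowerSeries.C (g0 m) + PowerSeries.X * u m) F = 0) : F = 0 := by
  let F' : MvPolynomial μ ℂ := aeval (fun m => C (g0 m) + X m) F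
  have hF' : ∀ (y : μ → PowerSeries ℂ),
      aeval y F' = aeval (fun m => PowerSeries.C (g0 m) + y m) F := by
    intro y
    simp only [F', algHom_aeval, map_add, aeval_X]
    congr 2
    funext m
    rw [← algebraMap_eq, AlgHom.commutes]
    rfl
  suffices h0 : F' = 0 by
    have : aeval (fun m => X m - C (g0 m) : μ → MvPolynomial μ ℂ) F' = F := by
      simp only [F', algHom_aeval, map_add, aeval_X]
      conv_rhs => rw [← aeval_X_left_apply F]
      congr 2
      funext m
      rw [← algebraMap_eq, AlgHom.commutes]
      ring
    rw [← this, h0, map_zero]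
  by_contra hne
  obtain ⟨d, hd, hmin⟩ : ∃ d, homogeneousComponent d F' ≠ 0 ∧
      ∀ k < d, homogeneousComponent k F' = 0 := by
    classical
    have hex : ∃ d, homogeneousComponent d F' ≠ 0 := by
      by_contra! hall
      apply hne
      rw [← sum_homogeneousComponent F']
      exact Finset.sum_eq_zero fun k _ => hall k
    exact ⟨Nat.find hex, Nat.find_spec hex, fun k hk => not_not.1 (Nat.find_min hex hk)⟩
  apply hd
  refine MvPolynomial.funext fun w => ?_
  obtain ⟨u, hu, h0⟩ := h w
  rw [← hF', ← sum_homogeneousComponent F', map_sum] at h0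
  have h1 : ∀ k, aeval (fun m => PowerSeries.X * u m) (homogeneousComponent k F') =
      PowerSeries.X ^ k * aeval u (homogeneousComponent k F') := fun k =>
    aeval_mul_of_isHomogeneous (homogeneousComponent_isHomogeneous k F') _ _
  have h2 := congrArg (PowerSeries.coeff d) h0
  rw [map_sum, map_zero, Finset.sum_eq_single d] at h2
  · rw [h1, PowerSeries.coeff_X_pow_mul', if_pos le_rfl, Nat.sub_self,
      PowerSeries.coeff_zero_eq_constantCoeff_apply] at h2
    have h3 : ∀ P : MvPolynomial μ ℂ, PowerSeries.constantCoeff (aeval u P) = eval w P := by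
      intro P
      let κ : PowerSeries ℂ →ₐ[ℂ] ℂ := AlgHom.mk' PowerSeries.constantCoeff fun c x => by simp
      have := algHom_aeval κ u P
      rw [← aeval_eq_eval]
      refine this.trans (congrArg (fun v => aeval v P) (funext hu))
    rw [h3] at h2
    simpa using h2
  · intro k hk hkd
    rcases lt_or_gt_of_ne hkd with hlt | hgt
    · rw [hmin k hlt]; simp
    · rw [h1, PowerSeries.coeff_X_pow_mul', if_neg (by omega)]
  · intro hd'
    rw [homogeneousComponent_eq_zero]
    · simp
    · simpa using hd'

end Separation

section Tangent

open MvPolynomial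

variable {n : ℕ}

/-- A bilinear expression in two coordinate vectors. -/
def bil (c : Fin n → Fin n → ℂ) {R : Type} [CommRing R] [Algebra ℂ R] (u v : Fin n → R) : R :=
  ∑ i, ∑ j, c i j • (u i * v j)

lemma algHom_bil {R T : Type} [CommRing R] [Algebra ℂ R] [CommRing T] [Algebra ℂ T]
    (φ : R →ₐ[ℂ] T) (c : Fin n → Fin n → ℂ) (u v : Fin n → R) :
    φ (bil c u v) = bil c (fun i => φ (u i)) fun i => φ (v i) := by
  simp [bil]

lemma coeff_zero_bil (c : Fin n → Fin n → ℂ) (u v : Fin n → PowerSeries ℂ) :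
    PowerSeries.coeff 0 (bil c u v) =
      bil c (fun i => PowerSeries.coeff 0 (u i)) fun i => PowerSeries.coeff 0 (v i) := by
  simp only [bil, map_sum, PowerSeries.coeff_smul]
  simp

lemma coeff_one_mul' (a b : PowerSeries ℂ) : PowerSeries.coeff 1 (a * b) =
    PowerSeries.coeff 1 a * PowerSeries.coeff 0 b +
      PowerSeries.coeff 0 a * PowerSeries.coeff 1 b := by
  rw [PowerSeries.coeff_mul, Finset.Nat.antidiagonal_succ]
  simp
  ring

lemma coeff_one_bil (c : Fin n → Fin n → ℂ) (u v : Fin n → PowerSeries ℂ) :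
    PowerSeries.coeff 1 (bil c u v) =
      bil c (fun i => PowerSeries.coeff 1 (u i)) (fun i => PowerSeries.coeff 0 (v i)) +
      bil c (fun i => PowerSeries.coeff 0 (u i)) fun i => PowerSeries.coeff 1 (v i) := by
  simp only [bil, map_sum, PowerSeries.coeff_smul, coeff_one_mul', ← Finset.sum_add_distrib,
    ← smul_add]

lemma functional_eq_bil (l : ExteriorAlgebra ℂ (Fin n → ℂ) →ₗ[ℂ] ℂ) (u v : Fin n → ℂ) :
    l (ExteriorAlgebra.ι ℂ u * ExteriorAlgebra.ι ℂ v) =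
      bil (fun i j => l (ExteriorAlgebra.ι ℂ (Pi.single i 1) * ExteriorAlgebra.ι ℂ (Pi.single j 1)))
        u v := by
  conv_lhs => rw [pi_eq_sum_univ' u, pi_eq_sum_univ' v]
  simp only [bil, map_sum, map_smul, Finset.sum_mul_sum, smul_mul_smul_comm, smul_eq_mul]
  exact Finset.sum_congr rfl fun i _ => Finset.sum_congr rfl fun j _ => by ring

lemma contract_wedge {W : Type*} [AddCommGroup W] [Module ℂ W] (α : Module.Dual ℂ W)
    {x y z w : W} (h : ExteriorAlgebra.ι ℂ x * ExteriorAlgebra.ι ℂ y +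
      ExteriorAlgebra.ι ℂ z * ExteriorAlgebra.ι ℂ w = 0) :
    α x • y - α y • x + (α z • w - α w • z) = 0 := by
  have key : ∀ a b : W, CliffordAlgebra.contractLeft (Q := (0 : QuadraticForm ℂ W)) α
      (ExteriorAlgebra.ι ℂ a * ExteriorAlgebra.ι ℂ b) =
        ExteriorAlgebra.ι ℂ (α a • b - α b • a) := by
    intro a b
    rw [ExteriorAlgebra.ι, CliffordAlgebra.contractLeft_ι_mul, CliffordAlgebra.contractLeft_ι,
      map_sub, map_smul, map_smul, Algebra.algebraMap_eq_smul_one, mul_smul_comm, mul_one]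
  have h1 := congrArg (CliffordAlgebra.contractLeft (Q := (0 : QuadraticForm ℂ W)) α) h
  rw [map_add, key, key, map_zero, ← map_add] at h1
  exact (map_eq_zero_iff _ (ExteriorAlgebra.ι_leftInverse (R := ℂ) (M := W)).injective).1 h1

lemma exists_dual_of_linearIndependent {W : Type*} [AddCommGroup W] [Module ℂ W] {k : ℕ}
    {p : Fin k → W} (hp : LinearIndependent ℂ p) (c : Fin k → ℂ) :
    ∃ α : Module.Dual ℂ W, ∀ i, α (p i) = c i := by
  obtain ⟨g, hg⟩ := (Fintype.linearCombination ℂ p).exists_leftInverse_of_injective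
    (LinearMap.ker_eq_bot.2 (linearIndependent_iff_injective_fintypeLinearCombination.1 hp))
  refine ⟨(Fintype.linearCombination ℂ c).comp g, fun i => ?_⟩
  have h1 : g (p i) = Pi.single i 1 := by
    have := LinearMap.congr_fun hg (Pi.single i 1)
    simpa using this
  simp [h1]

/-- The differential of the parametrisation of lines in trisecant planes. -/
lemma wedge_tangent_injective {W : Type*} [AddCommGroup W] [Module ℂ W] {p τ : Fin 3 → W}
    (hp : LinearIndependent ℂ p) {a b c : ℂ}
    (h : ExteriorAlgebra.ι ℂ (τ 0 + τ 2 + b • p 2 + a • (p 0 + p 2)) *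
        ExteriorAlgebra.ι ℂ (p 1 + p 2) +
      ExteriorAlgebra.ι ℂ (p 0 + p 2) * ExteriorAlgebra.ι ℂ (τ 1 + τ 2 + c • p 2) = 0) :
    (∀ α : Module.Dual ℂ W, (∀ k, α (p k) = 0) → α (τ 0) = -α (τ 2) ∧ α (τ 1) = -α (τ 2)) ∧
      (τ = 0 → a = 0 ∧ b = 0 ∧ c = 0) := by
  have hli := Fintype.linearIndependent_iff.1 hp
  have hli3 : ∀ x y z : ℂ, x • p 0 + y • p 1 + z • p 2 = 0 → x = 0 ∧ y = 0 ∧ z = 0 := by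
    intro x y z hxyz
    have := hli ![x, y, z] (by simpa [Fin.sum_univ_three] using hxyz)
    exact ⟨this 0, this 1, this 2⟩
  constructor
  · intro α hα
    have h1 := contract_wedge α h
    simp only [map_add, map_smul, hα, smul_eq_mul, mul_zero, add_zero, zero_smul, sub_zero,
      zero_sub] at h1
    obtain ⟨h2, h3, -⟩ := hli3 (-(α (τ 1) + α (τ 2))) (α (τ 0) + α (τ 2))
      (α (τ 0) + α (τ 2) - (α (τ 1) + α (τ 2))) (by rw [← h1]; module)
    exact ⟨by linear_combination h3, by linear_combination -h2⟩
  · intro hτ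
    simp only [hτ, Pi.zero_apply, zero_add, add_zero] at h
    obtain ⟨α, hα⟩ := exists_dual_of_linearIndependent hp ![1, 0, 0]
    obtain ⟨β, hβ⟩ := exists_dual_of_linearIndependent hp ![0, 1, 0]
    have α0 : α (p 0) = 1 := hα 0
    have α1 : α (p 1) = 0 := hα 1
    have α2 : α (p 2) = 0 := hα 2
    have β0 : β (p 0) = 0 := hβ 0
    have β1 : β (p 1) = 1 := hβ 1
    have β2 : β (p 2) = 0 := hβ 2
    have h1 := contract_wedge α h
    have h2 := contract_wedge β h
    simp only [map_add, map_smul, α0, α1, α2, smul_eq_mul] at h1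
    simp only [map_add, map_smul, β0, β1, β2, smul_eq_mul] at h2
    obtain ⟨-, h3, h4⟩ := hli3 0 a (a + c) (by rw [← h1]; module)
    obtain ⟨-, -, h5⟩ := hli3 a 0 (b + a) (by refine (Eq.trans ?_ (congrArg Neg.neg h2)).trans neg_zero; module)
    refine ⟨h3, by linear_combination h5 - h3, by linear_combination h4 - h3⟩


variable {r : ℕ} {S : Set (Fin (r + 1) → ℂ)} {A : Type} [CommRing A] [Algebra ℂ A]
  {D : Fin 2 → Derivation ℂ A A} {f : Fin (r + 1) → A}

lemma IsSurfModel.mem (hm : IsSurfModel S D f) (hS : IsProjVar S) (χ : A →ₐ[ℂ] ℂ) :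
    (fun i => χ (f i)) ∈ S := by
  by_contra hx
  obtain ⟨P, hP, hPS, hPx⟩ := hS.1.exists_not_vanish hx
  obtain ⟨F, hF⟩ := exists_mvEval_of_polyFun hP
  apply hPx
  rw [hF, ← sum_homogeneousComponent F, map_sum]
  refine Finset.sum_eq_zero fun k _ => ?_
  have h1 := homogeneousComponent_vanish hS.2.1.2 (F := F) (fun x hx => by rw [← hF]; exact hPS x hx) k
  have h2 := congrArg χ ((hm.hom _ k (homogeneousComponent_isHomogeneous k F)).2 h1)
  rw [algHom_aeval, map_zero] at h2
  exact h2

/-- Independence of three points together with transversality of the tangent directions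
would produce a nine-dimensional family. -/
theorem IsSurfModel.star (hm : IsSurfModel S D f) (hS : IsProjVar S)
    (hdeg : adim (GhkCone S 1 2) < 9) (χ : Fin 3 → A →ₐ[ℂ] ℂ)
    (hχ : LinearIndependent ℂ fun k i => χ k (f i)) :
    ∃ a : Fin 3 → Fin 2 → ℂ, a ≠ 0 ∧ ∀ α : Module.Dual ℂ (Fin (r + 1) → ℂ),
      (∀ k, α (fun i => χ k (f i)) = 0) →
      ∀ k l, α (∑ j, a k j • fun i => χ k (D j (f i))) =
        α (∑ j, a l j • fun i => χ l (D j (f i))) := by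
  by_contra! hcon
  let p : Fin 3 → Fin (r + 1) → ℂ := fun k i => χ k (f i)
  let W := ExteriorAlgebra ℂ (Fin (r + 1) → ℂ)
  let μ := (Fin 3 × Fin 2) ⊕ Fin 3
  let τ : (μ → ℂ) → Fin 3 → Fin (r + 1) → ℂ := fun θ k =>
    ∑ j, θ (Sum.inl (k, j)) • fun i => χ k (D j (f i))
  let q₁ : Fin (r + 1) → ℂ := p 0 + p 2
  let q₂ : Fin (r + 1) → ℂ := p 1 + p 2
  let d₁ : (μ → ℂ) → Fin (r + 1) → ℂ := fun θ =>
    τ θ 0 + τ θ 2 + θ (Sum.inr 1) • p 2 + θ (Sum.inr 0) • (p 0 + p 2)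
  let d₂ : (μ → ℂ) → Fin (r + 1) → ℂ := fun θ => τ θ 1 + τ θ 2 + θ (Sum.inr 2) • p 2
  have hτa : ∀ x y, τ (x + y) = τ x + τ y := by
    intro x y; funext k
    simp only [τ, Pi.add_apply, add_smul, Finset.sum_add_distrib]
  have hτs : ∀ (c : ℂ) x, τ (c • x) = c • τ x := by
    intro c x; funext k
    simp only [τ, Pi.smul_apply, smul_eq_mul, mul_smul, Finset.smul_sum]
  let ω : (μ → ℂ) →ₗ[ℂ] W :=
    { toFun := fun θ => ExteriorAlgebra.ι ℂ (d₁ θ) * ExteriorAlgebra.ι ℂ q₂ +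
        ExteriorAlgebra.ι ℂ q₁ * ExteriorAlgebra.ι ℂ (d₂ θ)
      map_add' := fun x y => by
        have h1 : d₁ (x + y) = d₁ x + d₁ y := by
          simp only [d₁, hτa, Pi.add_apply, add_smul]; abel
        have h2 : d₂ (x + y) = d₂ x + d₂ y := by
          simp only [d₂, hτa, Pi.add_apply, add_smul]; abel
        rw [h1, h2, map_add _ (d₁ x), map_add _ (d₂ x), add_mul, mul_add]; abel
      map_smul' := fun c x => by
        have h1 : d₁ (c • x) = c • d₁ x := by
          simp only [d₁, hτs, Pi.smul_apply, smul_eq_mul, mul_smul, smul_add]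
        have h2 : d₂ (c • x) = c • d₂ x := by
          simp only [d₂, hτs, Pi.smul_apply, smul_eq_mul, mul_smul, smul_add]
        rw [h1, h2, map_smul, map_smul, smul_mul_assoc, mul_smul_comm, RingHom.id_apply, smul_add] }
  have hω : LinearMap.ker ω = ⊥ := by
    rw [LinearMap.ker_eq_bot']
    intro θ hθ
    obtain ⟨h1, h2⟩ := wedge_tangent_injective (τ := τ θ) hχ hθ
    have ha : (fun (k : Fin 3) (j : Fin 2) =>
        if k = 2 then -θ (Sum.inl (k, j)) else θ (Sum.inl (k, j))) = 0 := by
      by_contra hne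
      obtain ⟨α, hα, k, l, hkl⟩ := hcon _ hne
      apply hkl
      obtain ⟨e0, e1⟩ := h1 α hα
      have e : ∀ k, α (∑ j, (if k = 2 then -θ (Sum.inl (k, j)) else θ (Sum.inl (k, j))) •
          fun i => χ k (D j (f i))) = -α (τ θ 2) := by
        intro k
        fin_cases k
        · exact e0
        · exact e1
        · simp [τ]
      rw [e, e]
    have hθ0 : ∀ k j, θ (Sum.inl (k, j)) = 0 := by
      intro k j
      have := congrFun (congrFun ha k) j
      by_cases hk : k = 2 <;> simpa [hk] using this
    have hτ : τ θ = 0 := by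
      funext k
      simp [τ, hθ0]
    obtain ⟨a0, a1, a2⟩ := h2 hτ
    funext m
    rcases m with ⟨k, j⟩ | k
    · exact hθ0 k j
    · fin_cases k <;> assumption
  obtain ⟨Λ, hΛ⟩ := ω.exists_leftInverse_of_injective hω
  have : Module.Finite ℂ W :=
    Module.Finite.of_basis (Module.Basis.ExteriorAlgebra (Pi.basisFun ℂ (Fin (r + 1))))
  let e : Fin 9 ≃ μ := Fintype.equivOfCardEq (by simp [μ])
  let l : Fin 9 → W →ₗ[ℂ] ℂ := fun m => (LinearMap.proj (e m)).comp Λ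
  let g : Fin 9 → W → ℂ := fun m => l m
  have hg : ∀ m, g m ∈ PolyFun W := fun m => polyFun_of_linear (l m).isLinear
  refine absurd (le_adim_of_indepOn (X := GhkCone S 1 2) (isAlgSet_zcl _) hg ?_) (not_le.2 hdeg)
  refine (IndepOn.zcl_iff hg).2 fun F hF => ?_
  let c : Fin 9 → Fin (r + 1) → Fin (r + 1) → ℂ := fun m i j =>
    l m (ExteriorAlgebra.ι ℂ (Pi.single i 1) * ExteriorAlgebra.ι ℂ (Pi.single j 1))
  let G : MvPolynomial ((Fin 3 × Fin (r + 1)) ⊕ Fin 3) ℂ := aeval (fun m => bil (c m)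
    (fun i => X (Sum.inr 0) * (X (Sum.inl (0, i)) + X (Sum.inr 1) * X (Sum.inl (2, i))))
    (fun i => X (Sum.inl (1, i)) + X (Sum.inr 2) * X (Sum.inl (2, i)))) F
  have hG : ∀ {R : Type} [CommRing R] [Algebra ℂ R] (y : (Fin 3 × Fin (r + 1)) ⊕ Fin 3 → R),
      aeval y G = aeval (fun m => bil (c m)
        (fun i => y (Sum.inr 0) * (y (Sum.inl (0, i)) + y (Sum.inr 1) * y (Sum.inl (2, i))))
        (fun i => y (Sum.inl (1, i)) + y (Sum.inr 2) * y (Sum.inl (2, i)))) F := by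
    intro R _ _ y
    simp only [G, algHom_aeval, algHom_bil, map_mul, map_add, aeval_X]
  have hG0 : ∀ (η : Fin 3 → A →ₐ[ℂ] ℂ) (s : Fin 3 → ℂ),
      aeval (Sum.elim (fun q => η q.1 (f q.2)) s) G = 0 := by
    intro η s
    rw [hG, aeval_eq_eval]
    let p' : Fin 3 → Fin (r + 1) → ℂ := fun k i => η k (f i)
    let q : Fin 2 → Fin (r + 1) → ℂ := ![s 0 • (p' 0 + s 1 • p' 2), p' 1 + s 2 • p' 2]
    have hp' : ∀ k, p' k ∈ span ℂ (Set.range p') := fun k => subset_span ⟨k, rfl⟩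
    have := hF (ExteriorAlgebra.ιMulti ℂ 2 q) ⟨p', q, fun k => hm.mem hS _, fun j => by
      fin_cases j
      · exact smul_mem _ _ (add_mem (hp' 0) (smul_mem _ _ (hp' 2)))
      · exact add_mem (hp' 1) (smul_mem _ _ (hp' 2)), rfl⟩
    rw [← this]
    refine congrArg (fun v => eval v F) (funext fun m => ?_)
    simp only [g, ExteriorAlgebra.ιMulti_apply, List.ofFn_succ, List.ofFn_zero, List.prod_cons,
      List.prod_nil, mul_one]
    exact (functional_eq_bil (l m) (q 0) (q 1)).symm
  refine eq_zero_of_arcs F (fun m => bil (c m) q₁ q₂) fun w => ?_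
  let θ : μ → ℂ := fun m => w (e.symm m)
  let φ : Fin 3 → A →ₐ[ℂ] PowerSeries ℂ := fun k =>
    arc (∑ j, θ (Sum.inl (k, j)) • D j) (χ k)
  let s : Fin 3 → PowerSeries ℂ := fun k => 1 + PowerSeries.X * PowerSeries.C (θ (Sum.inr k))
  have h0 := aeval_points_eq_zero hm.sep f G hG0 φ s
  rw [hG] at h0
  have c0 : ∀ k i, PowerSeries.coeff 0 (φ k (f i)) = p k i := fun k i => coeff_zero_arc _ _ _
  have c1 : ∀ k i, PowerSeries.coeff 1 (φ k (f i)) = τ θ k i := by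
    intro k i
    rw [coeff_one_arc]
    simp [τ]
  have s0 : ∀ k, PowerSeries.coeff 0 (s k) = 1 := by simp [s]
  have s1 : ∀ k, PowerSeries.coeff 1 (s k) = θ (Sum.inr k) := by
    intro k
    simp [s, PowerSeries.coeff_one]
  have m0 : ∀ a b : PowerSeries ℂ, PowerSeries.coeff 0 (a * b) =
      PowerSeries.coeff 0 a * PowerSeries.coeff 0 b := by simp
  let Q : Fin 9 → PowerSeries ℂ := fun m => bil (c m)
    (fun i => s 0 * (φ 0 (f i) + s 1 * φ 2 (f i))) (fun i => φ 1 (f i) + s 2 * φ 2 (f i))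
  have hQ0 : ∀ m, PowerSeries.coeff 0 (Q m) = bil (c m) q₁ q₂ := by
    intro m
    simp only [Q, coeff_zero_bil, m0, map_add, s0, c0, one_mul]
    rfl
  have hQ1 : ∀ m, PowerSeries.coeff 1 (Q m) = w m := by
    intro m
    have h1 : l m (ω θ) = w m := by
      have := congrFun (LinearMap.congr_fun hΛ θ) (e m)
      simpa [l, θ] using this
    have h2 : l m (ω θ) = bil (c m) (d₁ θ) q₂ + bil (c m) q₁ (d₂ θ) := by
      change l m (_ + _) = _
      rw [map_add, functional_eq_bil, functional_eq_bil]
    rw [← h1, h2]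
    simp only [Q, coeff_one_bil, m0, coeff_one_mul', map_add, s0, s1, c0, c1, one_mul]
    congr 2
    · funext i
      simp only [d₁, Pi.add_apply, Pi.smul_apply, smul_eq_mul]
      ring
    · funext i
      simp only [d₂, Pi.add_apply, Pi.smul_apply, smul_eq_mul]
      ring
  refine ⟨fun m => PowerSeries.mk fun k => PowerSeries.coeff (k + 1) (Q m), fun m => ?_, ?_⟩
  · rw [← hQ1 m, ← PowerSeries.coeff_zero_eq_constantCoeff_apply, PowerSeries.coeff_mk]
  · rw [← h0]
    refine congrArg (fun v => aeval v F) (funext fun m => ?_)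
    change _ = Q m
    rw [add_comm, ← hQ0 m, PowerSeries.coeff_zero_eq_constantCoeff_apply]
    exact (PowerSeries.eq_X_mul_shift_add_const (Q m)).symm

end Tangent

section ZariskiOpen

variable {A : Type} [CommRing A] [Algebra ℂ A]

/-- Zariski openness of a property of complex points. -/
def ZOpen (P : (A →ₐ[ℂ] ℂ) → Prop) : Prop :=
  ∀ χ, P χ → ∃ a : A, χ a ≠ 0 ∧ ∀ η : A →ₐ[ℂ] ℂ, η a ≠ 0 → P η

lemma ZOpen.and {P Q : (A →ₐ[ℂ] ℂ) → Prop} (hP : ZOpen P) (hQ : ZOpen Q) :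
    ZOpen fun χ => P χ ∧ Q χ := by
  rintro χ ⟨h1, h2⟩
  obtain ⟨a, ha, ha'⟩ := hP χ h1
  obtain ⟨b, hb, hb'⟩ := hQ χ h2
  refine ⟨a * b, by simp [ha, hb], fun η hη => ?_⟩
  rw [map_mul] at hη
  exact ⟨ha' η (left_ne_zero_of_mul hη), hb' η (right_ne_zero_of_mul hη)⟩

lemma ZOpen.exists_and [IsDomain A] (hA : PointSep A) {P Q : (A →ₐ[ℂ] ℂ) → Prop} (hP : ZOpen P)
    (hQ : ZOpen Q) {χ₁ χ₂ : A →ₐ[ℂ] ℂ} (h₁ : P χ₁) (h₂ : Q χ₂) : ∃ χ, P χ ∧ Q χ := by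
  obtain ⟨a, ha, ha'⟩ := hP χ₁ h₁
  obtain ⟨b, hb, hb'⟩ := hQ χ₂ h₂
  have : a * b ≠ 0 := mul_ne_zero (fun h => ha (by rw [h, map_zero]))
    fun h => hb (by rw [h, map_zero])
  obtain ⟨η, hη⟩ := hA _ this
  rw [map_mul] at hη
  exact ⟨η, ha' η (left_ne_zero_of_mul hη), hb' η (right_ne_zero_of_mul hη)⟩

lemma zopen_ne_zero (a : A) : ZOpen fun χ => χ a ≠ 0 := fun _ h => ⟨a, h, fun _ => id⟩

/-- A property of triples of points that is Zariski open in each point separately. -/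
structure ZOpen₃ (R : (A →ₐ[ℂ] ℂ) → (A →ₐ[ℂ] ℂ) → (A →ₐ[ℂ] ℂ) → Prop) : Prop where
  fst : ∀ y z, ZOpen fun x => R x y z
  snd : ∀ x z, ZOpen fun y => R x y z
  trd : ∀ x y, ZOpen fun z => R x y z

lemma ZOpen₃.and {R Q : (A →ₐ[ℂ] ℂ) → (A →ₐ[ℂ] ℂ) → (A →ₐ[ℂ] ℂ) → Prop} (hR : ZOpen₃ R)
    (hQ : ZOpen₃ Q) : ZOpen₃ fun x y z => R x y z ∧ Q x y z :=
  ⟨fun y z => (hR.1 y z).and (hQ.1 y z), fun y z => (hR.2 y z).and (hQ.2 y z),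
    fun y z => (hR.3 y z).and (hQ.3 y z)⟩

lemma ZOpen₃.exists_and [IsDomain A] (hA : PointSep A)
    {R Q : (A →ₐ[ℂ] ℂ) → (A →ₐ[ℂ] ℂ) → (A →ₐ[ℂ] ℂ) → Prop} (hR : ZOpen₃ R) (hQ : ZOpen₃ Q)
    (h₁ : ∃ x y z, R x y z) (h₂ : ∃ x y z, Q x y z) : ∃ x y z, R x y z ∧ Q x y z := by
  obtain ⟨a1, a2, a3, ha⟩ := h₁
  obtain ⟨b1, b2, b3, hb⟩ := h₂
  obtain ⟨x, hx, hx'⟩ := (hR.1 a2 a3).exists_and hA (hQ.1 b2 b3) ha hb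
  obtain ⟨y, hy, hy'⟩ := (hR.2 x a3).exists_and hA (hQ.2 x b3) hx hx'
  exact ⟨x, y, (hR.3 x y).exists_and hA (hQ.3 x y) hy hy'⟩

lemma zopen_rank {n : ℕ} {κ : Type*} (u : κ → Fin n → A) (N : Submodule ℂ (Fin n → ℂ)) (d : ℕ) :
    ZOpen fun χ : A →ₐ[ℂ] ℂ =>
      d ≤ Module.finrank ℂ ↥(span ℂ (Set.range fun k i => χ (u k i)) ⊔ N) := by
  intro χ hχ
  let U : (κ ⊕ N) → Fin n → A := Sum.elim u fun x i => algebraMap ℂ A ((x : Fin n → ℂ) i)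
  have hU : ∀ η : A →ₐ[ℂ] ℂ, span ℂ (Set.range fun k i => η (U k i)) =
      span ℂ (Set.range fun k i => η (u k i)) ⊔ N := by
    intro η
    have : (Set.range fun k i => η (U k i)) = (Set.range fun k i => η (u k i)) ∪ (N : Set _) := by
      ext v
      simp [U]
    rw [this, span_union, span_eq]
  have hχ : d ≤ Module.finrank ℂ ↥(span ℂ (Set.range fun k i => χ (u k i)) ⊔ N) := hχ
  rw [← hU] at hχ
  obtain ⟨g, hgm, -, hgl⟩ :=
    Submodule.exists_fun_fin_finrank_span_eq ℂ (Set.range fun k i => χ (U k i))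
  choose k hk using hgm
  let j : Fin d → _ := fun i => k (Fin.castLE hχ i)
  have hli : LinearIndependent ℂ fun t i => χ (U (j t) i) := by
    have e : (fun t i => χ (U (j t) i)) = g ∘ Fin.castLE hχ := funext fun t => hk _
    rw [e]
    exact hgl.comp (Fin.castLE hχ) (Fin.castLE_injective hχ)
  choose α hα using fun s : Fin d => exists_dual_of_linearIndependent hli (Pi.single s 1)
  let M : Matrix (Fin d) (Fin d) A :=
    fun s t => ∑ i, algebraMap ℂ A (α s (Pi.single i 1)) * U (j t) i
  have hM : ∀ (η : A →ₐ[ℂ] ℂ), η M.det = Matrix.det fun s t => α s fun i => η (U (j t) i) := by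
    intro η
    rw [AlgHom.map_det]
    congr 1
    funext s t
    conv_rhs => rw [pi_eq_sum_univ' fun i => η (U (j t) i)]
    change η (∑ i, algebraMap ℂ A (α s (Pi.single i 1)) * U (j t) i) = _
    simp [mul_comm]
  refine ⟨M.det, ?_, fun η hη => ?_⟩
  · rw [hM]
    have : (fun s t => α s fun i => χ (U (j t) i)) = (1 : Matrix (Fin d) (Fin d) ℂ) := by
      funext s t
      rw [hα, Matrix.one_apply, Pi.single_apply]
      simp [eq_comm]
    rw [this, Matrix.det_one]
    exact one_ne_zero
  · rw [hM] at hη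
    have hl : LinearIndependent ℂ fun t i => η (U (j t) i) := by
      rw [Fintype.linearIndependent_iff]
      intro c hc t
      have : Matrix.mulVec (fun s t => α s fun i => η (U (j t) i)) c = 0 := by
        funext s
        have := congrArg (α s) hc
        simp only [map_sum, map_smul, smul_eq_mul, map_zero] at this
        simpa [Matrix.mulVec, dotProduct, mul_comm] using this
      exact congrFun (Matrix.eq_zero_of_mulVec_eq_zero hη this) t
    have h1 := finrank_span_eq_card hl
    rw [Fintype.card_fin] at h1
    change d ≤ Module.finrank ℂ ↥(span ℂ (Set.range fun k i => η (u k i)) ⊔ N)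
    rw [← h1, ← hU]
    refine Submodule.finrank_mono (span_mono ?_)
    rintro _ ⟨t, rfl⟩
    exact ⟨_, rfl⟩

end ZariskiOpen

section ConeCase

open MvPolynomial

lemma derivation_aeval {σ : Type} [Fintype σ] {A : Type} [CommRing A] [Algebra ℂ A]
    (D : Derivation ℂ A A) (g : σ → A) (F : MvPolynomial σ ℂ) :
    D (aeval g F) = ∑ i, aeval g (pderiv i F) * D (g i) := by
  classical
  induction F using MvPolynomial.induction_on with
  | C a => simp [Derivation.map_algebraMap]
  | add p q hp hq => simp only [map_add, hp, hq, add_mul, Finset.sum_add_distrib]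
  | mul_X p j hp =>
    simp only [map_mul, aeval_X, Derivation.leibniz, hp, smul_eq_mul, map_add, add_mul,
      Finset.sum_add_distrib, Finset.mul_sum]
    congr 1
    · simp [pderiv_X, Pi.single_apply, apply_ite, ite_mul]
    · exact Finset.sum_congr rfl fun i _ => by ring

variable {n : ℕ} {A : Type} [CommRing A] [Algebra ℂ A]

/-- The linear form `α` in the functions `f`. -/
def lform (f : Fin n → A) : Module.Dual ℂ (Fin n → ℂ) →ₗ[ℂ] A where
  toFun α := ∑ i, α (Pi.single i 1) • f i
  map_add' x y := by simp [add_smul, Finset.sum_add_distrib]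
  map_smul' c x := by simp [mul_smul, Finset.smul_sum]

lemma dual_apply_eq (α : Module.Dual ℂ (Fin n → ℂ)) (v : Fin n → ℂ) :
    α v = ∑ i, α (Pi.single i 1) * v i := by
  conv_lhs => rw [pi_eq_sum_univ' v]
  simp [mul_comm]

lemma algHom_lform (χ : A →ₐ[ℂ] ℂ) (f : Fin n → A) (α : Module.Dual ℂ (Fin n → ℂ)) :
    χ (lform f α) = α fun i => χ (f i) := by
  rw [dual_apply_eq]
  simp [lform]

lemma derivation_lform (D : Derivation ℂ A A) (f : Fin n → A) (α : Module.Dual ℂ (Fin n → ℂ)) :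
    D (lform f α) = lform (fun i => D (f i)) α := by
  simp [lform]

/-- The point, together with its two tangent directions. -/
def jetv (D : Fin 2 → Derivation ℂ A A) (f : Fin n → A) : Fin 3 → Fin n → A :=
  ![f, fun i => D 0 (f i), fun i => D 1 (f i)]

/-- The affine tangent space at a point. -/
def tsp (D : Fin 2 → Derivation ℂ A A) (f : Fin n → A) (χ : A →ₐ[ℂ] ℂ) :
    Submodule ℂ (Fin n → ℂ) :=
  span ℂ (Set.range fun k i => χ (jetv D f k i))

lemma pt_mem_tsp (D : Fin 2 → Derivation ℂ A A) (f : Fin n → A) (χ : A →ₐ[ℂ] ℂ) :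
    (fun i => χ (f i)) ∈ tsp D f χ := subset_span ⟨0, rfl⟩

lemma deriv_mem_tsp (D : Fin 2 → Derivation ℂ A A) (f : Fin n → A) (χ : A →ₐ[ℂ] ℂ) (j : Fin 2) :
    (fun i => χ (D j (f i))) ∈ tsp D f χ := by
  fin_cases j
  · exact subset_span ⟨1, rfl⟩
  · exact subset_span ⟨2, rfl⟩

variable {r : ℕ} {S : Set (Fin (r + 1) → ℂ)} {D : Fin 2 → Derivation ℂ A A} {f : Fin (r + 1) → A}

lemma IsSurfModel.jet_linearIndependent (hm : IsSurfModel S D f) (χ : A →ₐ[ℂ] ℂ) :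
    LinearIndependent ℂ fun k i => χ (jetv D f k i) := by
  obtain ⟨lam, hl⟩ := hm.jet
  rw [Fintype.linearIndependent_iff]
  intro c hc a
  have h1 : ∀ k, ∑ i, χ (lam a i) * χ (jetv D f k i) = if a = k then 1 else 0 := by
    intro k
    have : ∑ i, lam a i * jetv D f k i = if a = k then 1 else 0 := by
      fin_cases k
      · exact (hl a).1
      · exact (hl a).2.1
      · exact (hl a).2.2
    simpa [apply_ite χ] using congrArg χ this
  have h2 : ∑ i, χ (lam a i) * (∑ k, c k • fun i => χ (jetv D f k i)) i = 0 := by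
    rw [hc]; simp
  simp only [Finset.sum_apply, Pi.smul_apply, smul_eq_mul, Finset.mul_sum] at h2
  rw [Finset.sum_comm] at h2
  have h3 : ∑ k, c k * (∑ i, χ (lam a i) * χ (jetv D f k i)) = 0 := by
    rw [← h2]
    refine Finset.sum_congr rfl fun k _ => ?_
    rw [Finset.mul_sum]
    exact Finset.sum_congr rfl fun i _ => by ring
  simpa [h1] using h3

lemma IsSurfModel.finrank_tsp (hm : IsSurfModel S D f) (χ : A →ₐ[ℂ] ℂ) :
    Module.finrank ℂ (tsp D f χ) = 3 := by
  rw [tsp, finrank_span_eq_card (hm.jet_linearIndependent χ), Fintype.card_fin]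

lemma IsSurfModel.eq_zero_of_deriv (hm : IsSurfModel S D f) (χ : A →ₐ[ℂ] ℂ) {a : Fin 2 → ℂ} {c : ℂ}
    (h : (∑ j, a j • fun i => χ (D j (f i))) = c • fun i => χ (f i)) : a = 0 := by
  have := Fintype.linearIndependent_iff.1 (hm.jet_linearIndependent χ) ![-c, a 0, a 1] (by
    rw [Fin.sum_univ_two] at h
    simp only [Fin.sum_univ_three, jetv, Matrix.cons_val_zero, Matrix.cons_val_one, Matrix.cons_val]
    rw [add_assoc, h]
    module)
  funext j
  fin_cases j
  · exact this 1
  · exact this 2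

lemma IsSurfModel.lform_injective (hm : IsSurfModel S D f) (hnd : Nondeg S) :
    Function.Injective (lform f) := by
  rw [injective_iff_map_eq_zero]
  intro α hα
  let F : MvPolynomial (Fin (r + 1)) ℂ := ∑ i, C (α (Pi.single i 1)) * X i
  have hF : F.IsHomogeneous 1 := IsHomogeneous.sum _ _ _ fun i _ => by
    simpa using (isHomogeneous_C _ _).mul (isHomogeneous_X ℂ i)
  have h0 : aeval f F = 0 := by
    rw [← hα]
    simp [F, lform, Algebra.smul_def]
  have h1 := (hm.hom F 1 hF).1 h0
  have h2 : span ℂ S ≤ LinearMap.ker α := by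
    rw [span_le]
    intro x hx
    have := h1 x hx
    simp only [F, map_sum, map_mul, eval_C, eval_X] at this
    rw [SetLike.mem_coe, LinearMap.mem_ker, dual_apply_eq]
    exact this
  rw [hnd] at h2
  exact LinearMap.ker_eq_top.1 (top_le_iff.1 h2)

lemma IsSurfModel.exists_pt_notMem (hm : IsSurfModel S D f) (hnd : Nondeg S)
    {N : Submodule ℂ (Fin (r + 1) → ℂ)} (hN : N ≠ ⊤) : ∃ χ : A →ₐ[ℂ] ℂ, (fun i => χ (f i)) ∉ N := by
  obtain ⟨α, hα, hαN⟩ := Submodule.exists_le_ker_of_lt_top N (lt_top_iff_ne_top.2 hN)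
  obtain ⟨χ, hχ⟩ := hm.sep (lform f α)
    fun h => hα (hm.lform_injective hnd (h.trans (map_zero _).symm))
  refine ⟨χ, fun h => hχ ?_⟩
  rw [algHom_lform]
  exact hαN h

/-- If all tangent spaces contain a common vector, it is a vertex. -/
lemma IsSurfModel.isConeVar (hm : IsSurfModel S D f) (hS : IsProjVar S)
    {v : Fin (r + 1) → ℂ} (hv : v ≠ 0) (h : ∀ χ, v ∈ tsp D f χ) : IsConeVar S := by
  let dv : MvPolynomial (Fin (r + 1)) ℂ → MvPolynomial (Fin (r + 1)) ℂ :=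
    fun F => ∑ i, C (v i) * pderiv i F
  have hdv : ∀ F N, F.IsHomogeneous N → (∀ x ∈ S, eval x F = 0) → ∀ x ∈ S, eval x (dv F) = 0 := by
    intro F N hF hFS
    have h1 := (hm.hom F N hF).2 hFS
    have hd : (dv F).IsHomogeneous (N - 1) := IsHomogeneous.sum _ _ _ fun i _ => by
      simpa using (isHomogeneous_C _ _).mul (hF.pderiv (i := i))
    refine (hm.hom _ _ hd).1 ?_
    by_contra hne
    obtain ⟨χ, hχ⟩ := hm.sep _ hne
    apply hχ
    obtain ⟨c, hc⟩ := (mem_span_range_iff_exists_fun ℂ).1 (h χ)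
    have hj : ∀ k, ∑ i, χ (jetv D f k i) * χ (aeval f (pderiv i F)) = 0 := by
      have hD : ∀ j, ∑ i, χ (D j (f i)) * χ (aeval f (pderiv i F)) = 0 := by
        intro j
        have := congrArg χ (derivation_aeval (D j) f F)
        rw [h1, map_zero, map_zero, map_sum] at this
        rw [this]
        exact Finset.sum_congr rfl fun i _ => by rw [map_mul, mul_comm]
      intro k
      fin_cases k
      · have := congrArg (fun P => χ (aeval f P)) hF.sum_X_mul_pderiv
        simp only [map_sum, map_mul, aeval_X, map_nsmul, h1, smul_zero] at this
        rw [map_zero] at this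
        exact this
      · exact hD 0
      · exact hD 1
    have : χ (aeval f (dv F)) = ∑ k, c k * ∑ i, χ (jetv D f k i) * χ (aeval f (pderiv i F)) := by
      simp only [dv, map_sum, map_mul, aeval_C, ← hc, Finset.mul_sum]
      rw [Finset.sum_comm]
      refine Finset.sum_congr rfl fun i _ => ?_
      simp [Finset.sum_mul, mul_assoc]
    rw [this]
    simp [hj]
  have key : ∀ N F, F.IsHomogeneous N → (∀ x ∈ S, eval x F = 0) →
      ∀ x ∈ S, ∀ t : ℂ, eval (fun i => x i + t * v i) F = 0 := by
    intro N
    induction N with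
    | zero =>
      intro F hF hFS x hx t
      have := totalDegree_eq_zero_iff_eq_C.1 (Nat.le_zero.1 hF.totalDegree_le)
      have h2 := hFS x hx
      rw [this, eval_C] at h2 ⊢
      exact h2
    | succ N ih =>
      intro F hF hFS x hx t
      have hd : (dv F).IsHomogeneous N := IsHomogeneous.sum _ _ _ fun i _ => by
        simpa using (isHomogeneous_C _ _).mul (hF.pderiv (i := i))
      let q : Polynomial ℂ :=
        aeval (fun i => Polynomial.C (x i) + Polynomial.X * Polynomial.C (v i)) F
      have hq : ∀ s G, Polynomial.eval s
          (aeval (fun i => Polynomial.C (x i) + Polynomial.X * Polynomial.C (v i)) G) =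
            eval (fun i => x i + s * v i) G := by
        intro s G
        have := algHom_aeval (Polynomial.aeval s : Polynomial ℂ →ₐ[ℂ] ℂ)
          (fun i => Polynomial.C (x i) + Polynomial.X * Polynomial.C (v i)) G
        rw [Polynomial.coe_aeval_eq_eval, aeval_eq_eval] at this
        refine this.trans (congrArg (fun v => eval v G) (funext fun i => ?_))
        simp only [Polynomial.eval_add, Polynomial.eval_C, Polynomial.eval_mul, Polynomial.eval_X]
      have hq' : q.derivative = 0 := by
        refine Polynomial.funext fun s => ?_
        rw [Polynomial.eval_zero, ← ih _ hd (hdv F _ hF hFS) x hx s, ← hq]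
        have := derivation_aeval (Polynomial.derivative' (R := ℂ))
          (fun i => Polynomial.C (x i) + Polynomial.X * Polynomial.C (v i)) F
        refine congrArg (Polynomial.eval s) (this.trans ?_)
        simp only [dv, map_sum, map_mul, aeval_C, map_add]
        refine Finset.sum_congr rfl fun i _ => ?_
        have e1 : Polynomial.derivative' (Polynomial.C (x i)) = 0 := Polynomial.derivative_C
        have e2 : Polynomial.derivative' (Polynomial.X * Polynomial.C (v i)) = Polynomial.C (v i) := by
          refine Polynomial.derivative_mul.trans ?_
          simp
        rw [e1, e2, zero_add, mul_comm]
        rfl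
      obtain ⟨c, hc⟩ : ∃ c, q = Polynomial.C c :=
        ⟨_, Polynomial.eq_C_of_derivative_eq_zero hq'⟩
      have e0 := hq 0 F
      have et := hq t F
      rw [← et]
      have : eval (fun i => x i + 0 * v i) F = 0 := by simpa using hFS x hx
      rw [this] at e0
      change q.eval _ = _ at e0
      change q.eval _ = _
      rw [hc, Polynomial.eval_C] at e0 ⊢
      exact e0
  have hadd : ∀ x ∈ S, ∀ t : ℂ, x + t • v ∈ S := by
    intro x hx t
    by_contra hcon
    obtain ⟨P, hP, hPS, hPx⟩ := hS.1.exists_not_vanish hcon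
    obtain ⟨F, hF⟩ := exists_mvEval_of_polyFun hP
    apply hPx
    rw [hF, ← sum_homogeneousComponent F, map_sum]
    exact Finset.sum_eq_zero fun k _ => key k _ (homogeneousComponent_isHomogeneous k F)
      (homogeneousComponent_vanish hS.2.1.2 (fun x hx => by rw [← hF]; exact hPS x hx) k) x hx t
  have hz : (0 : Fin (r + 1) → ℂ) ∈ S := hS.2.1.1
  have hvS : ∀ a : ℂ, a • v ∈ S := fun a => by simpa using hadd 0 hz a
  refine ⟨v, by simpa using hvS 1, hv, fun x hx a b => ?_⟩
  exact add_comm (b • x) (a • v) ▸ hadd _ (hS.2.1.2 b x hx) a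

end ConeCase

section ConeDichotomy

variable {A : Type} [CommRing A] [Algebra ℂ A]
  {r : ℕ} {S : Set (Fin (r + 1) → ℂ)} {D : Fin 2 → Derivation ℂ A A} {f : Fin (r + 1) → A}

lemma mem_of_forall_dual {W : Type*} [AddCommGroup W] [Module ℂ W] {N : Submodule ℂ W} {w : W}
    (h : ∀ α : Module.Dual ℂ W, (∀ x ∈ N, α x = 0) → α w = 0) : w ∈ N := by
  by_contra hw
  obtain ⟨α, hα, hN⟩ := Submodule.exists_dual_map_eq_bot_of_notMem hw inferInstance
  refine hα (h α fun x hx => ?_)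
  have : α x ∈ N.map α := ⟨x, hx, rfl⟩
  rwa [hN, mem_bot] at this

lemma linearIndependent_of_notMem {W : Type*} [AddCommGroup W] [Module ℂ W] {p : Fin 3 → W}
    {T : Fin 3 → Submodule ℂ W} (hp : ∀ k, p k ∈ T k) (h0 : p 0 ∉ T 1 ⊔ T 2) (h1 : p 1 ∉ T 0 ⊔ T 2)
    (h2 : p 2 ∉ T 0 ⊔ T 1) : LinearIndependent ℂ p := by
  rw [Fintype.linearIndependent_iff]
  intro c hc
  rw [Fin.sum_univ_three] at hc
  have key : ∀ (i j k : Fin 3), c i • p i + c j • p j + c k • p k = 0 → p i ∉ T j ⊔ T k → c i = 0 := by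
    intro i j k h hi
    by_contra hne
    apply hi
    have : p i = (c i)⁻¹ • (-c j • p j + -c k • p k) := by
      rw [eq_inv_smul_iff₀ hne]
      linear_combination (norm := module) h
    rw [this]
    exact smul_mem _ _ (add_mem (smul_mem _ _ (mem_sup_left (hp j)))
      (smul_mem _ _ (mem_sup_right (hp k))))
  intro i
  fin_cases i
  · exact key 0 1 2 hc h0
  · exact key 1 0 2 (by rw [← hc]; abel) h1
  · exact key 2 0 1 (by rw [← hc]; abel) h2

/-- Three tangent spaces at points in general position share a tangent direction. -/
lemma IsSurfModel.exists_common_tangent (hm : IsSurfModel S D f) (hS : IsProjVar S)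
    (hdeg : adim (GhkCone S 1 2) < 9) (χ : Fin 3 → A →ₐ[ℂ] ℂ)
    (h0 : (fun i => χ 0 (f i)) ∉ tsp D f (χ 1) ⊔ tsp D f (χ 2))
    (h1 : (fun i => χ 1 (f i)) ∉ tsp D f (χ 0) ⊔ tsp D f (χ 2))
    (h2 : (fun i => χ 2 (f i)) ∉ tsp D f (χ 0) ⊔ tsp D f (χ 1)) :
    ∃ v ≠ 0, ∀ k, v ∈ tsp D f (χ k) := by
  let p : Fin 3 → Fin (r + 1) → ℂ := fun k i => χ k (f i)
  let T : Fin 3 → Submodule ℂ (Fin (r + 1) → ℂ) := fun k => tsp D f (χ k)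
  have hpT : ∀ k, p k ∈ T k := fun k => pt_mem_tsp D f (χ k)
  obtain ⟨a, ha, hstar⟩ := hm.star hS hdeg χ (linearIndependent_of_notMem (T := T) hpT h0 h1 h2)
  let t : Fin 3 → Fin (r + 1) → ℂ := fun k => ∑ j, a k j • fun i => χ k (D j (f i))
  have htT : ∀ k, t k ∈ T k := fun k => sum_mem fun j _ => smul_mem _ _ (deriv_mem_tsp D f (χ k) j)
  have hP : ∀ k l, ∃ c : Fin 3 → ℂ, t k - t l = c 0 • p 0 + c 1 • p 1 + c 2 • p 2 := by
    intro k l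
    have : t k - t l ∈ span ℂ (Set.range p) := by
      refine mem_of_forall_dual fun α hα => ?_
      rw [map_sub, sub_eq_zero]
      exact hstar α (fun m => hα _ (subset_span ⟨m, rfl⟩)) k l
    obtain ⟨c, hc⟩ := (mem_span_range_iff_exists_fun ℂ).1 this
    exact ⟨c, by rw [← hc, Fin.sum_univ_three]⟩
  have hz : ∀ {N : Submodule ℂ (Fin (r + 1) → ℂ)} {w : Fin (r + 1) → ℂ} {c : ℂ}, w ∉ N → c • w ∈ N →
      c = 0 := by
    intro N w c hw hc
    by_contra hne
    exact hw ((Submodule.smul_mem_iff _ hne).1 hc)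
  obtain ⟨c, hc⟩ := hP 0 1
  obtain ⟨d, hd⟩ := hP 0 2
  obtain ⟨e, he⟩ := hP 1 2
  have c2 : c 2 = 0 := hz h2 (by
    have : c 2 • p 2 = (t 0 - c 0 • p 0) + (-t 1 - c 1 • p 1) := by
      linear_combination (norm := module) -hc
    change c 2 • p 2 ∈ _
    rw [this]
    exact add_mem (mem_sup_left (sub_mem (htT 0) (smul_mem _ _ (hpT 0))))
      (mem_sup_right (sub_mem (neg_mem (htT 1)) (smul_mem _ _ (hpT 1)))))
  have d1 : d 1 = 0 := hz h1 (by
    have : d 1 • p 1 = (t 0 - d 0 • p 0) + (-t 2 - d 2 • p 2) := by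
      linear_combination (norm := module) -hd
    change d 1 • p 1 ∈ _
    rw [this]
    exact add_mem (mem_sup_left (sub_mem (htT 0) (smul_mem _ _ (hpT 0))))
      (mem_sup_right (sub_mem (neg_mem (htT 2)) (smul_mem _ _ (hpT 2)))))
  have e0 : e 0 = 0 := hz h0 (by
    have : e 0 • p 0 = (t 1 - e 1 • p 1) + (-t 2 - e 2 • p 2) := by
      linear_combination (norm := module) -he
    change e 0 • p 0 ∈ _
    rw [this]
    exact add_mem (mem_sup_left (sub_mem (htT 1) (smul_mem _ _ (hpT 1))))
      (mem_sup_right (sub_mem (neg_mem (htT 2)) (smul_mem _ _ (hpT 2)))))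
  have hcd : c 0 = d 0 := by
    refine sub_eq_zero.1 (hz h0 (c := c 0 - d 0) ?_)
    have : (c 0 - d 0) • p 0 = (-c 1 - e 1) • p 1 + (d 2 - e 2) • p 2 := by
      rw [c2] at hc; rw [d1] at hd; rw [e0] at he
      linear_combination (norm := module) -hc + hd - he
    change (c 0 - d 0) • p 0 ∈ _
    rw [this]
    exact add_mem (mem_sup_left (smul_mem _ _ (hpT 1))) (mem_sup_right (smul_mem _ _ (hpT 2)))
  refine ⟨t 0 - c 0 • p 0, fun hv => ha ?_, fun k => ?_⟩
  · have hk : ∀ k, ∃ b : ℂ, t k = b • p k := by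
      intro k
      fin_cases k
      · exact ⟨c 0, sub_eq_zero.1 hv⟩
      · refine ⟨-c 1, ?_⟩
        rw [c2] at hc
        change t 1 = _ • p 1
        linear_combination (norm := module) hv - hc
      · refine ⟨-d 2, ?_⟩
        rw [d1, ← hcd] at hd
        change t 2 = _ • p 2
        linear_combination (norm := module) hv - hd
    funext k
    obtain ⟨b, hb⟩ := hk k
    exact hm.eq_zero_of_deriv (χ k) hb
  · fin_cases k
    · exact sub_mem (htT 0) (smul_mem _ _ (hpT 0))
    · have : t 0 - c 0 • p 0 = t 1 + c 1 • p 1 := by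
        rw [c2] at hc
        linear_combination (norm := module) hc
      rw [this]
      exact add_mem (htT 1) (smul_mem _ _ (hpT 1))
    · have : t 0 - c 0 • p 0 = t 2 + d 2 • p 2 := by
        rw [d1, ← hcd] at hd
        linear_combination (norm := module) hd
      rw [this]
      exact add_mem (htT 2) (smul_mem _ _ (hpT 2))

lemma inf_le_of_pairwise {W : Type*} [AddCommGroup W] [Module ℂ W] [Module.Finite ℂ W]
    {T₁ T₂ T₃ : Submodule ℂ W} {v p : W} {e : ℕ} (hv : v ≠ 0) (h1 : v ∈ T₁) (h2 : v ∈ T₂)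
    (h3 : v ∈ T₃) (h12 : Module.finrank ℂ ↥(T₁ ⊓ T₂) = e) (h13 : Module.finrank ℂ ↥(T₃ ⊓ T₁) = e)
    (h23 : Module.finrank ℂ ↥(T₃ ⊓ T₂) = e) (hp : p ∈ T₃) (hpn : p ∉ T₁ ⊔ T₂)
    (hT : Module.finrank ℂ T₃ = 3) : T₁ ⊓ T₂ ≤ T₃ := by
  have hle : span ℂ {v} ≤ T₁ ⊓ T₂ := by simp [span_singleton_le_iff_mem, h1, h2]
  by_cases he : e ≤ 1
  · have h := eq_of_le_of_finrank_le hle (by rw [finrank_span_singleton hv, h12]; exact he)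
    rw [← h, span_singleton_le_iff_mem]
    exact h3
  · have hlt : T₃ ⊓ (T₁ ⊔ T₂) < T₃ :=
      lt_of_le_of_ne inf_le_left fun h => hpn (h.ge hp).2
    have h4 := finrank_lt_finrank_of_lt hlt
    have e1 : T₃ ⊓ T₁ = T₃ ⊓ (T₁ ⊔ T₂) :=
      eq_of_le_of_finrank_le (inf_le_inf_left _ le_sup_left) (by omega)
    have e2 : T₃ ⊓ T₂ = T₃ ⊓ (T₁ ⊔ T₂) :=
      eq_of_le_of_finrank_le (inf_le_inf_left _ le_sup_right) (by omega)
    have e3 : T₃ ⊓ T₁ = T₁ ⊓ T₂ := eq_of_le_of_finrank_le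
      (le_inf inf_le_right ((e1.trans e2.symm).le.trans inf_le_right)) (by omega)
    rw [← e3]
    exact inf_le_left

/-- If no two tangent spaces span the ambient space then the surface is a cone. -/
theorem IsSurfModel.isConeVar_of_not_spanning [IsDomain A] (hm : IsSurfModel S D f)
    (hS : IsProjVar S) (hnd : Nondeg S) (hdeg : adim (GhkCone S 1 2) < 9)
    (H : ∀ χ₁ χ₂, tsp D f χ₁ ⊔ tsp D f χ₂ ≠ ⊤) : IsConeVar S := by
  classical
  let T := tsp D f
  let pt : (A →ₐ[ℂ] ℂ) → Submodule ℂ (Fin (r + 1) → ℂ) :=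
    fun χ => span ℂ (Set.range fun (_ : Unit) i => χ (f i))
  have hpt : ∀ χ N, (fun i => χ (f i)) ∈ N → pt χ ≤ N := by
    intro χ N h
    simp only [pt, Set.range_const, span_singleton_le_iff_mem]
    exact h
  have hpt' : ∀ χ, (fun i => χ (f i)) ∈ pt χ := fun χ => subset_span ⟨(), rfl⟩
  let d := Nat.findGreatest (fun d => ∃ χ₁ χ₂, Module.finrank ℂ ↥(T χ₁ ⊔ T χ₂) = d) (r + 1)
  have hbd : ∀ N : Submodule ℂ (Fin (r + 1) → ℂ), Module.finrank ℂ N ≤ r + 1 := fun N => by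
    simpa using N.finrank_le
  have hd : ∀ χ₁ χ₂, Module.finrank ℂ ↥(T χ₁ ⊔ T χ₂) ≤ d := fun χ₁ χ₂ =>
    Nat.le_findGreatest (hbd _) ⟨χ₁, χ₂, rfl⟩
  obtain ⟨χ₀, -⟩ := hm.sep 1 one_ne_zero
  obtain ⟨x₀, y₀, hxy⟩ : ∃ χ₁ χ₂, Module.finrank ℂ ↥(T χ₁ ⊔ T χ₂) = d :=
    Nat.findGreatest_spec (P := fun d => ∃ χ₁ χ₂, Module.finrank ℂ ↥(T χ₁ ⊔ T χ₂) = d)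
      (hbd (T χ₀ ⊔ T χ₀)) ⟨χ₀, χ₀, rfl⟩
  let R : (A →ₐ[ℂ] ℂ) → (A →ₐ[ℂ] ℂ) → (A →ₐ[ℂ] ℂ) → Prop := fun x y z =>
    d + 1 ≤ Module.finrank ℂ ↥(T x ⊔ T y ⊔ pt z)
  have hlt : ∀ {N : Submodule ℂ (Fin (r + 1) → ℂ)} {z : A →ₐ[ℂ] ℂ}, (fun i => z (f i)) ∉ N →
      Module.finrank ℂ N < Module.finrank ℂ ↥(N ⊔ pt z) := fun {N z} h =>
    finrank_lt_finrank_of_lt (lt_of_le_of_ne le_sup_left fun e => h (e ▸ mem_sup_right (hpt' z)))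
  have hR : ZOpen₃ R := by
    refine ⟨fun y z => ?_, fun x z => ?_, fun x y => ?_⟩
    · have e : (fun x => R x y z) = fun x => d + 1 ≤ Module.finrank ℂ ↥(T x ⊔ (T y ⊔ pt z)) :=
        funext fun x => by simp only [R]; rw [sup_assoc]
      rw [e]
      exact zopen_rank (jetv D f) (T y ⊔ pt z) (d + 1)
    · have e : (fun y => R x y z) = fun y => d + 1 ≤ Module.finrank ℂ ↥(T y ⊔ (T x ⊔ pt z)) :=
        funext fun y => by simp only [R]; rw [sup_comm (T x), sup_assoc]
      rw [e]
      exact zopen_rank (jetv D f) (T x ⊔ pt z) (d + 1)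
    · have e : (fun z => R x y z) = fun z => d + 1 ≤ Module.finrank ℂ ↥(pt z ⊔ (T x ⊔ T y)) :=
        funext fun z => by simp only [R]; rw [sup_comm]
      rw [e]
      exact zopen_rank (fun (_ : Unit) => f) (T x ⊔ T y) (d + 1)
  have hRe : ∃ x y z, R x y z := by
    obtain ⟨z, hz⟩ := hm.exists_pt_notMem hnd (H x₀ y₀)
    exact ⟨x₀, y₀, z, by have := hlt hz; simp only [R]; simp only [T] at hxy; simp only [T]; omega⟩
  have hRR : ZOpen₃ fun x y z => R x y z ∧ R y z x ∧ R z x y :=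
    hR.and (.and ⟨fun y z => hR.3 y z, fun x z => hR.1 z x, fun x y => hR.2 y x⟩
      ⟨fun y z => hR.2 z y, fun x z => hR.3 z x, fun x y => hR.1 x y⟩)
  have hcons : ∀ {x y z}, R x y z →
      Module.finrank ℂ ↥(T x ⊓ T y) = 6 - d ∧ (fun i => z (f i)) ∉ T x ⊔ T y := by
    intro x y z h
    have h1 := hd x y
    have h2 : Module.finrank ℂ ↥(T x ⊔ T y ⊔ pt z) ≤ Module.finrank ℂ ↥(T x ⊔ T y) + 1 := by
      refine (finrank_add_le_finrank_add_finrank _ _).trans (Nat.add_le_add_left ?_ _)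
      exact finrank_range_le_card (R := ℂ) fun (_ : Unit) i => z (f i)
    have h3 := finrank_sup_add_finrank_inf_eq (T x) (T y)
    have h4 : Module.finrank ℂ (T x) = 3 := hm.finrank_tsp x
    have h5 : Module.finrank ℂ (T y) = 3 := hm.finrank_tsp y
    have h6 : d + 1 ≤ Module.finrank ℂ ↥(T x ⊔ T y ⊔ pt z) := h
    refine ⟨by omega, fun hz => ?_⟩
    rw [sup_eq_left.2 (hpt _ _ hz)] at h6
    omega
  have hcommon : ∀ {x y z}, R x y z ∧ R y z x ∧ R z x y →
      (∃ v ≠ 0, v ∈ T x ∧ v ∈ T y) ∧ T x ⊓ T y ≤ T z := by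
    rintro x y z ⟨h1, h2, h3⟩
    obtain ⟨v, hv, hvT⟩ := hm.exists_common_tangent hS hdeg ![x, y, z] (hcons h2).2
      (by have := (hcons h3).2; rw [sup_comm] at this; exact this) (hcons h1).2
    refine ⟨⟨v, hv, hvT 0, hvT 1⟩, ?_⟩
    refine inf_le_of_pairwise hv (hvT 0) (hvT 1) (hvT 2) (hcons h1).1 (hcons h3).1 ?_
      (pt_mem_tsp D f z) (hcons h1).2 (hm.finrank_tsp z)
    rw [inf_comm]
    exact (hcons h2).1
  obtain ⟨x, y, z, hxyz⟩ : ∃ x y z, R x y z ∧ R y z x ∧ R z x y := by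
    obtain ⟨a, b, c, habc⟩ := hRe
    exact hR.exists_and hm.sep (.and ⟨fun y z => hR.3 y z, fun x z => hR.1 z x, fun x y => hR.2 y x⟩
      ⟨fun y z => hR.2 z y, fun x z => hR.3 z x, fun x y => hR.1 x y⟩) ⟨a, b, c, habc⟩
      (ZOpen₃.exists_and hm.sep ⟨fun y z => hR.3 y z, fun x z => hR.1 z x, fun x y => hR.2 y x⟩
      ⟨fun y z => hR.2 z y, fun x z => hR.3 z x, fun x y => hR.1 x y⟩ ⟨c, a, b, habc⟩
        ⟨b, c, a, habc⟩)
  obtain ⟨⟨v, hv, hvx, hvy⟩, -⟩ := hcommon hxyz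
  refine hm.isConeVar hS hv fun η => ?_
  by_contra hη
  have hopen := zopen_rank (jetv D f) (span ℂ {v}) 4
  obtain ⟨ζ, h1, h2⟩ := (hRR.3 x y).exists_and hm.sep hopen hxyz (χ₂ := η) (by
    have := finrank_lt_finrank_of_lt (lt_of_le_of_ne (le_sup_left (a := tsp D f η) (b := span ℂ {v}))
      fun e => hη (e ▸ mem_sup_right (mem_span_singleton_self v)))
    rw [hm.finrank_tsp] at this
    exact this)
  have h3 : v ∈ T ζ := (hcommon h1).2 ⟨hvx, hvy⟩
  have h4 : tsp D f ζ ⊔ span ℂ {v} = tsp D f ζ :=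
    sup_eq_left.2 (by rwa [span_singleton_le_iff_mem])
  have h5 : 4 ≤ Module.finrank ℂ ↥(tsp D f ζ ⊔ span ℂ {v}) := h2
  rw [h4, hm.finrank_tsp] at h5
  omega

end ConeDichotomy

section Frame

variable {A : Type} [CommRing A] [Algebra ℂ A]
  {r : ℕ} {S : Set (Fin (r + 1) → ℂ)} {D : Fin 2 → Derivation ℂ A A} {f : Fin (r + 1) → A}

lemma exists_dual_eq {W ι : Type*} [AddCommGroup W] [Module ℂ W] [Fintype ι]
    {p : ι → W} (hp : LinearIndependent ℂ p) (c : ι → ℂ) :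
    ∃ α : Module.Dual ℂ W, ∀ i, α (p i) = c i := by
  let e := Fintype.equivFin ι
  obtain ⟨α, hα⟩ := exists_dual_of_linearIndependent
    ((linearIndependent_equiv e.symm).2 hp) (c ∘ e.symm)
  exact ⟨α, fun i => by simpa using hα (e i)⟩

/-- The value of `a` and of its two derivatives at `χ`. -/
def jval (D : Fin 2 → Derivation ℂ A A) (χ : A →ₐ[ℂ] ℂ) (a : A) : Fin 3 → ℂ :=
  ![χ a, χ (D 0 a), χ (D 1 a)]

lemma jval_lform (χ : A →ₐ[ℂ] ℂ) (α : Module.Dual ℂ (Fin (r + 1) → ℂ)) (k : Fin 3) :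
    jval D χ (lform f α) k = α fun i => χ (jetv D f k i) := by
  fin_cases k
  · exact algHom_lform χ f α
  · change χ (D 0 (lform f α)) = _
    rw [derivation_lform, algHom_lform]
    rfl
  · change χ (D 1 (lform f α)) = _
    rw [derivation_lform, algHom_lform]
    rfl

lemma dual_eq_zero_iff_jval (χ : A →ₐ[ℂ] ℂ) (α : Module.Dual ℂ (Fin (r + 1) → ℂ)) :
    (∀ v ∈ tsp D f χ, α v = 0) ↔ jval D χ (lform f α) = 0 := by
  constructor
  · intro h
    funext k
    rw [jval_lform]
    exact h _ (subset_span ⟨k, rfl⟩)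
  · intro h v hv
    have : tsp D f χ ≤ LinearMap.ker α := by
      rw [tsp, span_le]
      rintro _ ⟨k, rfl⟩
      rw [SetLike.mem_coe, LinearMap.mem_ker, ← jval_lform, h]
      rfl
    exact this hv

/-- Linear forms dual to the tangent spaces at two points. -/
lemma IsSurfModel.exists_frame (hm : IsSurfModel S D f) {χ₁ χ₂ : A →ₐ[ℂ] ℂ}
    (h : Disjoint (tsp D f χ₁) (tsp D f χ₂)) :
    ∃ x : Fin 3 → Module.Dual ℂ (Fin (r + 1) → ℂ), (∀ i, jval D χ₁ (lform f (x i)) = Pi.single i 1) ∧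
      ∀ i, jval D χ₂ (lform f (x i)) = 0 := by
  have hl := (hm.jet_linearIndependent χ₁).sum_type (hm.jet_linearIndependent χ₂) h
  choose x hx using fun i : Fin 3 => exists_dual_eq hl (Sum.elim (Pi.single i 1) 0)
  refine ⟨x, fun i => funext fun k => ?_, fun i => funext fun k => ?_⟩
  · rw [jval_lform]
    exact hx i (Sum.inl k)
  · rw [jval_lform]
    exact hx i (Sum.inr k)

/-- Wronskian of two elements. -/
def wr (D : Derivation ℂ A A) (a b : A) : A := a * D b - b * D a

theorem IsSurfModel.wr_mul_wr [IsDomain A] (hm : IsSurfModel S D f) (hS : IsProjVar S)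
    (hdeg : adim (GhkCone S 1 2) < 9) {χ₁ χ₂ : A →ₐ[ℂ] ℂ}
    {x y : Fin 3 → Module.Dual ℂ (Fin (r + 1) → ℂ)}
    (hx1 : ∀ i, jval D χ₁ (lform f (x i)) = Pi.single i 1) (hx2 : ∀ i, jval D χ₂ (lform f (x i)) = 0)
    (hy1 : ∀ i, jval D χ₁ (lform f (y i)) = 0) (hy2 : ∀ i, jval D χ₂ (lform f (y i)) = Pi.single i 1) :
    wr (D 0) (lform f (y 1)) (lform f (y 2)) * wr (D 1) (lform f (x 1)) (lform f (x 2)) =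
      wr (D 1) (lform f (y 1)) (lform f (y 2)) * wr (D 0) (lform f (x 1)) (lform f (x 2)) := by
  set X := fun i => lform f (x i)
  set Y := fun i => lform f (y i)
  have hX1 : X 1 ≠ 0 := by
    intro h
    have := congrFun (hx1 1) 1
    change jval D χ₁ (X 1) 1 = _ at this
    simp [h, jval] at this
  have hY1 : Y 1 ≠ 0 := by
    intro h
    have := congrFun (hy2 1) 1
    change jval D χ₂ (Y 1) 1 = _ at this
    simp [h, jval] at this
  suffices h : Y 1 * X 1 * (wr (D 0) (Y 1) (Y 2) * wr (D 1) (X 1) (X 2) -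
      wr (D 1) (Y 1) (Y 2) * wr (D 0) (X 1) (X 2)) = 0 by
    exact sub_eq_zero.1 ((mul_eq_zero.1 h).resolve_left (mul_ne_zero hY1 hX1))
  by_contra hne
  obtain ⟨χ₃, hχ⟩ := hm.sep _ hne
  simp only [map_mul] at hχ
  have hy : χ₃ (Y 1) ≠ 0 := left_ne_zero_of_mul (left_ne_zero_of_mul hχ)
  have hx : χ₃ (X 1) ≠ 0 := right_ne_zero_of_mul (left_ne_zero_of_mul hχ)
  have hw := right_ne_zero_of_mul hχ
  apply hw
  let χ : Fin 3 → A →ₐ[ℂ] ℂ := ![χ₁, χ₂, χ₃]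
  have ev : ∀ (η : A →ₐ[ℂ] ℂ) α, (α fun i => η (f i)) = jval D η (lform f α) 0 := fun η α =>
    (algHom_lform η f α).symm
  have evd : ∀ (η : A →ₐ[ℂ] ℂ) α (j : Fin 2),
      (α fun i => η (D j (f i))) = jval D η (lform f α) j.succ := by
    intro η α j
    rw [jval_lform]
    fin_cases j <;> rfl
  have hind : LinearIndependent ℂ fun k i => χ k (f i) := by
    rw [Fintype.linearIndependent_iff]
    intro c hc
    have key : ∀ α : Module.Dual ℂ (Fin (r + 1) → ℂ), c 0 * jval D χ₁ (lform f α) 0 +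
        c 1 * jval D χ₂ (lform f α) 0 + c 2 * χ₃ (lform f α) = 0 := by
      intro α
      have := congrArg α hc
      rw [map_zero, Fin.sum_univ_three, map_add, map_add, map_smul, map_smul, map_smul] at this
      simp only [ev] at this
      exact this
    have h2 : c 2 = 0 := by
      have := key (y 1)
      rw [hy1, hy2] at this
      simpa [hy, Y] using this
    have h0 : c 0 = 0 := by
      have := key (x 0)
      rw [hx1, hx2] at this
      simpa [h2] using this
    have h1 : c 1 = 0 := by
      have := key (y 0)
      rw [hy1, hy2] at this
      simpa [h2] using this
    intro i
    fin_cases i <;> assumption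
  obtain ⟨a, ha, hstar⟩ := hm.star hS hdeg χ hind
  have hstar' : ∀ α : Module.Dual ℂ (Fin (r + 1) → ℂ), jval D χ₁ (lform f α) 0 = 0 →
      jval D χ₂ (lform f α) 0 = 0 → χ₃ (lform f α) = 0 →
      (a 0 0 * jval D χ₁ (lform f α) 1 + a 0 1 * jval D χ₁ (lform f α) 2 =
        a 1 0 * jval D χ₂ (lform f α) 1 + a 1 1 * jval D χ₂ (lform f α) 2) ∧
      (a 0 0 * jval D χ₁ (lform f α) 1 + a 0 1 * jval D χ₁ (lform f α) 2 =
        a 2 0 * χ₃ (D 0 (lform f α)) + a 2 1 * χ₃ (D 1 (lform f α))) := by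
    intro α h1 h2 h3
    have h := hstar α (fun k => by
      rw [ev]
      fin_cases k
      exacts [h1, h2, h3])
    simp only [Fin.sum_univ_two, map_add, map_smul, smul_eq_mul, evd] at h
    exact ⟨h 0 1, h 0 2⟩
  have lc : ∀ (s t : ℂ) (α β : Module.Dual ℂ (Fin (r + 1) → ℂ)) (η : A →ₐ[ℂ] ℂ) k,
      jval D η (lform f (s • α - t • β)) k =
        s * jval D η (lform f α) k - t * jval D η (lform f β) k := by
    intro s t α β η k
    simp only [jval_lform, LinearMap.sub_apply, LinearMap.smul_apply, smul_eq_mul]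
  have lc0 : ∀ (s t : ℂ) (α β : Module.Dual ℂ (Fin (r + 1) → ℂ)) (η : A →ₐ[ℂ] ℂ),
      η (lform f (s • α - t • β)) = s * η (lform f α) - t * η (lform f β) := by
    intro s t α β η
    simp
  have lcd : ∀ (s t : ℂ) (α β : Module.Dual ℂ (Fin (r + 1) → ℂ)) (η : A →ₐ[ℂ] ℂ) j,
      η (D j (lform f (s • α - t • β))) = s * η (D j (lform f α)) - t * η (D j (lform f β)) := by
    intro s t α β η j
    simp
  have hy' := hstar' (χ₃ (Y 1) • y 2 - χ₃ (Y 2) • y 1) (by rw [lc, hy1, hy1]; simp)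
    (by rw [lc, hy2, hy2]; simp)
    (by rw [lc0]; exact sub_eq_zero.2 (mul_comm _ _))
  have hx' := hstar' (χ₃ (X 1) • x 2 - χ₃ (X 2) • x 1) (by rw [lc, hx1, hx1]; simp)
    (by rw [lc, hx2, hx2]; simp)
    (by rw [lc0]; exact sub_eq_zero.2 (mul_comm _ _))
  have hxy' := hstar' (χ₃ (X 1) • y 1 - χ₃ (Y 1) • x 1) (by rw [lc, hx1, hy1]; simp)
    (by rw [lc, hx2, hy2]; simp) (by rw [lc0]; exact sub_eq_zero.2 (mul_comm _ _))
  simp only [lc, lcd, hx1, hx2, hy1, hy2] at hx' hy' hxy'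
  simp at hx' hy' hxy'
  simp only [wr, map_sub, map_mul]
  change (_ = 0) ∧ _ = _ * (_ * χ₃ (D 0 (X 2)) - _ * χ₃ (D 0 (X 1))) +
    _ * (_ * χ₃ (D 1 (X 2)) - _ * χ₃ (D 1 (X 1))) at hx'
  change (0 = _) ∧ _ = _ * (_ * χ₃ (D 0 (Y 2)) - _ * χ₃ (D 0 (Y 1))) +
    _ * (_ * χ₃ (D 1 (Y 2)) - _ * χ₃ (D 1 (Y 1))) at hy'
  have ha2 : a 2 0 ≠ 0 ∨ a 2 1 ≠ 0 := by
    by_contra! hc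
    simp only [hc, zero_mul, add_zero] at hx' hy' hxy'
    have h00 : a 0 0 = 0 := by simpa [hy] using hxy'.2
    have h01 : a 0 1 = 0 := by simpa [hx, h00] using hx'.1
    have h10 : a 1 0 = 0 := by simpa [hx, h00] using hxy'.1.symm
    have h11 : a 1 1 = 0 := by simpa [hy, h10] using hy'.1.symm
    refine ha (funext fun k => funext fun j => ?_)
    fin_cases k <;> fin_cases j
    exacts [h00, h01, h10, h11, hc.1, hc.2]
  have hxx := hx'.2.symm.trans hx'.1
  have hyy := hy'.2
  rcases ha2 with h | h
  · refine mul_left_cancel₀ h ?_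
    linear_combination (-(χ₃ (X 1) * χ₃ (D 1 (X 2)) - χ₃ (X 2) * χ₃ (D 1 (X 1)))) * hyy -
      (χ₃ (Y 1) * χ₃ (D 1 (Y 2)) - χ₃ (Y 2) * χ₃ (D 1 (Y 1))) * hxx
  · refine mul_left_cancel₀ h ?_
    linear_combination (χ₃ (X 1) * χ₃ (D 0 (X 2)) - χ₃ (X 2) * χ₃ (D 0 (X 1))) * hyy +
      (χ₃ (Y 1) * χ₃ (D 0 (Y 2)) - χ₃ (Y 2) * χ₃ (D 0 (Y 1))) * hxx

end Frame

section SeriesWronskian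

open PowerSeries

variable {R : Type} [CommRing R]

lemma coeff_add_mul {P Q : R⟦X⟧} {k m : ℕ} (hP : ∀ i < k, coeff i P = 0) (hQ : ∀ i < m, coeff i Q = 0) :
    coeff (k + m) (P * Q) = coeff k P * coeff m Q := by
  obtain ⟨P, rfl⟩ := X_pow_dvd_iff.2 hP
  obtain ⟨Q, rfl⟩ := X_pow_dvd_iff.2 hQ
  have h : ∀ (n : ℕ) (F : R⟦X⟧), coeff n (X ^ n * F) = constantCoeff F := by
    intro n F
    simpa using coeff_X_pow_mul F n 0
  have e : X ^ k * P * (X ^ m * Q) = X ^ (k + m) * (P * Q) := by ring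
  rw [e, h, h, h, map_mul]

lemma coeff_X_mul_derivative (P : R⟦X⟧) (n : ℕ) : coeff n (X * d⁄dX R P) = n * coeff n P := by
  cases n with
  | zero => simp
  | succ n =>
    rw [mul_comm, coeff_succ_mul_X, coeff_derivative]
    push_cast
    ring

/-- Two power series with vanishing Wronskian are proportional. -/
theorem proportional_of_wronskian [IsDomain R] [CharZero R] {P Q : R⟦X⟧} (hP : P ≠ 0)
    (h : P * d⁄dX R Q = Q * d⁄dX R P) : ∃ p q : R, p ≠ 0 ∧ C p * Q = C q * P := by
  let k := P.order.toNat
  have hk : coeff k P ≠ 0 := coeff_order hP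
  refine ⟨coeff k P, coeff k Q, hk, ?_⟩
  by_contra hne
  let Z := C (coeff k P) * Q - C (coeff k Q) * P
  have hZ : Z ≠ 0 := sub_ne_zero.2 hne
  have hZk : coeff k Z = 0 := by
    simp only [Z, map_sub, coeff_C_mul]
    ring
  have hC : ∀ c : R, d⁄dX R (C c) = 0 := fun _ => derivative_C
  have hW : P * (X * d⁄dX R Z) = Z * (X * d⁄dX R P) := by
    simp only [Z, map_sub, Derivation.leibniz, smul_eq_mul, hC]
    linear_combination (X * C (coeff k P)) * h
  let m := Z.order.toNat
  have hm : coeff m Z ≠ 0 := coeff_order hZ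
  have hPk : ∀ i < k, coeff i P = 0 := fun i hi => coeff_of_lt_order_toNat i hi
  have hZm : ∀ i < m, coeff i Z = 0 := fun i hi => coeff_of_lt_order_toNat i hi
  have h1 := congrArg (coeff (k + m)) hW
  rw [coeff_add_mul hPk fun i hi => by rw [coeff_X_mul_derivative, hZm i hi, mul_zero], add_comm k m,
    coeff_add_mul hZm fun i hi => by rw [coeff_X_mul_derivative, hPk i hi, mul_zero],
    coeff_X_mul_derivative, coeff_X_mul_derivative] at h1
  have h2 : ((m : R) - k) * (coeff k P * coeff m Z) = 0 := by linear_combination h1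
  rcases mul_eq_zero.1 h2 with h3 | h3
  · have : m = k := by exact_mod_cast sub_eq_zero.1 h3
    exact hm (this ▸ hZk)
  · exact (mul_ne_zero hk hm) h3

lemma eq_zero_of_eval_series {P : Polynomial R} [IsDomain R] {w : R⟦X⟧} (h0 : constantCoeff w = 0)
    (hw : w ≠ 0) (h : P.eval₂ C w = 0) : P = 0 := by
  by_contra hP
  obtain ⟨Q, hQ, hndvd⟩ := Polynomial.exists_eq_pow_rootMultiplicity_mul_and_not_dvd P hP 0
  rw [map_zero, sub_zero] at hQ hndvd
  rw [hQ, Polynomial.eval₂_mul, Polynomial.eval₂_pow, Polynomial.eval₂_X] at h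
  have h1 := (mul_eq_zero.1 h).resolve_left (pow_ne_zero _ hw)
  apply hndvd
  rw [Polynomial.X_dvd_iff]
  have h2 := congrArg constantCoeff h1
  rw [Polynomial.hom_eval₂, h0, map_zero] at h2
  rw [Polynomial.eval₂_at_zero] at h2
  simpa using h2

end SeriesWronskian

section TranscendenceTwo

open MvPolynomial

/-- A homomorphism which is injective on two algebraically independent elements is injective if
the source has transcendence degree two. -/
lemma injective_of_dep {A B : Type} [CommRing A] [IsDomain A] [Algebra ℂ A] [CommRing B] [Algebra ℂ B]
    (hdep : ∀ g : Fin 3 → A, ∃ F : MvPolynomial (Fin 3) ℂ, F ≠ 0 ∧ aeval g F = 0) (T : A →ₐ[ℂ] B)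
    (y : Fin 2 → A) (hy : ∀ F : MvPolynomial (Fin 2) ℂ, aeval (fun i => T (y i)) F = 0 → F = 0) :
    Function.Injective T := by
  rw [injective_iff_map_eq_zero]
  intro a ha
  by_contra hne
  obtain ⟨F, hF, hFa⟩ := hdep (Fin.cons a y)
  let P := finSuccEquiv ℂ 2 F
  have hP : P ≠ 0 := by simpa [P] using hF
  let ev : Polynomial (MvPolynomial (Fin 2) ℂ) →+* A := Polynomial.eval₂RingHom (aeval y).toRingHom a
  have hev : ev P = 0 := by
    rw [← hFa]
    have : ∀ G, ev (finSuccEquiv ℂ 2 G) = aeval (Fin.cons a y : Fin 3 → A) G := by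
      intro G
      simp only [ev]
      induction G using MvPolynomial.induction_on with
      | C c =>
        rw [← algebraMap_eq, AlgEquiv.commutes, AlgHom.commutes,
          Polynomial.algebraMap_apply, Polynomial.coe_eval₂RingHom, Polynomial.eval₂_C]
        exact (aeval y).commutes c
      | add p q hp hq => rw [map_add, map_add, hp, hq, map_add]
      | mul_X p i hp =>
        suffices hi : Polynomial.eval₂RingHom (aeval y).toRingHom a (finSuccEquiv ℂ 2 (X i)) =
            (Fin.cons a y : Fin 3 → A) i by
          rw [map_mul, map_mul, hp, map_mul, aeval_X, hi]
        rcases Fin.eq_zero_or_eq_succ i with rfl | ⟨j, rfl⟩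
        · rw [finSuccEquiv_X_zero, Polynomial.coe_eval₂RingHom, Polynomial.eval₂_X, Fin.cons_zero]
        · rw [finSuccEquiv_X_succ, Polynomial.coe_eval₂RingHom, Polynomial.eval₂_C, Fin.cons_succ]
          exact aeval_X y j
    exact this F
  obtain ⟨Q, hQ, hndvd⟩ := Polynomial.exists_eq_pow_rootMultiplicity_mul_and_not_dvd P hP 0
  rw [map_zero, sub_zero] at hQ hndvd
  rw [hQ, map_mul, map_pow] at hev
  have hX : ev Polynomial.X = a := by simp [ev]
  rw [hX] at hev
  have h1 := (mul_eq_zero.1 hev).resolve_left (pow_ne_zero _ hne)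
  apply hndvd
  rw [Polynomial.X_dvd_iff]
  refine hy _ ?_
  have h2 := congrArg T h1
  rw [map_zero] at h2
  rw [← h2]
  change _ = T.toRingHom (Polynomial.eval₂ (aeval y).toRingHom a Q)
  rw [Polynomial.hom_eval₂]
  have h3 : T.toRingHom a = 0 := ha
  rw [h3, Polynomial.eval₂_at_zero]
  exact (algHom_aeval T y _).symm

end TranscendenceTwo

section SeriesPath

open PowerSeries

variable {A : Type} [CommRing A] [Algebra ℂ A]

lemma exists_derivation_polynomial (D : Derivation ℂ A A) :
    ∃ E : Derivation ℂ (Polynomial A) (Polynomial A), E Polynomial.X = 0 ∧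
      ∀ a, E (Polynomial.C a) = Polynomial.C (D a) := by
  refine ⟨PolynomialModule.equivPolynomialSelf.toLinearMap.compDer D.mapCoeffs, ?_, fun a => ?_⟩
  · change PolynomialModule.equivPolynomialSelf (D.mapCoeffs Polynomial.X) = _
    rw [Derivation.mapCoeffs_X, map_zero]
  · change PolynomialModule.equivPolynomialSelf (D.mapCoeffs (Polynomial.C a)) = _
    rw [Derivation.mapCoeffs_C, PolynomialModule.equivPolynomialSelf_apply_eq,
      PolynomialModule.equivPolynomial_single, Polynomial.monomial_zero_left]

lemma algebraicIndependent_smul {R : Type} [CommRing R] [IsDomain R] [Algebra ℂ R] {s : R}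
    (hs : Function.Injective (Polynomial.aeval s : Polynomial ℂ →ₐ[ℂ] R)) {w : R⟦X⟧}
    (h0 : constantCoeff w = 0) (hw : w ≠ 0) {F : MvPolynomial (Fin 2) ℂ}
    (hF : MvPolynomial.aeval ![C s * w, w] F = 0) : F = 0 := by
  let P : Polynomial (Polynomial ℂ) :=
    MvPolynomial.aeval ![Polynomial.C Polynomial.X * Polynomial.X, Polynomial.X] F
  let σ : Polynomial (Polynomial ℂ) →ₐ[ℂ] Polynomial R :=
    Polynomial.mapAlgHom (Polynomial.aeval s : Polynomial ℂ →ₐ[ℂ] R)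
  have hP : P = 0 := by
    have hσ : σ P = 0 := by
      refine eq_zero_of_eval_series h0 hw ?_
      let φ : Polynomial R →ₐ[ℂ] R⟦X⟧ := (Polynomial.aeval (R := R) w).restrictScalars ℂ
      have h1 : φ (σ P) = 0 := by
        rw [← hF]
        refine (algHom_aeval (φ.comp σ) _ F).trans
          (congrArg (fun v => MvPolynomial.aeval v F) (funext fun i => ?_))
        fin_cases i
        · change Polynomial.aeval w (Polynomial.map _ (Polynomial.C Polynomial.X * Polynomial.X)) = _
          simp
        · change Polynomial.aeval w (Polynomial.map _ Polynomial.X) = _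
          simp
      exact (Polynomial.aeval_def w (σ P)).symm.trans h1
    exact Polynomial.map_injective _ hs (hσ.trans (map_zero σ).symm)
  have h2 : F * MvPolynomial.X 1 = 0 := by
    refine MvPolynomial.funext fun x => ?_
    rw [map_mul, MvPolynomial.eval_X, map_zero]
    by_cases hx : x 1 = 0
    · rw [hx, mul_zero]
    let ψ : Polynomial (Polynomial ℂ) →ₐ[ℂ] ℂ :=
      (Polynomial.aeval (x 0 / x 1)).comp
        ((Polynomial.aeval (R := Polynomial ℂ) (Polynomial.C (x 1))).restrictScalars ℂ)
    have h3 : ψ P = MvPolynomial.eval x F := by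
      rw [← MvPolynomial.aeval_eq_eval]
      refine (algHom_aeval ψ _ F).trans
        (congrArg (fun v => MvPolynomial.aeval v F) (funext fun i => ?_))
      fin_cases i
      · change Polynomial.aeval _ (Polynomial.aeval (Polynomial.C (x 1))
          (Polynomial.C Polynomial.X * Polynomial.X)) = _
        simp only [map_mul, Polynomial.aeval_C, Polynomial.aeval_X]
        simp
        exact div_mul_cancel₀ _ hx
      · change Polynomial.aeval _ (Polynomial.aeval (Polynomial.C (x 1)) Polynomial.X) = _
        simp
    rw [← h3, hP, map_zero, zero_mul]
  exact (mul_eq_zero.1 h2).resolve_right (MvPolynomial.X_ne_zero 1)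

theorem exists_path [IsDomain A]
    (hdep : ∀ g : Fin 3 → A, ∃ F : MvPolynomial (Fin 3) ℂ, F ≠ 0 ∧ MvPolynomial.aeval g F = 0)
    (D : Fin 2 → Derivation ℂ A A) (χ : A →ₐ[ℂ] ℂ) (Y : Fin 3 → A)
    (hY : ∀ i, jval D χ (Y i) = Pi.single i 1) {R : Type} [CommRing R] [IsDomain R] [Algebra ℂ R]
    {s : R} (hs : Function.Injective (Polynomial.aeval s : Polynomial ℂ →ₐ[ℂ] R)) :
    ∃ T : A →ₐ[ℂ] R⟦X⟧, Function.Injective T ∧ T (Y 1) = C s * T (Y 2) ∧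
      ∃ α β, ∀ a, d⁄dX _ (T a) = α * T (D 0 a) + β * T (D 1 a) := by
  choose E hEX hEC using fun j => exists_derivation_polynomial (D j)
  let G : Fin 2 → A := fun j => wr (D j) (Y 0) (Y 1)
  let H : Fin 2 → A := fun j => wr (D j) (Y 0) (Y 2)
  have : CharZero R := charZero_of_injective_algebraMap (algebraMap ℂ R).injective
  let α : Polynomial A := Polynomial.X * Polynomial.C (H 1) - Polynomial.C (G 1)
  let β : Polynomial A := Polynomial.C (G 0) - Polynomial.X * Polynomial.C (H 0)
  let E' : Derivation ℂ (Polynomial A) (Polynomial A) := α • E 0 + β • E 1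
  have hE' : ∀ P, E' P = α * E 0 P + β * E 1 P := fun P => rfl
  let Χ : Polynomial A →ₐ[ℂ] R :=
    (Polynomial.aeval s).comp (Polynomial.mapAlgHom χ)
  have hΧ : ∀ a, Χ (Polynomial.C a) = algebraMap ℂ R (χ a) := by
    intro a
    change Polynomial.aeval s (Polynomial.map _ (Polynomial.C a)) = _
    simp
  have hΧX : Χ Polynomial.X = s := by
    change Polynomial.aeval s (Polynomial.map _ Polynomial.X) = _
    simp
  let τ := arc E' Χ
  let T : A →ₐ[ℂ] R⟦X⟧ := τ.comp Polynomial.CAlgHom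
  have hT : ∀ a, T a = τ (Polynomial.C a) := fun a => rfl
  have hdT : ∀ a, d⁄dX _ (T a) = τ α * T (D 0 a) + τ β * T (D 1 a) := by
    intro a
    rw [hT, derivative_arc, hE', map_add, map_mul, map_mul, hEC, hEC]
    rfl
  have hT0 : ∀ a, constantCoeff (T a) = algebraMap ℂ R (χ a) := by
    intro a
    rw [← coeff_zero_eq_constantCoeff_apply, hT, coeff_zero_arc, hΧ]
  have hτX : τ Polynomial.X = C s := by
    refine derivative.ext ?_ ?_
    · rw [derivative_arc, hE', hEX, hEX]
      simp
    · rw [← coeff_zero_eq_constantCoeff_apply, coeff_zero_arc]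
      simp [hΧX]
  have hj : ∀ i, χ (Y i) = (Pi.single i 1 : Fin 3 → ℂ) 0 ∧
      χ (D 0 (Y i)) = (Pi.single i 1 : Fin 3 → ℂ) 1 ∧ χ (D 1 (Y i)) = (Pi.single i 1 : Fin 3 → ℂ) 2 :=
    fun i => ⟨congrFun (hY i) 0, congrFun (hY i) 1, congrFun (hY i) 2⟩
  have hτC : ∀ a, τ (Polynomial.C a) = T a := fun a => rfl
  have hα : τ α = C s * T (H 1) - T (G 1) := by
    simp only [α, map_sub, map_mul, hτX, hτC]
  have hβ : τ β = T (G 0) - C s * T (H 0) := by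
    simp only [β, map_sub, map_mul, hτX, hτC]
  have hprop : T (Y 1) = C s * T (Y 2) := by
    have hP0 : constantCoeff (T (Y 0)) = 1 := by rw [hT0, (hj 0).1]; simp
    have hQ0 : constantCoeff (T (Y 1) - C s * T (Y 2)) = 0 := by
      rw [map_sub, map_mul, hT0, hT0, (hj 1).1, (hj 2).1]
      simp
    obtain ⟨p, q, hp, hpq⟩ := proportional_of_wronskian (P := T (Y 0))
      (Q := T (Y 1) - C s * T (Y 2)) (fun h => by simp [h] at hP0) (by
        rw [map_sub, Derivation.leibniz, derivative_C, hdT, hdT, hdT, hα, hβ]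
        simp only [G, H, wr, map_sub, map_mul, smul_eq_mul]
        ring)
    have h1 := congrArg constantCoeff hpq
    rw [map_mul, map_mul, hP0, hQ0, constantCoeff_C, constantCoeff_C, mul_zero, mul_one] at h1
    rw [← h1, map_zero, zero_mul] at hpq
    exact sub_eq_zero.1 ((mul_eq_zero.1 hpq).resolve_left fun h => hp (by
      have := congrArg constantCoeff h
      simpa using this))
  refine ⟨T, ?_, hprop, τ α, τ β, hdT⟩
  refine injective_of_dep hdep T ![Y 1, Y 2] fun F hF => ?_
  have hw0 : constantCoeff (T (Y 2)) = 0 := by rw [hT0, (hj 2).1]; simp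
  have hw : T (Y 2) ≠ 0 := by
    intro h
    have h1 := congrArg constantCoeff (hdT (Y 2))
    rw [h, map_zero, map_zero, map_add, map_mul, map_mul, hT0, hT0, (hj 2).2.1, (hj 2).2.2, hα, hβ, map_sub,
      map_sub,
      map_mul, map_mul, hT0, hT0, hT0, hT0, constantCoeff_C] at h1
    simp [G, H, wr, hj] at h1
  refine algebraicIndependent_smul hs hw0 hw ?_
  rw [← hF]
  refine congrArg (fun v => MvPolynomial.aeval v F) (funext fun i => ?_)
  fin_cases i
  · exact hprop.symm
  · rfl

end SeriesPath

section Moebius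

open Polynomial

theorem exists_rational_relation {A : Type} [CommRing A] [IsDomain A] [Algebra ℂ A]
    {K : Type} [Field K] [Algebra ℂ K] [Algebra A K] [IsScalarTower ℂ A K] [IsFractionRing A K]
    (hdep : ∀ g : Fin 3 → A, ∃ F : MvPolynomial (Fin 3) ℂ, F ≠ 0 ∧ MvPolynomial.aeval g F = 0)
    (D : Fin 2 → Derivation ℂ A A) (χ : A →ₐ[ℂ] ℂ) {X Y : Fin 3 → A}
    (hY : ∀ i, jval D χ (Y i) = Pi.single i 1) (hX : X 1 ≠ 0)
    (hW : wr (D 0) (Y 1) (Y 2) * wr (D 1) (X 1) (X 2) =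
      wr (D 1) (Y 1) (Y 2) * wr (D 0) (X 1) (X 2)) :
    Transcendental ℂ (algebraMap A K (Y 1) / algebraMap A K (Y 2)) ∧ ∃ p q : ℂ[X], p ≠ 0 ∧
      aeval (algebraMap A K (Y 1) / algebraMap A K (Y 2)) p * algebraMap A K (X 2) =
        aeval (algebraMap A K (Y 1) / algebraMap A K (Y 2)) q * algebraMap A K (X 1) := by
  obtain ⟨R, _, _, _, s, hs⟩ : ∃ (R : Type) (_ : CommRing R) (_ : IsDomain R) (_ : Algebra ℂ R) (s : R),
      Function.Bijective (aeval s : ℂ[X] →ₐ[ℂ] R) :=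
    ⟨ℂ[X], inferInstance, inferInstance, inferInstance, Polynomial.X, by
      have : (aeval Polynomial.X : ℂ[X] →ₐ[ℂ] ℂ[X]) = AlgHom.id ℂ _ := by ext; simp
      rw [this]
      exact Function.bijective_id⟩
  obtain ⟨T, hT, hTs, α, β, hd⟩ := exists_path hdep D χ Y hY hs.1
  have : CharZero R := charZero_of_injective_algebraMap (algebraMap ℂ R).injective
  have hy2 : T (Y 2) ≠ 0 := by
    intro h
    have h0 := (map_eq_zero_iff T hT).1 h
    have := congrFun (hY 2) 2
    simp [h0, jval] at this
  have hy : wr (D 0) (Y 1) (Y 2) ≠ 0 := by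
    intro h
    have h1 := congrArg (fun a => χ (D 1 a)) h
    have hj : ∀ i, χ (Y i) = (Pi.single i 1 : Fin 3 → ℂ) 0 ∧
        χ (D 0 (Y i)) = (Pi.single i 1 : Fin 3 → ℂ) 1 ∧ χ (D 1 (Y i)) = (Pi.single i 1 : Fin 3 → ℂ) 2 :=
      fun i => ⟨congrFun (hY i) 0, congrFun (hY i) 1, congrFun (hY i) 2⟩
    simp [wr, hj] at h1
  have hWy : α * T (wr (D 0) (Y 1) (Y 2)) + β * T (wr (D 1) (Y 1) (Y 2)) = 0 := by
    have h2 : T (Y 1) * PowerSeries.derivative R (T (Y 2)) =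
        T (Y 2) * PowerSeries.derivative R (T (Y 1)) := by
      rw [hTs, Derivation.leibniz, PowerSeries.derivative_C, smul_zero, add_zero, smul_eq_mul]
      ring
    rw [hd, hd] at h2
    simp only [wr, map_sub, map_mul]
    linear_combination h2
  have hWx : T (X 1) * PowerSeries.derivative R (T (X 2)) =
      T (X 2) * PowerSeries.derivative R (T (X 1)) := by
    refine mul_left_cancel₀ ((map_ne_zero_iff T hT).2 hy) ?_
    rw [hd, hd]
    have h3 := congrArg T hW
    simp only [wr, map_sub, map_mul] at h3 hWy ⊢
    linear_combination β * h3 + (T (X 1) * T (D 0 (X 2)) - T (X 2) * T (D 0 (X 1))) * hWy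
  obtain ⟨p', q', hp', hpq⟩ := proportional_of_wronskian ((map_ne_zero_iff T hT).2 hX) hWx
  obtain ⟨p, rfl⟩ := hs.2 p'
  obtain ⟨q, rfl⟩ := hs.2 q'
  let L := FractionRing (PowerSeries R)
  let TL : A →ₐ[ℂ] L := (IsScalarTower.toAlgHom ℂ (PowerSeries R) L).comp T
  have hTL : Function.Injective TL := (IsFractionRing.injective (PowerSeries R) L).comp hT
  let Φ : K →ₐ[ℂ] L := IsFractionRing.liftAlgHom hTL
  have hΦ : ∀ a, Φ (algebraMap A K a) = algebraMap (PowerSeries R) L (T a) :=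
    fun a => IsFractionRing.lift_algebraMap hTL a
  let cL : R →ₐ[ℂ] L :=
    (IsScalarTower.toAlgHom ℂ (PowerSeries R) L).comp (IsScalarTower.toAlgHom ℂ R (PowerSeries R))
  have hcL : ∀ c, cL c = algebraMap (PowerSeries R) L (PowerSeries.C c) := fun c => rfl
  have hcinj : Function.Injective cL :=
    (IsFractionRing.injective (PowerSeries R) L).comp PowerSeries.C_injective
  have hΦY : Φ (algebraMap A K (Y 1) / algebraMap A K (Y 2)) = cL s := by
    rw [map_div₀, hΦ, hΦ, hTs, map_mul, hcL, mul_div_cancel_right₀]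
    exact (map_ne_zero_iff _ (IsFractionRing.injective (PowerSeries R) L)).2 hy2
  have hΦP : ∀ P : ℂ[X], Φ (aeval (algebraMap A K (Y 1) / algebraMap A K (Y 2)) P) =
      cL (aeval s P) := by
    intro P
    rw [← aeval_algHom_apply, ← aeval_algHom_apply, hΦY]
  refine ⟨?_, p, q, ?_, Φ.injective ?_⟩
  · rw [transcendental_iff]
    intro P hP
    have h1 := hΦP P
    rw [hP, map_zero] at h1
    exact (map_eq_zero_iff _ hs.1).1 ((map_eq_zero_iff _ hcinj).1 h1.symm)
  · rintro rfl
    exact hp' (map_zero _)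
  · change Φ _ = Φ _
    rw [map_mul, map_mul, hΦP, hΦP, hΦ, hΦ, hcL, hcL, ← map_mul, ← map_mul, hpq]

theorem exists_moebius {K : Type} [Field K] [Algebra ℂ K] {x y : K} (hx : Transcendental ℂ x)
    (hy : Transcendental ℂ y) {p q p' q' : ℂ[X]} (hp : p ≠ 0) (hxy : aeval y p = aeval y q * x)
    (hp' : p' ≠ 0) (hyx : aeval x p' = aeval x q' * y) :
    ∃ a b c d : ℂ, a * d - b * c ≠ 0 ∧ algebraMap ℂ K a * x + algebraMap ℂ K b =
      (algebraMap ℂ K c * x + algebraMap ℂ K d) * y := by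
  have hxi := transcendental_iff_injective.1 hx
  let ψ : RatFunc ℂ →ₐ[ℂ] K := IsFractionRing.liftAlgHom (A := ℂ[X]) (g := aeval x) hxi
  have hψ : ∀ P : ℂ[X], ψ (algebraMap ℂ[X] (RatFunc ℂ) P) = aeval x P :=
    fun P => IsFractionRing.lift_algebraMap hxi P
  have hq' : aeval x q' ≠ 0 := by
    intro h
    rw [h, zero_mul] at hyx
    exact hp' (transcendental_iff.1 hx _ hyx)
  have hq : aeval y q ≠ 0 := by
    intro h
    rw [h, zero_mul] at hxy
    exact hp (transcendental_iff.1 hy _ hxy)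
  let g : RatFunc ℂ := algebraMap _ _ p' / algebraMap _ _ q'
  have hg : ψ g = y := by
    rw [map_div₀, hψ, hψ, hyx, mul_div_cancel_left₀ _ hq']
  have hgP : ∀ P : ℂ[X], ψ (aeval g P) = aeval y P := fun P => by rw [← aeval_algHom_apply, hg]
  have hX : RatFunc.X ∈ IntermediateField.adjoin ℂ {g} := by
    have h1 : RatFunc.X = aeval g p / aeval g q := by
      apply ψ.injective
      change ψ _ = ψ _
      rw [map_div₀, hgP, hgP, hxy, mul_div_cancel_left₀ _ hq, ← RatFunc.algebraMap_X, hψ, aeval_X]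
    have hmem : ∀ P : ℂ[X], aeval g P ∈ IntermediateField.adjoin ℂ {g} := fun P =>
      IntermediateField.algebra_adjoin_le_adjoin ℂ {g}
        (Polynomial.aeval_mem_adjoin_singleton ℂ g)
    rw [h1]
    exact div_mem (hmem p) (hmem q)
  have htop : IntermediateField.adjoin ℂ {g} = ⊤ := by
    rw [eq_top_iff, ← RatFunc.adjoin_X]
    exact IntermediateField.adjoin_le_iff.2 (by simpa using hX)
  have hmax := RatFunc.finrank_eq_max_natDegree g
  rw [htop, IntermediateField.finrank_top] at hmax
  have hn : g.num.natDegree ≤ 1 := hmax ▸ le_max_left _ _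
  have hd : g.denom.natDegree ≤ 1 := hmax ▸ le_max_right _ _
  obtain ⟨a, b, hab⟩ := Polynomial.exists_eq_X_add_C_of_natDegree_le_one hn
  obtain ⟨c, d, hcd⟩ := Polynomial.exists_eq_X_add_C_of_natDegree_le_one hd
  have h0 : aeval x g.denom ≠ 0 := fun h => g.denom_ne_zero (transcendental_iff.1 hx _ h)
  have hrel : aeval x g.num = aeval x g.denom * y := by
    have h1 := congrArg ψ (RatFunc.num_div_denom g)
    rw [map_div₀, hψ, hψ, hg, div_eq_iff h0] at h1
    rw [h1, mul_comm]
  rw [hcd] at h0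
  rw [hab, hcd] at hrel
  simp only [map_add, map_mul, aeval_C, aeval_X] at hrel h0
  refine ⟨a, b, c, d, fun h => ?_, hrel⟩
  have h' := congrArg (algebraMap ℂ K) h
  simp only [map_sub, map_mul, map_zero] at h'
  have key : ∀ u v : ℂ, algebraMap ℂ K u * y = algebraMap ℂ K v → u = 0 ∧ v = 0 := by
    intro u v huv
    have h2 := transcendental_iff.1 hy (C u * X - C v) (by simp [huv])
    have h3 := congrArg (fun P => coeff P 1) h2
    have h4 := congrArg (fun P => coeff P 0) h2
    simp at h3 h4
    exact ⟨h3, h4⟩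
  obtain ⟨rfl, rfl⟩ := key c a (mul_left_cancel₀ h0 (by
    linear_combination -(algebraMap ℂ K c * hrel) - h'))
  obtain ⟨rfl, -⟩ := key d b (by simpa using hrel.symm)
  simp at h0

end Moebius

section Link

variable {A : Type} [CommRing A] [Algebra ℂ A]
  {r : ℕ} {S : Set (Fin (r + 1) → ℂ)} {D : Fin 2 → Derivation ℂ A A} {f : Fin (r + 1) → A}

/-- The linear form `α` evaluated on the generic point, in an extension of `A`. -/
def klin (K : Type) [Field K] [Algebra ℂ K] [Algebra A K] [IsScalarTower ℂ A K]
    (f : Fin (r + 1) → A) : Module.Dual ℂ (Fin (r + 1) → ℂ) →ₗ[ℂ] K :=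
  (IsScalarTower.toAlgHom ℂ A K).toLinearMap ∘ₗ lform f

/-- The span of the tangent space at `χ₁` and of the point `χ₂`. -/
def tpt (D : Fin 2 → Derivation ℂ A A) (f : Fin (r + 1) → A) (χ₁ χ₂ : A →ₐ[ℂ] ℂ) :
    Submodule ℂ (Fin (r + 1) → ℂ) :=
  tsp D f χ₁ ⊔ span ℂ {fun i => χ₂ (f i)}

lemma mem_annihilator_tpt {χ₁ χ₂ : A →ₐ[ℂ] ℂ} {α : Module.Dual ℂ (Fin (r + 1) → ℂ)} :
    α ∈ (tpt D f χ₁ χ₂).dualAnnihilator ↔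
      jval D χ₁ (lform f α) = 0 ∧ χ₂ (lform f α) = 0 := by
  rw [tpt, dualAnnihilator_sup_eq, mem_inf, mem_dualAnnihilator, dual_eq_zero_iff_jval,
    mem_dualAnnihilator, algHom_lform]
  refine and_congr_right fun _ => ⟨fun h => h _ (subset_span rfl), fun h w hw => ?_⟩
  obtain ⟨c, rfl⟩ := mem_span_singleton.1 hw
  rw [map_smul, h, smul_zero]

/-- Multiplication by `k` exchanges the linear forms vanishing on the tangent space at one point
and on the other point. -/
def Link (K : Type) [Field K] [Algebra ℂ K] [Algebra A K] [IsScalarTower ℂ A K]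
    (D : Fin 2 → Derivation ℂ A A) (f : Fin (r + 1) → A) (χ₁ χ₂ : A →ₐ[ℂ] ℂ) (k : K) : Prop :=
  k ≠ 0 ∧ (∀ α ∈ (tpt D f χ₁ χ₂).dualAnnihilator, ∃ β ∈ (tpt D f χ₂ χ₁).dualAnnihilator,
    k * klin K f α = klin K f β) ∧ ∀ β ∈ (tpt D f χ₂ χ₁).dualAnnihilator,
    ∃ α ∈ (tpt D f χ₁ χ₂).dualAnnihilator, k * klin K f α = klin K f β

lemma Link.symm {K : Type} [Field K] [Algebra ℂ K] [Algebra A K] [IsScalarTower ℂ A K]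
    {χ₁ χ₂ : A →ₐ[ℂ] ℂ} {k : K} (h : Link K D f χ₁ χ₂ k) : Link K D f χ₂ χ₁ k⁻¹ := by
  obtain ⟨hk, h1, h2⟩ := h
  refine ⟨inv_ne_zero hk, fun α hα => ?_, fun β hβ => ?_⟩
  · obtain ⟨β, hβ, h⟩ := h2 α hα
    exact ⟨β, hβ, by rw [← h, inv_mul_cancel_left₀ hk]⟩
  · obtain ⟨α, hα, h⟩ := h1 β hβ
    exact ⟨α, hα, by rw [← h, inv_mul_cancel_left₀ hk]⟩

lemma eq_combination_of_frame {χ₁ χ₂ : A →ₐ[ℂ] ℂ} (h : tsp D f χ₁ ⊔ tsp D f χ₂ = ⊤)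
    {y : Fin 3 → Module.Dual ℂ (Fin (r + 1) → ℂ)} (hy1 : ∀ i, jval D χ₁ (lform f (y i)) = 0)
    (hy2 : ∀ i, jval D χ₂ (lform f (y i)) = Pi.single i 1)
    {α : Module.Dual ℂ (Fin (r + 1) → ℂ)} (hα : α ∈ (tpt D f χ₁ χ₂).dualAnnihilator) :
    ∃ s t : ℂ, α = s • y 1 + t • y 2 := by
  obtain ⟨h1, h2⟩ := mem_annihilator_tpt.1 hα
  refine ⟨jval D χ₂ (lform f α) 1, jval D χ₂ (lform f α) 2, ?_⟩
  rw [← sub_eq_zero, ← mem_bot (R := ℂ), ← dualAnnihilator_top, ← h, dualAnnihilator_sup_eq, mem_inf,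
    mem_dualAnnihilator, mem_dualAnnihilator, dual_eq_zero_iff_jval, dual_eq_zero_iff_jval]
  have hl : ∀ χ : A →ₐ[ℂ] ℂ, ∀ a b c : A, ∀ s t : ℂ, jval D χ (a - (s • b + t • c)) =
      jval D χ a - (s • jval D χ b + t • jval D χ c) := by
    intro χ a b c s t
    funext k
    fin_cases k <;> simp [jval]
  simp only [map_sub, map_add, map_smul, hl, hy1, hy2, h1]
  refine ⟨by simp, ?_⟩
  funext k
  fin_cases k
  · simpa [jval] using h2
  · simp
  · simp

theorem IsSurfModel.exists_link [IsDomain A] (K : Type) [Field K] [Algebra ℂ K] [Algebra A K]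
    [IsScalarTower ℂ A K] [IsFractionRing A K] (hm : IsSurfModel S D f) (hS : IsProjVar S)
    (hdeg : adim (GhkCone S 1 2) < 9) {χ₁ χ₂ : A →ₐ[ℂ] ℂ}
    (hd : Disjoint (tsp D f χ₁) (tsp D f χ₂)) (ht : tsp D f χ₁ ⊔ tsp D f χ₂ = ⊤) :
    ∃ k : K, Link K D f χ₁ χ₂ k := by
  obtain ⟨x, hx1, hx2⟩ := hm.exists_frame hd
  obtain ⟨y, hy2, hy1⟩ := hm.exists_frame hd.symm
  have hW := hm.wr_mul_wr hS hdeg hx1 hx2 hy1 hy2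
  have hne : ∀ (χ : A →ₐ[ℂ] ℂ) (a : A) (i : Fin 3), jval D χ a = Pi.single i 1 → a ≠ 0 := by
    rintro χ _ i h rfl
    have := congrFun h i
    fin_cases i <;> simp [jval] at this
  obtain ⟨hty, p, q, hp, hpq⟩ := exists_rational_relation (K := K) hm.dep D χ₂
    (X := fun i => lform f (x i)) (Y := fun i => lform f (y i)) hy2 (hne _ _ _ (hx1 1)) hW
  obtain ⟨htx, p', q', hp', hpq'⟩ := exists_rational_relation (K := K) hm.dep D χ₁
    (X := fun i => lform f (y i)) (Y := fun i => lform f (x i)) hx1 (hne _ _ _ (hy2 1))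
    (by linear_combination -hW)
  have hinj := IsFractionRing.injective A K
  have hx0 : algebraMap A K (lform f (x 2)) ≠ 0 := (map_ne_zero_iff _ hinj).2 (hne _ _ _ (hx1 2))
  have hy0 : algebraMap A K (lform f (y 2)) ≠ 0 := (map_ne_zero_iff _ hinj).2 (hne _ _ _ (hy2 2))
  obtain ⟨a, b, c, d, hdet, habcd⟩ := exists_moebius htx hty hp
    (by rw [← mul_div_assoc, ← hpq, mul_div_cancel_right₀ _ hx0]) hp'
    (by rw [← mul_div_assoc, ← hpq', mul_div_cancel_right₀ _ hy0])
  let L := klin K f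
  have hL : ∀ α, L α = algebraMap A K (lform f α) := fun _ => rfl
  have hy0' : L (y 2) ≠ 0 := hy0
  have hx0' : L (x 2) ≠ 0 := hx0
  simp only [← hL] at habcd
  let k : K := L (c • x 1 + d • x 2) / L (y 2)
  have hk2 : k * L (y 2) = L (c • x 1 + d • x 2) := div_mul_cancel₀ _ hy0
  have hk1 : k * L (y 1) = L (a • x 1 + b • x 2) := by
    simp only [k, map_add, map_smul, Algebra.smul_def]
    field_simp at habcd ⊢
    linear_combination -habcd
  have hk : ∀ s t : ℂ, k * L (s • y 1 + t • y 2) =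
      L ((s * a + t * c) • x 1 + (s * b + t * d) • x 2) := by
    intro s t
    have h1 : k * L (s • y 1 + t • y 2) = s • (k * L (y 1)) + t • (k * L (y 2)) := by
      rw [map_add, map_smul, map_smul, mul_add, mul_smul_comm, mul_smul_comm]
    rw [h1, hk1, hk2, ← map_smul, ← map_smul, ← map_add]
    congr 1
    module
  have hmx : ∀ s t : ℂ, s • x 1 + t • x 2 ∈ (tpt D f χ₂ χ₁).dualAnnihilator := by
    intro s t
    refine add_mem (smul_mem _ _ ?_) (smul_mem _ _ ?_)
    · exact mem_annihilator_tpt.2 ⟨hx2 1, congrFun (hx1 1) 0⟩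
    · exact mem_annihilator_tpt.2 ⟨hx2 2, congrFun (hx1 2) 0⟩
  have hmy : ∀ s t : ℂ, s • y 1 + t • y 2 ∈ (tpt D f χ₁ χ₂).dualAnnihilator := by
    intro s t
    refine add_mem (smul_mem _ _ ?_) (smul_mem _ _ ?_)
    · exact mem_annihilator_tpt.2 ⟨hy1 1, congrFun (hy2 1) 0⟩
    · exact mem_annihilator_tpt.2 ⟨hy1 2, congrFun (hy2 2) 0⟩
  have hsurj : ∀ u v : ℂ, ∃ s t : ℂ, k * L (s • y 1 + t • y 2) = L (u • x 1 + v • x 2) := by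
    intro u v
    refine ⟨(u * d - v * c) / (a * d - b * c), (a * v - b * u) / (a * d - b * c), ?_⟩
    rw [hk]
    congr 3
    · rw [div_mul_eq_mul_div, div_mul_eq_mul_div, ← add_div, div_eq_iff hdet]
      ring
    · rw [div_mul_eq_mul_div, div_mul_eq_mul_div, ← add_div, div_eq_iff hdet]
      ring
  refine ⟨k, fun h => ?_, fun α hα => ?_, fun β hβ => ?_⟩
  · obtain ⟨s, t, hst⟩ := hsurj 0 1
    rw [h, zero_mul, zero_smul, one_smul, zero_add] at hst
    exact hx0' hst.symm
  · obtain ⟨s, t, rfl⟩ := eq_combination_of_frame ht hy1 hy2 hα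
    exact ⟨_, hmx _ _, hk s t⟩
  · obtain ⟨u, v, rfl⟩ := eq_combination_of_frame (by rwa [sup_comm]) hx2 hx1 hβ
    obtain ⟨s, t, hst⟩ := hsurj u v
    exact ⟨_, hmy s t, hst⟩

end Link

section Generic

variable {A : Type} [CommRing A] [Algebra ℂ A]
  {r : ℕ} {S : Set (Fin (r + 1) → ℂ)} {D : Fin 2 → Derivation ℂ A A} {f : Fin (r + 1) → A}

section Constant

open PowerSeries

lemma eq_zero_of_arc_eq_zero [IsDomain A]
    (hdep : ∀ g : Fin 3 → A, ∃ F : MvPolynomial (Fin 3) ℂ, F ≠ 0 ∧ MvPolynomial.aeval g F = 0)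
    {χ : A →ₐ[ℂ] ℂ} {Y : Fin 3 → A} (hY : ∀ i, jval D χ (Y i) = Pi.single i 1) {u : A}
    (h : ∀ w : Fin 2 → ℂ, arc (w 0 • D 0 + w 1 • D 1) χ u = 0) : u = 0 := by
  let T : A →ₐ[ℂ] ((Fin 2 → ℂ) → PowerSeries ℂ) :=
    AlgHom.pi fun w => arc (w 0 • D 0 + w 1 • D 1) χ
  have hT : Function.Injective T := by
    refine injective_of_dep hdep T ![Y 1, Y 2] fun F hF => ?_
    refine eq_zero_of_arcs F 0 fun w => ?_
    let v : Fin 2 → PowerSeries ℂ := fun m => arc (w 0 • D 0 + w 1 • D 1) χ (![Y 1, Y 2] m)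
    have hj : ∀ i, χ (Y i) = (Pi.single i 1 : Fin 3 → ℂ) 0 ∧
        χ (D 0 (Y i)) = (Pi.single i 1 : Fin 3 → ℂ) 1 ∧ χ (D 1 (Y i)) = (Pi.single i 1 : Fin 3 → ℂ) 2 :=
      fun i => ⟨congrFun (hY i) 0, congrFun (hY i) 1, congrFun (hY i) 2⟩
    have hv0 : ∀ m, constantCoeff (v m) = 0 := by
      intro m
      rw [← coeff_zero_eq_constantCoeff_apply, coeff_zero_arc]
      fin_cases m <;> simp [hj]
    have hv1 : ∀ m, coeff 1 (v m) = w m := by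
      intro m
      rw [coeff_one_arc]
      fin_cases m <;> simp [hj]
    choose t ht using fun m => X_dvd_iff.2 (hv0 m)
    refine ⟨t, fun m => ?_, ?_⟩
    · rw [← hv1, ht, ← zero_add 1, coeff_succ_X_mul, coeff_zero_eq_constantCoeff_apply]
    · have h1 : Pi.evalAlgHom ℂ (fun _ : Fin 2 → ℂ => PowerSeries ℂ) w
          (MvPolynomial.aeval (fun i => T (![Y 1, Y 2] i)) F) = 0 := congrFun hF w
      rw [algHom_aeval] at h1
      rw [← h1]
      refine congrArg (fun v => MvPolynomial.aeval v F) (funext fun m => ?_)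
      rw [Pi.zero_apply, map_zero, zero_add, ← ht]
      rfl
  refine hT (funext fun w => ?_)
  rw [map_zero]
  exact h w

lemma IsSurfModel.proportional_of_wr [IsDomain A] (hm : IsSurfModel S D f) {χ : A →ₐ[ℂ] ℂ} {y z : A}
    (hy : χ y ≠ 0) (h : ∀ j, wr (D j) y z = 0) : χ y • z = χ z • y := by
  choose x hx using fun i : Fin 3 => exists_dual_eq (hm.jet_linearIndependent χ) (Pi.single i 1)
  rw [← sub_eq_zero]
  refine eq_zero_of_arc_eq_zero (Y := fun i => lform f (x i)) hm.dep
    (fun i => funext fun k => by rw [jval_lform]; exact hx i k) fun w => ?_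
  let T := arc (w 0 • D 0 + w 1 • D 1) χ
  have hT0 : ∀ a, constantCoeff (T a) = χ a := fun a => by
    rw [← coeff_zero_eq_constantCoeff_apply]; exact coeff_zero_arc _ _ _
  have hw : T y * d⁄dX ℂ (T z) = T z * d⁄dX ℂ (T y) := by
    simp only [T]
    rw [derivative_arc, derivative_arc, ← map_mul, ← map_mul]
    congr 1
    have h0 := h 0
    have h1 := h 1
    simp only [wr] at h0 h1
    simp only [Derivation.add_apply, Derivation.smul_apply, Algebra.smul_def]
    linear_combination algebraMap ℂ A (w 0) * h0 + algebraMap ℂ A (w 1) * h1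
  have hP : T y ≠ 0 := by
    intro h0
    rw [← hT0, h0, map_zero] at hy
    exact hy rfl
  obtain ⟨p, q, hp, hpq⟩ := proportional_of_wronskian hP hw
  have h2 := congrArg constantCoeff hpq
  rw [map_mul, map_mul, hT0, hT0, constantCoeff_C, constantCoeff_C] at h2
  change T (χ y • z - χ z • y) = 0
  have hC : (C p : PowerSeries ℂ) ≠ 0 := (map_ne_zero_iff _ C_injective).2 hp
  refine (mul_eq_zero.1 ?_).resolve_left hC
  have h3 := congrArg (C (R := ℂ)) h2
  rw [map_mul, map_mul] at h3
  rw [map_sub, map_smul, map_smul, smul_eq_C_mul, smul_eq_C_mul]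
  linear_combination C (χ y) * hpq - T y * h3

end Constant

/-- The first tangent space and the other two points span a hyperplane. -/
def Transv (D : Fin 2 → Derivation ℂ A A) (f : Fin (r + 1) → A) (x y z : A →ₐ[ℂ] ℂ) : Prop :=
  5 ≤ Module.finrank ℂ
    ↥(tsp D f x ⊔ (span ℂ {fun i => y (f i)} ⊔ span ℂ {fun i => z (f i)}))

lemma Transv.le_finrank {x y z : A →ₐ[ℂ] ℂ} (h : Transv D f x y z)
    {P : Submodule ℂ (Fin (r + 1) → ℂ)} (hy : (fun i => y (f i)) ∈ P) (hz : (fun i => z (f i)) ∈ P) :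
    5 ≤ Module.finrank ℂ ↥(tsp D f x ⊔ P) := by
  refine le_trans h (finrank_mono (sup_le_sup_left (sup_le ?_ ?_) _))
  · rwa [span_singleton_le_iff_mem]
  · rwa [span_singleton_le_iff_mem]

/-- Three points in general position. -/
structure Gen (D : Fin 2 → Derivation ℂ A A) (f : Fin (r + 1) → A) (x y z : A →ₐ[ℂ] ℂ) : Prop where
  span₁₂ : 6 ≤ Module.finrank ℂ ↥(tsp D f x ⊔ tsp D f y)
  span₁₃ : 6 ≤ Module.finrank ℂ ↥(tsp D f x ⊔ tsp D f z)
  span₂₃ : 6 ≤ Module.finrank ℂ ↥(tsp D f y ⊔ tsp D f z)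
  transv₁ : Transv D f x y z
  transv₂ : Transv D f y x z
  transv₃ : Transv D f z x y

lemma Transv.swap {x y z : A →ₐ[ℂ] ℂ} (h : Transv D f x y z) : Transv D f x z y := by
  unfold Transv at h ⊢
  rwa [sup_comm (span ℂ {fun i => z (f i)})]

lemma Gen.swap₁₂ {x y z : A →ₐ[ℂ] ℂ} (h : Gen D f x y z) : Gen D f y x z :=
  ⟨by rw [sup_comm]; exact h.1, h.3, h.2, h.5, h.4, h.6.swap⟩

lemma Gen.swap₂₃ {x y z : A →ₐ[ℂ] ℂ} (h : Gen D f x y z) : Gen D f x z y :=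
  ⟨h.2, h.1, by rw [sup_comm]; exact h.3, h.4.swap, h.6, h.5⟩

lemma finrank_span_singleton_le_one {W : Type*} [AddCommGroup W] [Module ℂ W] (v : W) :
    Module.finrank ℂ (span ℂ {v}) ≤ 1 := by
  by_cases hv : v = 0
  · rw [hv, span_zero_singleton, finrank_bot]
    exact zero_le_one
  · exact (finrank_span_singleton hv).le

lemma sup_eq_top_of_six_le (hr : r = 5) {N : Submodule ℂ (Fin (r + 1) → ℂ)}
    (h : 6 ≤ Module.finrank ℂ N) : N = ⊤ := by
  refine eq_top_of_finrank_eq (le_antisymm N.finrank_le ?_)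
  rw [Module.finrank_fin_fun]
  omega

lemma IsSurfModel.notMem_tpt_of_transv (hm : IsSurfModel S D f) {x y z : A →ₐ[ℂ] ℂ}
    (h : Transv D f x y z) : (fun i => z (f i)) ∉ tpt D f x y := by
  intro hz
  have h1 : tsp D f x ⊔ (span ℂ {fun i => y (f i)} ⊔ span ℂ {fun i => z (f i)}) = tpt D f x y := by
    rw [← sup_assoc, sup_eq_left.2]
    · rfl
    · rwa [span_singleton_le_iff_mem]
  unfold Transv at h
  rw [h1, tpt] at h
  have h2 := finrank_add_le_finrank_add_finrank (tsp D f x) (span ℂ {fun i => y (f i)})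
  have h3 := finrank_span_singleton_le_one fun i => y (f i)
  rw [hm.finrank_tsp] at h2
  omega

lemma IsSurfModel.exists_annihilator (hm : IsSurfModel S D f) {x y z : A →ₐ[ℂ] ℂ}
    (h : Transv D f x y z) : ∃ α ∈ (tpt D f x y).dualAnnihilator, z (lform f α) ≠ 0 := by
  by_contra! hne
  refine hm.notMem_tpt_of_transv h (mem_of_forall_dual fun α hα => ?_)
  rw [← algHom_lform]
  exact hne α ((mem_dualAnnihilator _).2 hα)

lemma Link.vanish {K : Type} [Field K] [Algebra ℂ K] [Algebra A K] [IsScalarTower ℂ A K]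
    [IsFractionRing A K] (hm : IsSurfModel S D f) {x y z : A →ₐ[ℂ] ℂ} {k : K}
    (hk : Link K D f x y k) (h : Transv D f x y z) {α β : Module.Dual ℂ (Fin (r + 1) → ℂ)}
    (hα : z (lform f α) = 0) (hαβ : k * klin K f α = klin K f β) : z (lform f β) = 0 := by
  obtain ⟨α', hα', hz⟩ := hm.exists_annihilator h
  obtain ⟨β', -, hβ'⟩ := hk.2.1 α' hα'
  have h1 : algebraMap A K (lform f β * lform f α') = algebraMap A K (lform f β' * lform f α) := by
    rw [map_mul, map_mul]
    change klin K f β * klin K f α' = klin K f β' * klin K f α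
    rw [← hαβ, ← hβ']
    ring
  have h2 := congrArg z (IsFractionRing.injective A K h1)
  rw [map_mul, map_mul, hα, mul_zero] at h2
  exact (mul_eq_zero.1 h2).resolve_right hz

/-- The star condition for three points spanning a plane not tangent along a line at any of them. -/
lemma IsSurfModel.not_linearIndependent (hm : IsSurfModel S D f) (hS : IsProjVar S)
    (hdeg : adim (GhkCone S 1 2) < 9) (hr : r = 5) (χ : Fin 3 → A →ₐ[ℂ] ℂ)
    (hQ : ∀ k, 5 ≤ Module.finrank ℂ ↥(tsp D f (χ k) ⊔ span ℂ (Set.range fun k i => χ k (f i))))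
    (γ : Fin 3 → Module.Dual ℂ (Fin (r + 1) → ℂ)) (h0 : ∀ i k, χ k (lform f (γ i)) = 0)
    (hj : ∀ i, jval D (χ i) (lform f (γ i)) = 0) : ¬ LinearIndependent ℂ γ := by
  intro hγ
  let p : Fin 3 → Fin (r + 1) → ℂ := fun k i => χ k (f i)
  let P := span ℂ (Set.range p)
  have hpP : ∀ k, p k ∈ P := fun k => subset_span ⟨k, rfl⟩
  have hp0 : ∀ k, p k ≠ 0 := fun k h => (hm.jet_linearIndependent (χ k)).ne_zero 0 h
  have hinf : ∀ k, Module.finrank ℂ ↥(tsp D f (χ k) ⊔ P) +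
      Module.finrank ℂ ↥(tsp D f (χ k) ⊓ P) = 3 + Module.finrank ℂ P := fun k => by
    rw [finrank_sup_add_finrank_inf_eq, hm.finrank_tsp]
  have hle : ∀ k, span ℂ {p k} ≤ tsp D f (χ k) ⊓ P := fun k => by
    rw [span_singleton_le_iff_mem]
    exact ⟨pt_mem_tsp D f (χ k), hpP k⟩
  have h1 : ∀ k, 1 ≤ Module.finrank ℂ ↥(tsp D f (χ k) ⊓ P) := fun k =>
    (finrank_span_singleton (K := ℂ) (hp0 k)).ge.trans (finrank_mono (hle k))
  have hP3 : Module.finrank ℂ P ≤ 3 := finrank_range_le_card p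
  have hQ' : ∀ k, 5 ≤ Module.finrank ℂ ↥(tsp D f (χ k) ⊔ P) := hQ
  have hP : Module.finrank ℂ P = 3 := by
    have := hinf 0
    have := h1 0
    have := hQ' 0
    omega
  have hpi : LinearIndependent ℂ p := by
    rw [linearIndependent_iff_card_eq_finrank_span, Fintype.card_fin]
    exact hP.symm
  obtain ⟨a, ha, hstar⟩ := hm.star hS hdeg χ hpi
  let t : Fin 3 → Fin (r + 1) → ℂ := fun k => ∑ j, a k j • fun i => χ k (D j (f i))
  have htT : ∀ k, t k ∈ tsp D f (χ k) := fun k =>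
    sum_mem fun j _ => smul_mem _ _ (deriv_mem_tsp D f (χ k) j)
  have hspan : span ℂ (Set.range γ) = P.dualAnnihilator := by
    refine eq_of_le_of_finrank_le ?_ ?_
    · rw [span_le]
      rintro _ ⟨i, rfl⟩
      rw [SetLike.mem_coe, mem_dualAnnihilator]
      intro w hw
      have : P ≤ LinearMap.ker (γ i) := by
        rw [span_le]
        rintro _ ⟨k, rfl⟩
        rw [SetLike.mem_coe, LinearMap.mem_ker, ← algHom_lform]
        exact h0 i k
      exact this hw
    · have h2 := Subspace.finrank_add_finrank_dualAnnihilator_eq P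
      rw [Module.finrank_fin_fun] at h2
      rw [finrank_span_eq_card hγ, Fintype.card_fin]
      omega
  have hγt : ∀ i k, γ i (t k) = 0 := by
    intro i k
    have h2 := hstar (γ i) (fun l => by rw [← algHom_lform]; exact h0 i l) k i
    rw [show γ i (t k) = _ from h2]
    exact (dual_eq_zero_iff_jval (χ i) (γ i)).2 (hj i) _ (htT i)
  have htP : ∀ k, t k ∈ P := by
    intro k
    refine mem_of_forall_dual fun α hα => ?_
    have h2 : α ∈ span ℂ (Set.range γ) := by
      rw [hspan, mem_dualAnnihilator]
      exact hα
    have h3 : span ℂ (Set.range γ) ≤ LinearMap.ker (Module.Dual.eval ℂ _ (t k)) := by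
      rw [span_le]
      rintro _ ⟨i, rfl⟩
      exact hγt i k
    exact h3 h2
  refine ha (funext fun k => ?_)
  have h2 : span ℂ {p k} = tsp D f (χ k) ⊓ P := by
    refine eq_of_le_of_finrank_le (hle k) ?_
    have := hinf k
    have := hQ' k
    rw [finrank_span_singleton (hp0 k)]
    omega
  have h3 : t k ∈ span ℂ {p k} := by
    rw [h2]
    exact ⟨htT k, htP k⟩
  obtain ⟨c, hc⟩ := mem_span_singleton.1 h3
  exact hm.eq_zero_of_deriv (χ k) (c := c) hc.symm

lemma klin_injective (K : Type) [Field K] [Algebra ℂ K] [Algebra A K] [IsScalarTower ℂ A K]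
    [IsFractionRing A K] (hm : IsSurfModel S D f) (hnd : Nondeg S) :
    Function.Injective (klin K f) :=
  (IsFractionRing.injective A K).comp (hm.lform_injective hnd)

lemma eq_zero_of_jval {χ₁ χ₂ : A →ₐ[ℂ] ℂ} (h : tsp D f χ₁ ⊔ tsp D f χ₂ = ⊤)
    {α : Module.Dual ℂ (Fin (r + 1) → ℂ)} (h1 : jval D χ₁ (lform f α) = 0)
    (h2 : jval D χ₂ (lform f α) = 0) : α = 0 := by
  rw [← mem_bot (R := ℂ), ← dualAnnihilator_top, ← h, dualAnnihilator_sup_eq, mem_inf,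
    mem_dualAnnihilator, mem_dualAnnihilator, dual_eq_zero_iff_jval, dual_eq_zero_iff_jval]
  exact ⟨h1, h2⟩

lemma jval_smul (χ : A →ₐ[ℂ] ℂ) (c : ℂ) (α : Module.Dual ℂ (Fin (r + 1) → ℂ)) :
    jval D χ (lform f (c • α)) = c • jval D χ (lform f α) := by
  funext k
  rw [jval_lform, Pi.smul_apply, jval_lform, LinearMap.smul_apply]

/-- The multipliers at a point form an affine line. -/
theorem Gen.exists_affine {K : Type} [Field K] [Algebra ℂ K] [Algebra A K] [IsScalarTower ℂ A K]
    [IsFractionRing A K] (hm : IsSurfModel S D f) (hS : IsProjVar S) (hnd : Nondeg S)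
    (hdeg : adim (GhkCone S 1 2) < 9) (hr : r = 5) {x y z : A →ₐ[ℂ] ℂ} (hG : Gen D f x y z)
    {k k' : K} (hk : Link K D f x y k) (hk' : Link K D f x z k') :
    ∃ a b : ℂ, a ≠ 0 ∧ k' = algebraMap ℂ K a * k + algebraMap ℂ K b := by
  have hinj := klin_injective K hm hnd
  have hxy := sup_eq_top_of_six_le hr hG.span₁₂
  have hxz := sup_eq_top_of_six_le hr hG.span₁₃
  obtain ⟨α, hα0, hα⟩ : ∃ α : Module.Dual ℂ (Fin (r + 1) → ℂ), α ≠ 0 ∧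
      tsp D f x ⊔ (span ℂ {fun i => y (f i)} ⊔ span ℂ {fun i => z (f i)}) ≤ LinearMap.ker α := by
    refine Submodule.exists_le_ker_of_lt_top _ (lt_top_iff_ne_top.2 fun h => ?_)
    have h1 := finrank_add_le_finrank_add_finrank (tsp D f x)
      (span ℂ {fun i => y (f i)} ⊔ span ℂ {fun i => z (f i)})
    have h2 := finrank_add_le_finrank_add_finrank
      (span ℂ {fun i => y (f i)}) (span ℂ {fun i => z (f i)})
    have h3 := finrank_span_singleton_le_one fun i => y (f i)
    have h4 := finrank_span_singleton_le_one fun i => z (f i)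
    rw [h, hm.finrank_tsp, finrank_top, Module.finrank_fin_fun] at h1
    omega
  have hαx : jval D x (lform f α) = 0 :=
    (dual_eq_zero_iff_jval x α).1 fun v hv => hα (mem_sup_left hv)
  have hαy : y (lform f α) = 0 := by
    rw [algHom_lform]
    exact hα (mem_sup_right (mem_sup_left (mem_span_singleton_self _)))
  have hαz : z (lform f α) = 0 := by
    rw [algHom_lform]
    exact hα (mem_sup_right (mem_sup_right (mem_span_singleton_self _)))
  obtain ⟨β, hβ, hαβ⟩ := hk.2.1 α (mem_annihilator_tpt.2 ⟨hαx, hαy⟩)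
  obtain ⟨β', hβ', hαβ'⟩ := hk'.2.1 α (mem_annihilator_tpt.2 ⟨hαx, hαz⟩)
  have hβz := hk.vanish hm hG.transv₁ hαz hαβ
  have hβy := hk'.vanish hm hG.transv₁.swap hαy hαβ'
  obtain ⟨hβj, hβx⟩ := mem_annihilator_tpt.1 hβ
  obtain ⟨hβj', hβx'⟩ := mem_annihilator_tpt.1 hβ'
  have hL0 : klin K f α ≠ 0 := fun h => hα0 (hinj (h.trans (map_zero _).symm))
  have hβ0 : β ≠ 0 := by
    rintro rfl
    rw [map_zero] at hαβ
    exact (mul_ne_zero hk.1 hL0) hαβ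
  have hβ0' : β' ≠ 0 := by
    rintro rfl
    rw [map_zero] at hαβ'
    exact (mul_ne_zero hk'.1 hL0) hαβ'
  have hdepn : ¬ LinearIndependent ℂ ![α, β, β'] := by
    refine hm.not_linearIndependent hS hdeg hr ![x, y, z] ?_ _ ?_ ?_
    · have h1 : ∀ i, (fun j => (![x, y, z] i : A →ₐ[ℂ] ℂ) (f j)) ∈
          span ℂ (Set.range fun k j => (![x, y, z] k : A →ₐ[ℂ] ℂ) (f j)) :=
        fun i => subset_span ⟨i, rfl⟩
      intro i
      fin_cases i
      · exact hG.transv₁.le_finrank (h1 1) (h1 2)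
      · exact hG.transv₂.le_finrank (h1 0) (h1 2)
      · exact hG.transv₃.le_finrank (h1 0) (h1 1)
    · intro i k
      have hx0 : x (lform f α) = 0 := congrFun hαx 0
      have hy0 : y (lform f β) = 0 := congrFun hβj 0
      have hz0 : z (lform f β') = 0 := congrFun hβj' 0
      fin_cases i <;> fin_cases k <;> assumption
    · intro i
      fin_cases i <;> assumption
  obtain ⟨c, hc, i, hi⟩ := Fintype.not_linearIndependent_iff.1 hdepn
  simp only [Fin.sum_univ_three, Matrix.cons_val_zero, Matrix.cons_val_one, Matrix.cons_val] at hc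
  have key : ∀ (w : A →ₐ[ℂ] ℂ) (δ : Module.Dual ℂ (Fin (r + 1) → ℂ)), tsp D f x ⊔ tsp D f w = ⊤ →
      jval D w (lform f δ) = 0 → δ ≠ 0 → ∀ s t : ℂ, s • α + t • δ = 0 → s = 0 ∧ t = 0 := by
    intro w δ hw hδ hδ0 s t hst
    have h1 : s • α = 0 := by
      refine eq_zero_of_jval hw (by rw [jval_smul, hαx, smul_zero]) ?_
      rw [eq_neg_of_add_eq_zero_left hst, ← neg_smul, jval_smul, hδ, smul_zero]
    rw [h1, zero_add] at hst
    exact ⟨(smul_eq_zero.1 h1).resolve_right hα0, (smul_eq_zero.1 hst).resolve_right hδ0⟩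
  have hc2 : c 2 ≠ 0 := by
    intro h
    rw [h, zero_smul, add_zero] at hc
    obtain ⟨h0, h1⟩ := key y β hxy hβj hβ0 _ _ hc
    fin_cases i <;> exact hi (by assumption)
  have hc1 : c 1 ≠ 0 := by
    intro h
    rw [h, zero_smul, add_zero] at hc
    exact hc2 (key z β' hxz hβj' hβ0' _ _ hc).2
  have hc' := congrArg (klin K f) hc
  simp only [map_add, map_smul, map_zero, Algebra.smul_def, ← hαβ, ← hαβ'] at hc'
  have h4 : algebraMap ℂ K (c 0) + algebraMap ℂ K (c 1) * k + algebraMap ℂ K (c 2) * k' = 0 := by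
    refine (mul_eq_zero.1 ?_).resolve_right hL0
    linear_combination hc'
  refine ⟨-(c 1 / c 2), -(c 0 / c 2), neg_ne_zero.2 (div_ne_zero hc1 hc2), ?_⟩
  have h5 : algebraMap ℂ K (c 2) ≠ 0 := (map_ne_zero _).2 hc2
  rw [map_neg, map_neg, map_div₀, map_div₀]
  field_simp
  linear_combination h4

lemma Gen.mul_mem_range {K : Type} [Field K] [Algebra ℂ K] [Algebra A K] [IsScalarTower ℂ A K]
    [IsFractionRing A K] (hm : IsSurfModel S D f) (hS : IsProjVar S) (hnd : Nondeg S)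
    (hdeg : adim (GhkCone S 1 2) < 9) (hr : r = 5) {x y z : A →ₐ[ℂ] ℂ} (hG : Gen D f x y z)
    {k k' : K} (hk : Link K D f x y k) (hk' : Link K D f x z k')
    {α : Module.Dual ℂ (Fin (r + 1) → ℂ)} (hα : jval D x (lform f α) = 0) :
    ∃ β, k * klin K f α = klin K f β := by
  obtain ⟨a, b, ha, hab⟩ := hG.exists_affine hm hS hnd hdeg hr hk hk'
  obtain ⟨δ, hδ, hz⟩ := hm.exists_annihilator hG.transv₁
  obtain ⟨hδx, -⟩ := mem_annihilator_tpt.1 hδ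
  obtain ⟨β, -, hβ⟩ := hk.2.1 δ hδ
  let c := z (lform f α) / z (lform f δ)
  have h1 : α - c • δ ∈ (tpt D f x z).dualAnnihilator := by
    refine mem_annihilator_tpt.2 ⟨(dual_eq_zero_iff_jval x _).1 fun v hv => ?_, ?_⟩
    · rw [LinearMap.sub_apply, LinearMap.smul_apply, (dual_eq_zero_iff_jval x α).2 hα v hv,
        (dual_eq_zero_iff_jval x δ).2 hδx v hv, smul_zero, sub_zero]
    · rw [map_sub, map_smul, map_sub, map_smul, smul_eq_mul, div_mul_cancel₀ _ hz, sub_self]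
  obtain ⟨β', -, hβ'⟩ := hk'.2.1 _ h1
  refine ⟨a⁻¹ • (β' - b • (α - c • δ)) + c • β, ?_⟩
  have ha' : algebraMap ℂ K a ≠ 0 := (map_ne_zero _).2 ha
  simp only [map_add, map_sub, map_smul, ← hβ, ← hβ', hab, Algebra.smul_def, map_inv₀]
  field_simp
  ring

end Generic

section Pencil

variable {A : Type} [CommRing A] [Algebra ℂ A]
  {r : ℕ} {S : Set (Fin (r + 1) → ℂ)} {D : Fin 2 → Derivation ℂ A A} {f : Fin (r + 1) → A}

lemma ZOpen.const (p : Prop) : ZOpen fun _ : A →ₐ[ℂ] ℂ => p :=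
  fun _ h => ⟨1, by rw [map_one]; exact one_ne_zero, fun _ _ => h⟩

lemma ZOpen₃.swap₁₂ {R : (A →ₐ[ℂ] ℂ) → (A →ₐ[ℂ] ℂ) → (A →ₐ[ℂ] ℂ) → Prop} (h : ZOpen₃ R) :
    ZOpen₃ fun x y z => R y x z :=
  ⟨fun y z => h.2 y z, fun x z => h.1 x z, fun x y => h.3 y x⟩

lemma ZOpen₃.swap₂₃ {R : (A →ₐ[ℂ] ℂ) → (A →ₐ[ℂ] ℂ) → (A →ₐ[ℂ] ℂ) → Prop} (h : ZOpen₃ R) :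
    ZOpen₃ fun x y z => R x z y :=
  ⟨fun y z => h.1 z y, fun x z => h.3 x z, fun x y => h.2 x y⟩

lemma zopen₃_span : ZOpen₃ fun x y _ : A →ₐ[ℂ] ℂ =>
    6 ≤ Module.finrank ℂ ↥(tsp D f x ⊔ tsp D f y) := by
  refine ⟨fun y z => zopen_rank (jetv D f) (tsp D f y) 6, fun x z => ?_, fun x y => .const _⟩
  have e : (fun y => 6 ≤ Module.finrank ℂ ↥(tsp D f x ⊔ tsp D f y)) =
      fun y => 6 ≤ Module.finrank ℂ ↥(tsp D f y ⊔ tsp D f x) :=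
    funext fun y => by rw [sup_comm]
  rw [e]
  exact zopen_rank (jetv D f) (tsp D f x) 6

lemma zopen₃_transv : ZOpen₃ (Transv D f) := by
  have h : ∀ x z : A →ₐ[ℂ] ℂ, ZOpen fun y => Transv D f x y z := by
    intro x z
    have e : (fun y => Transv D f x y z) = fun y => 5 ≤ Module.finrank ℂ
        ↥(span ℂ (Set.range fun (_ : Unit) i => y (f i)) ⊔ (tsp D f x ⊔ span ℂ {fun i => z (f i)})) := by
      funext y
      rw [Set.range_const, Transv, sup_left_comm]
    rw [e]
    exact zopen_rank (fun _ : Unit => f) _ 5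
  refine ⟨fun y z => zopen_rank (jetv D f) _ 5, h, fun x y => ?_⟩
  have e : (fun z => Transv D f x y z) = fun z => Transv D f x z y :=
    funext fun z => propext ⟨Transv.swap, Transv.swap⟩
  rw [e]
  exact h x y

lemma zopen₃_gen : ZOpen₃ (Gen D f) := by
  have e : Gen D f = fun x y z => 6 ≤ Module.finrank ℂ ↥(tsp D f x ⊔ tsp D f y) ∧
      6 ≤ Module.finrank ℂ ↥(tsp D f x ⊔ tsp D f z) ∧
      6 ≤ Module.finrank ℂ ↥(tsp D f y ⊔ tsp D f z) ∧
      Transv D f x y z ∧ Transv D f y x z ∧ Transv D f z x y := by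
    funext x y z
    exact propext ⟨fun h => ⟨h.1, h.2, h.3, h.4, h.5, h.6⟩,
      fun ⟨h1, h2, h3, h4, h5, h6⟩ => ⟨h1, h2, h3, h4, h5, h6⟩⟩
  have h1 := zopen₃_span (D := D) (f := f)
  have h2 := zopen₃_transv (D := D) (f := f)
  rw [e]
  exact h1.and (h1.swap₂₃.and (h1.swap₂₃.swap₁₂.and (h2.and (h2.swap₁₂.and h2.swap₁₂.swap₂₃))))

lemma IsSurfModel.exists_transv [Nontrivial A] (hm : IsSurfModel S D f) (hnd : Nondeg S) (hr : r = 5) :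
    ∃ x y z, Transv D f x y z := by
  obtain ⟨x, -⟩ := hm.sep 1 one_ne_zero
  have hlt : ∀ N : Submodule ℂ (Fin (r + 1) → ℂ), Module.finrank ℂ N ≤ 5 → N ≠ ⊤ := by
    rintro _ h rfl
    rw [finrank_top, Module.finrank_fin_fun] at h
    omega
  have hup : ∀ (N : Submodule ℂ (Fin (r + 1) → ℂ)) v, v ∉ N →
      Module.finrank ℂ N + 1 ≤ Module.finrank ℂ ↥(N ⊔ span ℂ {v}) := fun N v hv =>
    finrank_lt_finrank_of_lt (lt_of_le_of_ne le_sup_left fun e =>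
      hv (e ▸ mem_sup_right (mem_span_singleton_self v)))
  have hT := hm.finrank_tsp x
  obtain ⟨y, hy⟩ := hm.exists_pt_notMem hnd (hlt (tsp D f x) (by omega))
  have h1 := hup _ _ hy
  have h2 := finrank_add_le_finrank_add_finrank (tsp D f x) (span ℂ {fun i => y (f i)})
  have h3 := finrank_span_singleton_le_one fun i => y (f i)
  obtain ⟨z, hz⟩ := hm.exists_pt_notMem hnd (hlt (tsp D f x ⊔ span ℂ {fun i => y (f i)}) (by omega))
  have h4 := hup _ _ hz
  refine ⟨x, y, z, ?_⟩
  rw [Transv, ← sup_assoc]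
  omega

lemma IsSurfModel.exists_gen [IsDomain A] (hm : IsSurfModel S D f) (hnd : Nondeg S) (hr : r = 5)
    (h : ∃ x y, tsp D f x ⊔ tsp D f y = ⊤) : ∃ x y z, Gen D f x y z := by
  obtain ⟨x, y, hxy⟩ := h
  have h0 : 6 ≤ Module.finrank ℂ ↥(tsp D f x ⊔ tsp D f y) := by
    rw [hxy, finrank_top, Module.finrank_fin_fun]
    omega
  obtain ⟨a, b, c, habc⟩ := hm.exists_transv hnd hr
  have h1 := zopen₃_span (D := D) (f := f)
  have h2 := zopen₃_transv (D := D) (f := f)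
  obtain ⟨u, v, w, h3, h4, h5, h6, h7, h8⟩ :=
    h1.exists_and hm.sep (h1.swap₂₃.and (h1.swap₂₃.swap₁₂.and (h2.and (h2.swap₁₂.and
      h2.swap₁₂.swap₂₃)))) ⟨x, y, x, h0⟩ <| h1.swap₂₃.exists_and hm.sep (h1.swap₂₃.swap₁₂.and
      (h2.and (h2.swap₁₂.and h2.swap₁₂.swap₂₃))) ⟨x, x, y, h0⟩ <|
      h1.swap₂₃.swap₁₂.exists_and hm.sep (h2.and (h2.swap₁₂.and h2.swap₁₂.swap₂₃)) ⟨x, x, y, h0⟩ <|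
      h2.exists_and hm.sep (h2.swap₁₂.and h2.swap₁₂.swap₂₃) ⟨a, b, c, habc⟩ <|
      h2.swap₁₂.exists_and hm.sep h2.swap₁₂.swap₂₃ ⟨b, a, c, habc⟩ ⟨b, c, a, habc⟩
  exact ⟨u, v, w, h3, h4, h5, h6, h7, h8⟩

end Pencil

section PencilExists

variable {A : Type} [CommRing A] [Algebra ℂ A]
  {r : ℕ} {S : Set (Fin (r + 1) → ℂ)} {D : Fin 2 → Derivation ℂ A A} {f : Fin (r + 1) → A}

lemma finrank_map_of_injective {V W : Type*} [AddCommGroup V] [Module ℂ V] [AddCommGroup W] [Module ℂ W]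
    (g : V →ₗ[ℂ] W) (hg : Function.Injective g) (p : Submodule ℂ V) :
    Module.finrank ℂ (p.map g) = Module.finrank ℂ p :=
  (p.equivMapOfInjective g hg).finrank_eq.symm

lemma mem_annihilator_tsp {χ : A →ₐ[ℂ] ℂ} {α : Module.Dual ℂ (Fin (r + 1) → ℂ)} :
    α ∈ (tsp D f χ).dualAnnihilator ↔ jval D χ (lform f α) = 0 := by
  rw [mem_dualAnnihilator, dual_eq_zero_iff_jval]

lemma IsSurfModel.finrank_annihilator_tsp (hm : IsSurfModel S D f) (hr : r = 5) (χ : A →ₐ[ℂ] ℂ) :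
    Module.finrank ℂ ↥(tsp D f χ).dualAnnihilator = 3 := by
  have h := Subspace.finrank_add_finrank_dualAnnihilator_eq (tsp D f χ)
  rw [hm.finrank_tsp, Module.finrank_fin_fun] at h
  omega

/-- The linear forms remaining linear after multiplication by `k`. -/
def stab (K : Type) [Field K] [Algebra ℂ K] [Algebra A K] [IsScalarTower ℂ A K]
    (f : Fin (r + 1) → A) (k : K) : Submodule ℂ K :=
  LinearMap.range (klin K f) ⊓ (LinearMap.range (klin K f)).comap (LinearMap.mulLeft ℂ k)

lemma klin_mem_stab {K : Type} [Field K] [Algebra ℂ K] [Algebra A K] [IsScalarTower ℂ A K] {k : K}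
    {α β : Module.Dual ℂ (Fin (r + 1) → ℂ)} (h : k * klin K f α = klin K f β) :
    klin K f α ∈ stab K f k :=
  ⟨⟨α, rfl⟩, ⟨β, h.symm⟩⟩

variable (K : Type) [Field K] [Algebra ℂ K] [Algebra A K] [IsScalarTower ℂ A K] [IsFractionRing A K]

lemma IsSurfModel.exists_link_of_le [IsDomain A] (hm : IsSurfModel S D f) (hS : IsProjVar S)
    (hdeg : adim (GhkCone S 1 2) < 9) (hr : r = 5) {x y : A →ₐ[ℂ] ℂ}
    (h : 6 ≤ Module.finrank ℂ ↥(tsp D f x ⊔ tsp D f y)) : ∃ k : K, Link K D f x y k := by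
  refine hm.exists_link K hS hdeg ?_ (sup_eq_top_of_six_le hr h)
  have h1 := finrank_sup_add_finrank_inf_eq (tsp D f x) (tsp D f y)
  rw [hm.finrank_tsp, hm.finrank_tsp] at h1
  rw [disjoint_iff, ← finrank_eq_zero (R := ℂ)]
  omega

variable {K}

lemma Gen.map_annihilator_le {x y z : A →ₐ[ℂ] ℂ} [IsDomain A] (hm : IsSurfModel S D f) (hS : IsProjVar S)
    (hnd : Nondeg S) (hdeg : adim (GhkCone S 1 2) < 9) (hr : r = 5) (hG : Gen D f x y z) {k : K}
    (hk : Link K D f x y k) : (tsp D f x).dualAnnihilator.map (klin K f) ≤ stab K f k := by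
  obtain ⟨k', hk'⟩ := hm.exists_link_of_le K hS hdeg hr hG.span₁₃
  rintro _ ⟨α, hα, rfl⟩
  obtain ⟨β, hβ⟩ := hG.mul_mem_range hm hS hnd hdeg hr hk hk' (mem_annihilator_tsp.1 hα)
  exact klin_mem_stab hβ

lemma Gen.exists_add_mul [IsDomain A] (hm : IsSurfModel S D f) (hS : IsProjVar S) (hnd : Nondeg S)
    (hdeg : adim (GhkCone S 1 2) < 9) (hr : r = 5) {x y z : A →ₐ[ℂ] ℂ} (hG : Gen D f x y z) {k : K}
    (hk : Link K D f x y k) (α : Module.Dual ℂ (Fin (r + 1) → ℂ)) :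
    ∃ u ∈ stab K f k, ∃ v ∈ stab K f k, klin K f α = u + k * v := by
  have hsum : (tsp D f x).dualAnnihilator ⊔ (tsp D f y).dualAnnihilator = ⊤ := by
    have h1 := finrank_sup_add_finrank_inf_eq (tsp D f x) (tsp D f y)
    have h2 := hG.span₁₂
    rw [hm.finrank_tsp, hm.finrank_tsp] at h1
    have h3 : tsp D f x ⊓ tsp D f y = ⊥ := by
      rw [← finrank_eq_zero (R := ℂ)]
      omega
    rw [← Subspace.dualAnnihilator_inf_eq, h3, dualAnnihilator_bot]
  obtain ⟨β, hβ, γ, hγ, rfl⟩ := mem_sup.1 (hsum.ge (mem_top (x := α)))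
  have h1 := hG.swap₁₂.map_annihilator_le hm hS hnd hdeg hr hk.symm (mem_map_of_mem hγ)
  obtain ⟨δ, hδ⟩ := h1.2
  have hδ' : k * klin K f δ = klin K f γ := by
    rw [hδ]
    exact mul_inv_cancel_left₀ hk.1 _
  refine ⟨_, hG.map_annihilator_le hm hS hnd hdeg hr hk (mem_map_of_mem hβ), _,
    klin_mem_stab hδ', ?_⟩
  rw [map_add, hδ']

lemma Gen.transcendental [IsDomain A] (hm : IsSurfModel S D f) (hnd : Nondeg S) (hr : r = 5)
    {x y z : A →ₐ[ℂ] ℂ} (hG : Gen D f x y z) {k : K} (hk : Link K D f x y k) :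
    Transcendental ℂ k := by
  intro halg
  obtain ⟨c, rfl⟩ := exists_algebraMap_eq_of_isAlgebraic halg
  obtain ⟨α, hα, hz⟩ := hm.exists_annihilator hG.transv₁
  obtain ⟨β, hβ, h⟩ := hk.2.1 α hα
  have hα0 : c • α ≠ 0 := smul_ne_zero (fun h => hk.1 (by rw [h, map_zero])) (by
    rintro rfl
    rw [map_zero, map_zero] at hz
    exact hz rfl)
  have h1 : c • α = β := klin_injective K hm hnd (by rw [map_smul, Algebra.smul_def, h])
  refine hα0 (eq_zero_of_jval (sup_eq_top_of_six_le hr hG.span₁₂) ?_ ?_)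
  · rw [jval_smul, (mem_annihilator_tpt.1 hα).1, smul_zero]
  · rw [h1]
    exact (mem_annihilator_tpt.1 hβ).1

instance finiteDimensional_stab (k : K) : FiniteDimensional ℂ ↥(stab K f k) :=
  finiteDimensional_of_le (S₂ := LinearMap.range (klin K f)) inf_le_left

lemma Gen.smul_add_smul_mem [IsDomain A] (hm : IsSurfModel S D f) (hS : IsProjVar S) (hnd : Nondeg S)
    (hdeg : adim (GhkCone S 1 2) < 9) (hr : r = 5) {x y w : A →ₐ[ℂ] ℂ} (hG : Gen D f x y w) {k : K}
    (hk : Link K D f x y k) (hY : stab K f k ≤ (tsp D f x).dualAnnihilator.map (klin K f))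
    {α β : Module.Dual ℂ (Fin (r + 1) → ℂ)} (hα : jval D x (lform f α) = 0)
    (h : k * klin K f α = klin K f β) :
    ∃ a b : ℂ, a ≠ 0 ∧ jval D w (lform f (a • β + b • α)) = 0 := by
  have hinj := klin_injective K hm hnd
  obtain ⟨k', hk'⟩ := hm.exists_link_of_le K hS hdeg hr hG.span₁₃
  obtain ⟨a, b, ha, hab⟩ := hG.exists_affine hm hS hnd hdeg hr hk hk'
  have ha' : algebraMap ℂ K a ≠ 0 := (map_ne_zero _).2 ha
  have hle : (tsp D f w).dualAnnihilator.map (klin K f) ≤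
      ((tsp D f x).dualAnnihilator.map (klin K f)).map (LinearMap.mulLeft ℂ k') := by
    rintro _ ⟨γ, hγ, rfl⟩
    have h1 := hG.swap₂₃.swap₁₂.map_annihilator_le hm hS hnd hdeg hr hk'.symm (mem_map_of_mem hγ)
    obtain ⟨δ, hδ⟩ := h1.2
    have hδ' : k' * klin K f δ = klin K f γ := by
      rw [hδ]
      exact mul_inv_cancel_left₀ hk'.1 _
    refine ⟨klin K f δ, hY (klin_mem_stab (β := a⁻¹ • (γ - b • δ)) ?_), hδ'⟩
    rw [map_smul, map_sub, map_smul, ← hδ', hab, Algebra.smul_def, Algebra.smul_def, map_inv₀]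
    field_simp
    ring
  have hmul : Function.Injective (LinearMap.mulLeft ℂ k') := fun u v huv =>
    mul_left_cancel₀ hk'.1 huv
  have heq := eq_of_le_of_finrank_le hle (by
    rw [finrank_map_of_injective _ hmul, finrank_map_of_injective _ hinj,
      finrank_map_of_injective _ hinj, hm.finrank_annihilator_tsp hr,
      hm.finrank_annihilator_tsp hr])
  obtain ⟨γ, hγ, h2⟩ : LinearMap.mulLeft ℂ k' (klin K f α) ∈
      (tsp D f w).dualAnnihilator.map (klin K f) := by
    rw [heq]
    exact mem_map_of_mem (mem_map_of_mem (mem_annihilator_tsp.2 hα))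
  refine ⟨a, b, ha, ?_⟩
  have h3 : a • β + b • α = γ := by
    refine hinj ?_
    rw [h2, LinearMap.mulLeft_apply, hab, map_add, map_smul, map_smul, ← h, Algebra.smul_def,
      Algebra.smul_def]
    ring
  rw [h3]
  exact mem_annihilator_tsp.1 hγ

/-- The surface carries a pencil. -/
theorem IsSurfModel.exists_pencil [IsDomain A] (K : Type) [Field K] [Algebra ℂ K] [Algebra A K]
    [IsScalarTower ℂ A K] [IsFractionRing A K] (hm : IsSurfModel S D f) (hS : IsProjVar S)
    (hnd : Nondeg S) (hdeg : adim (GhkCone S 1 2) < 9) (hr : r = 5)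
    (h : ∃ x y, tsp D f x ⊔ tsp D f y = ⊤) : ∃ k : K, Transcendental ℂ k ∧
      (∀ α, ∃ u ∈ stab K f k, ∃ v ∈ stab K f k, klin K f α = u + k * v) ∧
      4 ≤ Module.finrank ℂ ↥(stab K f k) := by
  obtain ⟨x, y, z, hG⟩ := hm.exists_gen hnd hr h
  obtain ⟨k, hk⟩ := hm.exists_link_of_le K hS hdeg hr hG.span₁₂
  refine ⟨k, hG.transcendental hm hnd hr hk, hG.exists_add_mul hm hS hnd hdeg hr hk, ?_⟩
  by_contra hlt
  have hle := hG.map_annihilator_le hm hS hnd hdeg hr hk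
  have hfin : Module.finrank ℂ ↥((tsp D f x).dualAnnihilator.map (klin K f)) = 3 := by
    rw [finrank_map_of_injective _ (klin_injective K hm hnd),
      hm.finrank_annihilator_tsp hr]
  have hY := (eq_of_le_of_finrank_le hle (by omega)).ge
  obtain ⟨α, hα, hz⟩ := hm.exists_annihilator hG.transv₁
  obtain ⟨β, hβ, hαβ⟩ := hk.2.1 α hα
  have hαx := (mem_annihilator_tpt.1 hα).1
  have hwr : ∀ j, wr (D j) (lform f α) (lform f β) = 0 := by
    intro j
    by_contra hne
    obtain ⟨w₀, hw₀⟩ := hm.sep _ hne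
    obtain ⟨w, hw, hw'⟩ := ZOpen.exists_and hm.sep (zopen₃_gen.3 x y) (zopen_ne_zero _) hG hw₀
    obtain ⟨a, b, ha, hab⟩ := hw.smul_add_smul_mem hm hS hnd hdeg hr hk hY hαx hαβ
    have h0 := congrFun hab 0
    have hj := congrFun hab j.succ
    have hj' : a * w (D j (lform f β)) + b * w (D j (lform f α)) = 0 := by
      rw [map_add, map_smul, map_smul] at hj
      fin_cases j <;> simpa [jval] using hj
    have h0' : a * w (lform f β) + b * w (lform f α) = 0 := by
      rw [map_add, map_smul, map_smul] at h0
      simpa [jval] using h0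
    refine hw' ?_
    rw [wr, map_sub, map_mul, map_mul]
    refine (mul_eq_zero.1 ?_).resolve_left ha
    linear_combination w (lform f α) * hj' - w (D j (lform f α)) * h0'
  have hprop := hm.proportional_of_wr hz hwr
  have h1 : z (lform f α) • β = z (lform f β) • α :=
    hm.lform_injective hnd (by rw [map_smul, map_smul]; exact hprop)
  have h2 : z (lform f α) • β = 0 := by
    refine eq_zero_of_jval (sup_eq_top_of_six_le hr hG.span₁₂) ?_ ?_
    · rw [h1, jval_smul, hαx, smul_zero]
    · rw [jval_smul, (mem_annihilator_tpt.1 hβ).1, smul_zero]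
  rw [(smul_eq_zero.1 h2).resolve_left hz, map_zero] at hαβ
  have h3 := (mul_eq_zero.1 hαβ).resolve_left hk.1
  have h4 : α = 0 := klin_injective K hm hnd (h3.trans (map_zero _).symm)
  rw [h4, map_zero, map_zero] at hz
  exact hz rfl

end PencilExists

section Decompose

variable {K : Type} [Field K] [Algebra ℂ K] {k : K}

lemma linearIndependent_mul_pow (hk : Transcendental ℂ k) {z : K} (hz : z ≠ 0) (n : ℕ) :
    LinearIndependent ℂ fun i : Fin n => z * k ^ (i : ℕ) := by
  rw [Fintype.linearIndependent_iff]
  intro c hc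
  have h1 : Polynomial.aeval k (∑ i : Fin n, Polynomial.monomial (i : ℕ) (c i)) = 0 := by
    refine (mul_eq_zero.1 (?_ : z * _ = 0)).resolve_left hz
    rw [← hc, map_sum, Finset.mul_sum]
    refine Finset.sum_congr rfl fun i _ => ?_
    rw [Polynomial.aeval_monomial, Algebra.smul_def]
    ring
  have h2 := transcendental_iff.1 hk _ h1
  intro i
  have h3 := congrArg (fun p => Polynomial.coeff p (i : ℕ)) h2
  simpa [Polynomial.finsetSum_coeff, Polynomial.coeff_monomial, Fin.val_inj] using h3

lemma mulLeft_injective_of_ne_zero (hk : k ≠ 0) : Function.Injective (LinearMap.mulLeft ℂ k) :=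
  fun _ _ h => mul_left_cancel₀ hk h

lemma finrank_add_finrank_le_of_mul (hk : k ≠ 0) (P Q : Submodule ℂ K) [FiniteDimensional ℂ Q]
    (hPQ : P ≤ Q) (hkP : P.map (LinearMap.mulLeft ℂ k) ≤ Q) :
    Module.finrank ℂ P + Module.finrank ℂ P ≤
      Module.finrank ℂ ↥(P ⊓ P.comap (LinearMap.mulLeft ℂ k)) + Module.finrank ℂ Q := by
  have hinj := mulLeft_injective_of_ne_zero hk
  have : FiniteDimensional ℂ P := finiteDimensional_of_le hPQ
  have h1 := finrank_sup_add_finrank_inf_eq (P.map (LinearMap.mulLeft ℂ k)) P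
  have h2 : P.map (LinearMap.mulLeft ℂ k) ⊓ P =
      (P ⊓ P.comap (LinearMap.mulLeft ℂ k)).map (LinearMap.mulLeft ℂ k) := by
      ext u
      constructor
      · rintro ⟨⟨w, hw, rfl⟩, hu⟩
        exact ⟨w, ⟨hw, hu⟩, rfl⟩
      · rintro ⟨w, ⟨hw, hu⟩, rfl⟩
        exact ⟨⟨w, hw, rfl⟩, hu⟩
  rw [h2, finrank_map_of_injective _ hinj, finrank_map_of_injective _ hinj] at h1
  have h3 := finrank_mono (sup_le hkP hPQ)
  omega

lemma exists_mul_pow_mem (hk : k ≠ 0) (n : ℕ) : ∀ P Q : Submodule ℂ K, FiniteDimensional ℂ Q →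
    P ≤ Q → P.map (LinearMap.mulLeft ℂ k) ≤ Q → Module.finrank ℂ Q ≤ Module.finrank ℂ P + 1 →
    n + 1 ≤ Module.finrank ℂ Q → ∃ z ≠ 0, ∀ i ≤ n, z * k ^ i ∈ Q := by
  induction n with
  | zero =>
    intro P Q _ _ _ _ hn
    have h : Q ≠ ⊥ := by
      rintro rfl
      rw [finrank_bot] at hn
      omega
    obtain ⟨z, hz, hz0⟩ := exists_mem_ne_zero_of_ne_bot h
    refine ⟨z, hz0, fun i hi => ?_⟩
    rw [Nat.le_zero.1 hi, pow_zero, mul_one]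
    exact hz
  | succ n ih =>
    intro P Q _ hPQ hkP hQ hn
    have h1 := finrank_add_finrank_le_of_mul hk P Q hPQ hkP
    obtain ⟨z, hz, h⟩ := ih (P ⊓ P.comap (LinearMap.mulLeft ℂ k)) P (finiteDimensional_of_le hPQ)
      inf_le_left (map_le_iff_le_comap.2 inf_le_right) (by omega) (by omega)
    refine ⟨z, hz, fun i hi => ?_⟩
    rcases Nat.le_or_eq_of_le_succ hi with hi | rfl
    · exact hPQ (h i hi)
    · have h2 := hkP (mem_map_of_mem (h n le_rfl))
      rw [LinearMap.mulLeft_apply] at h2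
      rw [pow_succ]
      convert h2 using 1
      ring

theorem exists_scroll_basis (hk : Transcendental ℂ k) (E Y : Submodule ℂ K)
    (hE : Module.finrank ℂ E = 6) (hYE : Y ≤ E) (hkY : Y.map (LinearMap.mulLeft ℂ k) ≤ E)
    (hsum : ∀ e ∈ E, ∃ u ∈ Y, ∃ v ∈ Y, e = u + k * v) (hY : 4 ≤ Module.finrank ℂ Y) :
    (∃ s, E ≤ span ℂ (Set.range fun i : Fin 6 => s * k ^ (i : ℕ))) ∨
    (∃ s t, E ≤ span ℂ (Set.range ![s, s * k, s * k ^ 2, t, t * k, t * k ^ 2])) ∨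
    ∃ s t, E ≤ span ℂ (Set.range ![s, s * k, t, t * k, t * k ^ 2, t * k ^ 3]) := by
  have hk0 : k ≠ 0 := by
    rintro rfl
    exact hk isAlgebraic_zero
  have hinj := mulLeft_injective_of_ne_zero hk0
  have hfE : FiniteDimensional ℂ E := Module.finite_of_finrank_pos (by omega)
  have hfY : FiniteDimensional ℂ Y := finiteDimensional_of_le hYE
  rcases Nat.lt_or_ge 4 (Module.finrank ℂ Y) with h5 | h4
  · left
    obtain ⟨z, hz, h⟩ := exists_mul_pow_mem hk0 5 Y E hfE hYE hkY (by omega) (by omega)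
    refine ⟨z, (eq_of_le_of_finrank_le ?_ ?_).ge⟩
    · rw [span_le]
      rintro _ ⟨i, rfl⟩
      exact h i (by omega)
    · rw [finrank_span_eq_card (linearIndependent_mul_pow hk hz 6), hE, Fintype.card_fin]
  right
  let Z := Y ⊓ Y.comap (LinearMap.mulLeft ℂ k)
  have hZ2 := finrank_add_finrank_le_of_mul hk0 Y E hYE hkY
  by_cases hz : ∃ z, z ≠ 0 ∧ z ∈ Z ∧ z * k ∈ Z
  · right
    obtain ⟨z, hz, hzZ, hkz⟩ := hz
    let T := span ℂ (Set.range fun i : Fin 3 => z * k ^ (i : ℕ))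
    have hT : Module.finrank ℂ T = 3 := by
      rw [finrank_span_eq_card (linearIndependent_mul_pow hk hz 3), Fintype.card_fin]
    have hTY : T ≤ Y := by
      rw [span_le]
      rintro _ ⟨i, rfl⟩
      have h1 : k * (z * k) ∈ Y := hkz.2
      fin_cases i
      · simpa using hzZ.1
      · simpa using hkz.1
      · change z * k ^ 2 ∈ Y
        convert h1 using 1
        ring
    have hfT : FiniteDimensional ℂ T := finiteDimensional_of_le hTY
    obtain ⟨y, hyY, hyT⟩ : ∃ y ∈ Y, y ∉ T := by
      by_contra! h
      have := finrank_mono (show Y ≤ T from h)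
      omega
    have hle : T ⊔ span ℂ {y} ≤ Y := sup_le hTY (by rwa [span_singleton_le_iff_mem])
    have hfTy : FiniteDimensional ℂ ↥(T ⊔ span ℂ {y}) := finiteDimensional_of_le hle
    have hYT : T ⊔ span ℂ {y} = Y := by
      refine eq_of_le_of_finrank_le hle ?_
      · have h1 : T < T ⊔ span ℂ {y} := lt_of_le_of_ne le_sup_left fun e =>
          hyT (e ▸ mem_sup_right (mem_span_singleton_self y))
        have := finrank_lt_finrank_of_lt h1
        omega
    have hform : ∀ u ∈ Y, ∃ a b c d : ℂ, u = a • z + b • (z * k) + c • (z * k ^ 2) + d • y := by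
      intro u hu
      rw [← hYT] at hu
      obtain ⟨t, ht, w, hw, rfl⟩ := mem_sup.1 hu
      obtain ⟨c, rfl⟩ := (mem_span_range_iff_exists_fun ℂ).1 ht
      obtain ⟨d, rfl⟩ := mem_span_singleton.1 hw
      refine ⟨c 0, c 1, c 2, d, ?_⟩
      simp [Fin.sum_univ_three]
    refine ⟨y, z, fun e he => ?_⟩
    obtain ⟨u, hu, v, hv, rfl⟩ := hsum e he
    obtain ⟨a, b, c, d, rfl⟩ := hform u hu
    obtain ⟨a', b', c', d', rfl⟩ := hform v hv
    refine (mem_span_range_iff_exists_fun ℂ).2 ⟨![d, d', a, b + a', c + b', c'], ?_⟩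
    simp only [Fin.sum_univ_six, Algebra.smul_def, Matrix.cons_val]
    simp only [map_add]
    ring
  · left
    push Not at hz
    have hdis : Z ⊓ Z.map (LinearMap.mulLeft ℂ k) = ⊥ := by
      rw [eq_bot_iff]
      rintro _ ⟨h1, z, hz', rfl⟩
      have h0 : z = 0 := by
        by_contra h0
        refine hz z h0 hz' ?_
        rw [mul_comm]
        exact h1
      rw [h0, map_zero]
      exact zero_mem _
    have hkZ : Z.map (LinearMap.mulLeft ℂ k) ≤ Y := map_le_iff_le_comap.2 inf_le_right
    have hfZ : FiniteDimensional ℂ Z := finiteDimensional_of_le (S₂ := Y) inf_le_left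
    have h1 := finrank_sup_add_finrank_inf_eq Z (Z.map (LinearMap.mulLeft ℂ k))
    rw [hdis, finrank_bot, finrank_map_of_injective _ hinj] at h1
    have h2 : Z ⊔ Z.map (LinearMap.mulLeft ℂ k) ≤ Y := sup_le inf_le_left hkZ
    have h3 := finrank_mono h2
    have hZ2' : Module.finrank ℂ Y + Module.finrank ℂ Y ≤ Module.finrank ℂ Z + Module.finrank ℂ E := hZ2
    have hZ : Module.finrank ℂ Z = 2 := by omega
    have hYZ := eq_of_le_of_finrank_le h2 (by omega)
    let b := Module.finBasisOfFinrankEq ℂ Z hZ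
    have hZform : ∀ u ∈ Z, ∃ c d : ℂ, u = c • (b 0 : K) + d • (b 1 : K) := by
      intro u hu
      have h4 := b.sum_repr ⟨u, hu⟩
      refine ⟨b.repr ⟨u, hu⟩ 0, b.repr ⟨u, hu⟩ 1, ?_⟩
      have h5 := congrArg Subtype.val h4
      rw [Fin.sum_univ_two] at h5
      exact h5.symm
    have hform : ∀ u ∈ Y, ∃ c d c' d' : ℂ,
        u = c • (b 0 : K) + d • (b 1 : K) + k * (c' • (b 0 : K) + d' • (b 1 : K)) := by
      intro u hu
      rw [← hYZ] at hu
      obtain ⟨t, ht, _, ⟨w, hw, rfl⟩, rfl⟩ := mem_sup.1 hu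
      obtain ⟨c, d, rfl⟩ := hZform t ht
      obtain ⟨c', d', rfl⟩ := hZform w hw
      exact ⟨c, d, c', d', rfl⟩
    refine ⟨b 0, b 1, fun e he => ?_⟩
    obtain ⟨u, hu, v, hv, rfl⟩ := hsum e he
    obtain ⟨c, d, c', d', rfl⟩ := hform u hu
    obtain ⟨p, q, p', q', rfl⟩ := hform v hv
    refine (mem_span_range_iff_exists_fun ℂ).2 ⟨![c, c' + p, p', d, d' + q, q'], ?_⟩
    simp only [Fin.sum_univ_six, Algebra.smul_def, Matrix.cons_val]
    simp only [map_add]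
    ring

end Decompose

section Closure

variable {W W' : Type*} [AddCommGroup W] [Module ℂ W] [AddCommGroup W'] [Module ℂ W']

lemma polyFun_comp_linear (g : W →ₗ[ℂ] W') {f : W' → ℂ} (hf : f ∈ PolyFun W') :
    (fun x => f (g x)) ∈ PolyFun W := by
  induction hf using Algebra.adjoin_induction with
  | mem f hf =>
    obtain ⟨h1, h2⟩ := hf
    exact polyFun_of_linear ⟨fun x y => by rw [map_add, h1], fun c x => by rw [map_smul, h2]⟩
  | algebraMap c => exact (PolyFun W).algebraMap_mem c
  | add f h _ _ h1 h2 => exact (PolyFun W).add_mem h1 h2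
  | mul f h _ _ h1 h2 => exact (PolyFun W).mul_mem h1 h2

lemma mem_zcl_iff {A : Set W} {x : W} :
    x ∈ zcl A ↔ ∀ f ∈ PolyFun W, (∀ a ∈ A, f a = 0) → f x = 0 := by
  refine ⟨fun hx f hf h => zcl_vanish hf h x hx, fun h => ?_⟩
  by_contra hx
  obtain ⟨f, hf, h0, hfx⟩ := (isAlgSet_zcl A).exists_not_vanish hx
  exact hfx (h f hf fun a ha => h0 a (subset_zcl A ha))

lemma zcl_image (g : W →ₗ[ℂ] W') (A : Set W) : g '' zcl A ⊆ zcl (g '' A) := by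
  rintro _ ⟨x, hx, rfl⟩
  rw [mem_zcl_iff] at hx ⊢
  exact fun f hf h => hx _ (polyFun_comp_linear g hf) fun a ha => h _ ⟨a, ha, rfl⟩

lemma image_zcl (g : W ≃ₗ[ℂ] W') (A : Set W) : g '' zcl A = zcl (g '' A) := by
  refine (zcl_image g.toLinearMap A).antisymm fun x hx => ⟨g.symm x, ?_, g.apply_symm_apply x⟩
  have h := zcl_image g.symm.toLinearMap (g '' A) ⟨x, hx, rfl⟩
  have e : g.symm.toLinearMap '' (g '' A) = A := g.toEquiv.symm_image_image A
  rw [e] at h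
  exact h

lemma add_one_le_adim {X Y : Set W} (hY : IsIrrAlg Y) (hXY : X ⊆ Y) (hne : X ≠ Y) {d : ℕ}
    (hX : ((d + 1 : ℕ) : ℕ∞) ≤ adim X) : ((d + 2 : ℕ) : ℕ∞) ≤ adim Y := by
  have h' : (d : ℕ∞) < adim X := lt_of_lt_of_le (by exact_mod_cast d.lt_succ_self) hX
  obtain ⟨_, ⟨n, rfl, c, hc, hi⟩, hlt⟩ := lt_sSup_iff.1 h'
  have hn : d < n := by exact_mod_cast hlt
  refine le_trans (by exact_mod_cast (by omega : d + 2 ≤ n + 1)) (le_sSup ⟨n + 1, rfl,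
    Fin.snoc (α := fun _ => Set W) c Y, Fin.strictMono_iff_lt_succ.2 fun i => ?_, fun i => ?_⟩)
  · refine Fin.lastCases ?_ (fun j => ?_) i
    · rw [Fin.succ_last, Fin.snoc_last, Fin.snoc_castSucc]
      exact lt_of_le_of_lt (hi _).2 (lt_of_le_of_ne hXY hne)
    · rw [Fin.succ_castSucc, Fin.snoc_castSucc, Fin.snoc_castSucc]
      exact hc Fin.castSucc_lt_succ
  · refine Fin.lastCases ?_ (fun j => ?_) i
    · rw [Fin.snoc_last]
      exact ⟨hY, le_rfl⟩
    · rw [Fin.snoc_castSucc]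
      exact ⟨(hi j).1, (hi j).2.trans hXY⟩

end Closure

section Parametrized

open MvPolynomial

variable {m n : ℕ}

lemma isIrrAlg_zcl_param {σ : Type*} (p : Fin n → MvPolynomial σ ℂ)
    (g : (Fin n → ℂ) →ₗ[ℂ] (Fin m → ℂ)) :
    IsIrrAlg (zcl (Set.range fun x => g fun j => eval x (p j))) := by
  refine isIrrAlg_zcl_range _ fun f hf => ?_
  obtain ⟨F, hF⟩ := exists_mvEval_of_polyFun (polyFun_comp_linear g hf)
  exact ⟨aeval p F, fun x => by rw [hF, eval_aeval]⟩

/-- A family with four parameters, one of which can be normalized, has dimension at most three. -/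
lemma adim_zcl_param_lt (p : Fin n → MvPolynomial (Fin 4) ℂ)
    (g : (Fin n → ℂ) →ₗ[ℂ] (Fin m → ℂ))
    (hp : ∀ x : Fin 4 → ℂ, x 0 ≠ 0 → ∃ y : Fin 3 → ℂ, ∀ j,
      eval x (p j) = eval (Fin.cons 1 y : Fin 4 → ℂ) (p j)) :
    ¬ (4 : ℕ) ≤ adim (zcl (Set.range fun x => g fun j => eval x (p j))) := by
  intro h
  obtain ⟨f, hf, hind⟩ := exists_indepOn_of_le_adim (by norm_num) h
  rw [IndepOn.zcl_iff hf] at hind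
  choose F hF using fun i => exists_mvEval_of_polyFun (polyFun_comp_linear g (hf i))
  obtain ⟨H, hH⟩ : ∃ H : Fin 4 → MvPolynomial (Fin 4) ℂ,
      ∀ i x, f i (g fun j => eval x (p j)) = eval x (H i) :=
    ⟨fun i => aeval p (F i), fun i x => by rw [hF, eval_aeval]⟩
  obtain ⟨c, hc⟩ : ∃ c : Fin 4 → MvPolynomial (Fin 3) ℂ,
      ∀ y : Fin 3 → ℂ, (fun i => eval y (c i)) = (Fin.cons 1 y : Fin 4 → ℂ) := by
    refine ⟨Fin.cons 1 X, fun y => funext fun i => ?_⟩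
    refine Fin.cases ?_ (fun j => ?_) i
    · rw [Fin.cons_zero, Fin.cons_zero, map_one]
    · rw [Fin.cons_succ, Fin.cons_succ, eval_X]
  have h3 := not_indepOn_of_poly (A := Fin 3 → ℂ) (fun k y => y k) fun i => aeval c (H i)
  refine h3 fun G hG => hind G ?_
  have hG' : ∀ y : Fin 3 → ℂ, eval (fun i => eval (Fin.cons 1 y : Fin 4 → ℂ) (H i)) G = 0 := by
    intro y
    have e : ∀ i, eval (Fin.cons 1 y : Fin 4 → ℂ) (H i) = eval y (aeval c (H i)) := by
      intro i
      rw [eval_aeval, hc]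
    simp only [e]
    exact hG y trivial
  have hQ : X 0 * aeval H G = 0 := by
    apply MvPolynomial.funext
    intro x
    rw [map_mul, eval_X, map_zero, eval_aeval]
    by_cases hx : x 0 = 0
    · rw [hx, zero_mul]
    · obtain ⟨y, hy⟩ := hp x hx
      have h5 := hG' y
      have h6 : ∀ i, eval x (H i) = eval (Fin.cons 1 y : Fin 4 → ℂ) (H i) := fun i => by
        rw [← hH, ← hH]
        exact congrArg (fun v => f i (g v)) (funext hy)
      simp only [h6, h5, mul_zero]
  have hQ' := (mul_eq_zero.1 hQ).resolve_left (X_ne_zero 0)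
  rintro _ ⟨x, rfl⟩
  simp only [hH]
  rw [← eval_aeval, hQ', map_zero]

end Parametrized

section ParametrizedSurface

open MvPolynomial

variable {A : Type} [CommRing A] [Algebra ℂ A]
  {r : ℕ} {S : Set (Fin (r + 1) → ℂ)} {D : Fin 2 → Derivation ℂ A A} {f : Fin (r + 1) → A}

lemma IsSurfModel.exists_subset_zcl {K : Type} [Field K] [Algebra ℂ K] [Algebra A K]
    [IsScalarTower ℂ A K] [IsDomain A] [IsFractionRing A K] (hm : IsSurfModel S D f)
    {σ : Type} {n : ℕ} (p : Fin n → MvPolynomial σ ℂ) (κ : σ → K)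
    (hE : LinearMap.range (klin K f) ≤ span ℂ (Set.range fun j => aeval κ (p j)))
    (hscale : ∀ (c : ℂ) (x : σ → ℂ), ∃ y : σ → ℂ, ∀ j, eval y (p j) = c * eval x (p j)) :
    ∃ g : (Fin n → ℂ) →ₗ[ℂ] (Fin (r + 1) → ℂ),
      (∀ i, algebraMap A K (f i) = ∑ j, g (Pi.single j 1) i • aeval κ (p j)) ∧
      S ⊆ zcl (Set.range fun x => g fun j => eval x (p j)) := by
  have h1 : ∀ i, ∃ c : Fin n → ℂ, ∑ j, c j • aeval κ (p j) = algebraMap A K (f i) := by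
    intro i
    refine (mem_span_range_iff_exists_fun ℂ).1 (hE ⟨LinearMap.proj i, ?_⟩)
    change algebraMap A K (∑ j, (Pi.single j 1 : Fin (r + 1) → ℂ) i • f j) = _
    simp [Pi.single_apply]
  choose c hc using h1
  let g : (Fin n → ℂ) →ₗ[ℂ] (Fin (r + 1) → ℂ) := Matrix.mulVecLin (Matrix.of c)
  have hg : ∀ v i, g v i = ∑ j, c i j * v j := fun v i => rfl
  refine ⟨g, fun i => ?_, fun x hx => ?_⟩
  · rw [← hc]
    refine Finset.sum_congr rfl fun j _ => ?_
    rw [hg]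
    simp [Pi.single_apply]
  rw [mem_zcl_iff]
  intro F hF h0
  obtain ⟨F, hF'⟩ := exists_mvEval_of_polyFun hF
  have h2 : ∀ y ∈ Set.range fun x => g fun j => eval x (p j), eval y F = 0 := fun y hy => by
    rw [← hF']
    exact h0 y hy
  rw [hF', ← sum_homogeneousComponent F, map_sum]
  refine Finset.sum_eq_zero fun N _ => ?_
  have h3 := homogeneousComponent_vanish (fun a y => by
    rintro ⟨z, rfl⟩
    obtain ⟨w, hw⟩ := hscale a z
    refine ⟨w, ?_⟩
    change g _ = a • g _
    rw [← map_smul]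
    exact congrArg g (funext hw)) h2 N
  refine (hm.hom _ N (homogeneousComponent_isHomogeneous N F)).1 ?_ x hx
  let q : Fin (r + 1) → MvPolynomial σ ℂ := fun i => ∑ j, C (c i j) * p j
  have h4 : aeval q (homogeneousComponent N F) = 0 := by
    apply MvPolynomial.funext
    intro y
    rw [eval_aeval, map_zero, ← h3 _ ⟨y, rfl⟩]
    refine congrArg (fun v => eval v _) (funext fun i => ?_)
    refine Eq.trans ?_ (hg _ i).symm
    simp [q]
  refine IsFractionRing.injective A K ?_
  rw [map_zero]
  have h5 := congrArg (aeval κ) h4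
  rw [map_zero, algHom_aeval] at h5
  have h6 := algHom_aeval (IsScalarTower.toAlgHom ℂ A K) f (homogeneousComponent N F)
  refine h6.trans (Eq.trans ?_ h5)
  refine congrArg (fun v => aeval v _) (funext fun i => ?_)
  change algebraMap A K (f i) = _
  rw [← hc]
  simp [q, Algebra.smul_def]

end ParametrizedSurface

section Scrolls

open MvPolynomial

/-- The parametrization of the scroll `S(2,2)`. -/
def polyS22 : Fin 6 → MvPolynomial (Fin 4) ℂ :=
  ![X 2 * X 0 ^ 2, X 2 * X 0 * X 1, X 2 * X 1 ^ 2, X 3 * X 0 ^ 2, X 3 * X 0 * X 1, X 3 * X 1 ^ 2]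

/-- The parametrization of the scroll `S(1,3)`. -/
def polyS13 : Fin 6 → MvPolynomial (Fin 4) ℂ :=
  ![X 2 * X 0, X 2 * X 1, X 3 * X 0 ^ 3, X 3 * X 0 ^ 2 * X 1, X 3 * X 0 * X 1 ^ 2, X 3 * X 1 ^ 3]

lemma eval_polyS22 (x : Fin 4 → ℂ) : (fun j => eval x (polyS22 j)) =
    ![x 2 * x 0 ^ 2, x 2 * x 0 * x 1, x 2 * x 1 ^ 2, x 3 * x 0 ^ 2, x 3 * x 0 * x 1,
      x 3 * x 1 ^ 2] := by
  funext j
  fin_cases j <;> simp [polyS22]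

lemma eval_polyS13 (x : Fin 4 → ℂ) : (fun j => eval x (polyS13 j)) =
    ![x 2 * x 0, x 2 * x 1, x 3 * x 0 ^ 3, x 3 * x 0 ^ 2 * x 1, x 3 * x 0 * x 1 ^ 2,
      x 3 * x 1 ^ 3] := by
  funext j
  fin_cases j <;> simp [polyS13]

lemma scrollS22_eq : ScrollS22 = zcl (Set.range fun x j => eval x (polyS22 j)) := by
  refine congrArg zcl (Set.Subset.antisymm ?_ ?_)
  · rintro _ ⟨x, rfl⟩
    refine ⟨![x.1.1, x.1.2, x.2.1, x.2.2], ?_⟩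
    change (fun j => eval _ (polyS22 j)) = _
    rw [eval_polyS22]
    rfl
  · rintro _ ⟨x, rfl⟩
    refine ⟨((x 0, x 1), (x 2, x 3)), ?_⟩
    change _ = (fun j => eval _ (polyS22 j))
    rw [eval_polyS22]

lemma scrollS13_eq : ScrollS13 = zcl (Set.range fun x j => eval x (polyS13 j)) := by
  refine congrArg zcl (Set.Subset.antisymm ?_ ?_)
  · rintro _ ⟨x, rfl⟩
    refine ⟨![x.1.1, x.1.2, x.2.1, x.2.2], ?_⟩
    change (fun j => eval _ (polyS13 j)) = _
    rw [eval_polyS13]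
    rfl
  · rintro _ ⟨x, rfl⟩
    refine ⟨((x 0, x 1), (x 2, x 3)), ?_⟩
    change _ = (fun j => eval _ (polyS13 j))
    rw [eval_polyS13]

lemma polyS22_scale (c : ℂ) (x : Fin 4 → ℂ) :
    ∃ y : Fin 4 → ℂ, ∀ j, eval y (polyS22 j) = c * eval x (polyS22 j) := by
  refine ⟨![x 0, x 1, c * x 2, c * x 3], fun j => ?_⟩
  fin_cases j <;> simp [polyS22] <;> ring

lemma polyS13_scale (c : ℂ) (x : Fin 4 → ℂ) :
    ∃ y : Fin 4 → ℂ, ∀ j, eval y (polyS13 j) = c * eval x (polyS13 j) := by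
  refine ⟨![x 0, x 1, c * x 2, c * x 3], fun j => ?_⟩
  fin_cases j <;> simp [polyS13] <;> ring

lemma polyS22_normalize (x : Fin 4 → ℂ) (hx : x 0 ≠ 0) : ∃ y : Fin 3 → ℂ, ∀ j,
    eval x (polyS22 j) = eval (Fin.cons 1 y : Fin 4 → ℂ) (polyS22 j) := by
  have e : (Fin.cons 1 ![x 1 / x 0, x 0 ^ 2 * x 2, x 0 ^ 2 * x 3] : Fin 4 → ℂ) =
      ![1, x 1 / x 0, x 0 ^ 2 * x 2, x 0 ^ 2 * x 3] := rfl
  refine ⟨![x 1 / x 0, x 0 ^ 2 * x 2, x 0 ^ 2 * x 3], fun j => ?_⟩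
  rw [e]
  fin_cases j <;> simp [polyS22] <;> field_simp

lemma polyS13_normalize (x : Fin 4 → ℂ) (hx : x 0 ≠ 0) : ∃ y : Fin 3 → ℂ, ∀ j,
    eval x (polyS13 j) = eval (Fin.cons 1 y : Fin 4 → ℂ) (polyS13 j) := by
  have e : (Fin.cons 1 ![x 1 / x 0, x 0 * x 2, x 0 ^ 3 * x 3] : Fin 4 → ℂ) =
      ![1, x 1 / x 0, x 0 * x 2, x 0 ^ 3 * x 3] := rfl
  refine ⟨![x 1 / x 0, x 0 * x 2, x 0 ^ 3 * x 3], fun j => ?_⟩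
  rw [e]
  fin_cases j <;> simp [polyS13] <;> field_simp

end Scrolls

section Classification

open MvPolynomial

variable {A : Type} [CommRing A] [Algebra ℂ A]
  {r : ℕ} {S : Set (Fin (r + 1) → ℂ)} {D : Fin 2 → Derivation ℂ A A} {f : Fin (r + 1) → A}

lemma IsSurfModel.eq_image_zcl {K : Type} [Field K] [Algebra ℂ K] [Algebra A K]
    [IsScalarTower ℂ A K] [IsDomain A] [IsFractionRing A K] (hm : IsSurfModel S D f)
    (hnd : Nondeg S) (hdim : adim S = 3) {n : ℕ} (hn : n = r + 1)
    (p : Fin n → MvPolynomial (Fin 4) ℂ) (κ : Fin 4 → K)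
    (hE : LinearMap.range (klin K f) ≤ span ℂ (Set.range fun j => aeval κ (p j)))
    (hscale : ∀ (c : ℂ) (x : Fin 4 → ℂ), ∃ y : Fin 4 → ℂ, ∀ j, eval y (p j) = c * eval x (p j))
    (hp : ∀ x : Fin 4 → ℂ, x 0 ≠ 0 → ∃ y : Fin 3 → ℂ, ∀ j,
      eval x (p j) = eval (Fin.cons 1 y : Fin 4 → ℂ) (p j)) :
    ∃ g : (Fin n → ℂ) ≃ₗ[ℂ] (Fin (r + 1) → ℂ),
      S = g '' zcl (Set.range fun x j => eval x (p j)) := by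
  obtain ⟨g, hg, hsub⟩ := hm.exists_subset_zcl p κ hE hscale
  have hsurj : Function.Surjective g := by
    rw [← LinearMap.range_eq_top]
    by_contra hne
    obtain ⟨α, hα0, hα⟩ := Submodule.exists_le_ker_of_lt_top _ (lt_top_iff_ne_top.2 hne)
    refine hα0 (klin_injective K hm hnd ?_)
    have h1 : klin K f α = ∑ i, α (Pi.single i 1) • algebraMap A K (f i) := by
      change algebraMap A K (∑ i, α (Pi.single i 1) • f i) = _
      rw [map_sum]
      exact Finset.sum_congr rfl fun i _ => map_smul (IsScalarTower.toAlgHom ℂ A K) _ _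
    rw [map_zero, h1]
    simp only [hg, Finset.smul_sum]
    rw [Finset.sum_comm]
    refine Finset.sum_eq_zero fun j _ => ?_
    simp only [smul_smul]
    rw [← Finset.sum_smul, ← dual_apply_eq, LinearMap.mem_ker.1 (hα ⟨_, rfl⟩), zero_smul]
  have hinj : Function.Injective g :=
    (LinearMap.injective_iff_surjective_of_finrank_eq_finrank (by
      rw [Module.finrank_fin_fun, Module.finrank_fin_fun, hn])).2 hsurj
  refine ⟨LinearEquiv.ofBijective g ⟨hinj, hsurj⟩, ?_⟩
  rw [image_zcl]
  have e : (LinearEquiv.ofBijective g ⟨hinj, hsurj⟩ : (Fin n → ℂ) → _) ''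
      (Set.range fun (x : Fin 4 → ℂ) j => eval x (p j)) =
      Set.range fun x => g fun j => eval x (p j) := by
    rw [← Set.range_comp]
    rfl
  rw [e]
  by_contra hne
  exact adim_zcl_param_lt p g hp (add_one_le_adim (isIrrAlg_zcl_param p g) hsub hne
    (d := 2) hdim.ge)

theorem IsSurfModel.eq_scroll [IsDomain A] (hm : IsSurfModel S D f) (hS : IsProjVar S)
    (hnd : Nondeg S) (hdim : adim S = 3) (hdeg : adim (GhkCone S 1 2) < 9) (hr : 5 ≤ r)
    (h : ∃ x y, tsp D f x ⊔ tsp D f y = ⊤) :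
    r = 5 ∧ ∃ g : (Fin 6 → ℂ) ≃ₗ[ℂ] (Fin (r + 1) → ℂ),
      S = ⇑g '' ScrollS22 ∨ S = ⇑g '' ScrollS13 := by
  have hr5 : r = 5 := by
    obtain ⟨x, y, hxy⟩ := h
    have h1 := finrank_add_le_finrank_add_finrank (tsp D f x) (tsp D f y)
    rw [hxy, finrank_top, Module.finrank_fin_fun, hm.finrank_tsp, hm.finrank_tsp] at h1
    omega
  refine ⟨hr5, ?_⟩
  obtain ⟨k, hk, hsum, hY⟩ := hm.exists_pencil (FractionRing A) hS hnd hdeg hr5 h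
  have hE : Module.finrank ℂ (LinearMap.range (klin (FractionRing A) f)) = 6 := by
    rw [LinearMap.finrank_range_of_inj (klin_injective _ hm hnd), Subspace.dual_finrank_eq,
      Module.finrank_fin_fun]
    omega
  rcases exists_scroll_basis hk _ _ hE inf_le_left (map_le_iff_le_comap.2 inf_le_right) (by
    rintro _ ⟨α, rfl⟩
    exact hsum α) hY with ⟨s, hs⟩ | ⟨s, t, hst⟩ | ⟨s, t, hst⟩
  · exfalso
    obtain ⟨g, -, hsub⟩ := hm.exists_subset_zcl
      (fun j : Fin 6 => (X 0 * X 1 ^ (j : ℕ) : MvPolynomial (Fin 2) ℂ)) ![s, k] (by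
        refine hs.trans (span_mono ?_)
        rintro _ ⟨j, rfl⟩
        exact ⟨j, by simp⟩) fun c x => ⟨![c * x 0, x 1], fun j => by simp; ring⟩
    obtain ⟨F, hF, hind⟩ := exists_indepOn_of_le_adim (X := S) (d := 3) (by norm_num) hdim.ge
    choose G hG using fun i => exists_mvEval_of_polyFun (polyFun_comp_linear g (hF i))
    refine not_indepOn_of_poly (A := Fin 2 → ℂ) (fun k y => y k)
      (fun i => aeval (fun j : Fin 6 => (X 0 * X 1 ^ (j : ℕ) : MvPolynomial (Fin 2) ℂ)) (G i))
      fun P hP => hind P fun x hx => zcl_vanish (polyFun_eval hF P) ?_ x (hsub hx)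
    rintro _ ⟨y, rfl⟩
    have h1 := hP y trivial
    simp only [eval_aeval] at h1
    simp only [hG]
    exact h1
  · obtain ⟨g, hg⟩ := hm.eq_image_zcl hnd hdim (by omega) polyS22 ![1, k, s, t] (by
      refine hst.trans (span_mono ?_)
      rintro _ ⟨j, rfl⟩
      exact ⟨j, by fin_cases j <;> simp [polyS22]⟩) polyS22_scale polyS22_normalize
    exact ⟨g, Or.inl (by rw [scrollS22_eq]; exact hg)⟩
  · obtain ⟨g, hg⟩ := hm.eq_image_zcl hnd hdim (by omega) polyS13 ![1, k, s, t] (by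
      refine hst.trans (span_mono ?_)
      rintro _ ⟨j, rfl⟩
      exact ⟨j, by fin_cases j <;> simp [polyS13]⟩) polyS13_scale polyS13_normalize
    exact ⟨g, Or.inr (by rw [scrollS13_eq]; exact hg)⟩

theorem isConeVar_or_scroll (hr : 5 ≤ r) (hS : IsProjVar S) (hnd : Nondeg S) (hdim : adim S = 3)
    (hdeg : adim (GhkCone S 1 2) < 9) : IsConeVar S ∨
      (r = 5 ∧ ∃ g : (Fin 6 → ℂ) ≃ₗ[ℂ] (Fin (r + 1) → ℂ),
        S = ⇑g '' ScrollS22 ∨ S = ⇑g '' ScrollS13) := by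
  obtain ⟨A, _, _, _, D, f, hm⟩ := exists_surfModel hS hnd hdim
  by_cases h : ∃ x y, tsp D f x ⊔ tsp D f y = ⊤
  · exact Or.inr (hm.eq_scroll hS hnd hdim hdeg hr h)
  · push Not at h
    exact Or.inl (hm.isConeVar_of_not_spanning hS hnd hdeg h)

end Classification

section Wedge

open MvPolynomial

variable {W : Type*} [AddCommGroup W] [Module ℂ W]

/-- The wedge of two vectors. -/
def wdg (a b : W) : ExteriorAlgebra ℂ W := ExteriorAlgebra.ι ℂ a * ExteriorAlgebra.ι ℂ b

lemma ιMulti_eq_wdg (q : Fin 2 → W) : ExteriorAlgebra.ιMulti ℂ 2 q = wdg (q 0) (q 1) := by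
  rw [ExteriorAlgebra.ιMulti_apply]
  simp [List.ofFn_succ, wdg]

lemma wdg_self (a : W) : wdg a a = 0 := ExteriorAlgebra.ι_sq_zero a

lemma wdg_swap (a b : W) : wdg b a = -wdg a b := by
  have h := wdg_self (a + b)
  have ha := wdg_self a
  have hb := wdg_self b
  simp only [wdg, map_add, add_mul, mul_add] at h ha hb ⊢
  rw [ha, hb, zero_add, add_zero] at h
  exact eq_neg_of_add_eq_zero_left h

lemma wdg_comb (a b c d : ℂ) (u v : W) :
    wdg (a • u + b • v) (c • u + d • v) = (a * d - b * c) • wdg u v := by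
  have hu := wdg_self u
  have hv := wdg_self v
  have hs := wdg_swap u v
  simp only [wdg] at hu hv hs ⊢
  simp only [map_add, map_smul, add_mul, mul_add, smul_mul_assoc, mul_smul_comm, hu, hv, hs]
  module

lemma wdg_smul_left (c : ℂ) (u v : W) : wdg (c • u) v = c • wdg u v := by
  rw [wdg, map_smul, smul_mul_assoc, wdg]

lemma wdg_smul_right (c : ℂ) (u v : W) : wdg u (c • v) = c • wdg u v := by
  rw [wdg, map_smul, mul_smul_comm, wdg]

lemma exists_eval_of_wdg {f : ExteriorAlgebra ℂ W → ℂ} (hf : f ∈ PolyFun (ExteriorAlgebra ℂ W))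
    {σ ι : Type*} [Fintype ι] (P Q : ι → MvPolynomial σ ℂ) (v : ι → W) :
    ∃ H : MvPolynomial σ ℂ, ∀ x : σ → ℂ,
      f (wdg (∑ k, eval x (P k) • v k) (∑ k, eval x (Q k) • v k)) = eval x H := by
  induction hf using Algebra.adjoin_induction with
  | mem f hf =>
    let L : ExteriorAlgebra ℂ W →ₗ[ℂ] ℂ := hf.mk' f
    refine ⟨∑ k, ∑ l, C (f (wdg (v l) (v k))) * (P l * Q k), fun x => ?_⟩
    change L _ = _
    simp only [wdg, map_sum, map_smul, Finset.sum_mul, Finset.mul_sum, smul_mul_assoc,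
      mul_smul_comm, map_mul, eval_C, Finset.smul_sum]
    refine Finset.sum_congr rfl fun k _ => Finset.sum_congr rfl fun l _ => ?_
    change _ = L _ * _
    rw [smul_eq_mul, smul_eq_mul]
    ring
  | algebraMap c => exact ⟨C c, fun x => (eval_C c).symm⟩
  | add f h _ _ h1 h2 =>
    obtain ⟨F, hF⟩ := h1
    obtain ⟨G, hG⟩ := h2
    exact ⟨F + G, fun x => by rw [map_add, ← hF, ← hG]; rfl⟩
  | mul f h _ _ h1 h2 =>
    obtain ⟨F, hF⟩ := h1
    obtain ⟨G, hG⟩ := h2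
    exact ⟨F * G, fun x => by rw [map_mul, ← hF, ← hG]; rfl⟩

lemma map_eq_sum_single {n : ℕ} (M : (Fin n → ℂ) →ₗ[ℂ] W) (w : Fin n → ℂ) :
    M w = ∑ k, w k • M (Pi.single k 1) := by
  conv_lhs => rw [pi_eq_sum_univ' w]
  rw [map_sum]
  refine Finset.sum_congr rfl fun k _ => ?_
  rw [map_smul]

/-- A polynomial function vanishing on the lines of a three-dimensional space meeting the chart
of normalized Plücker coordinates vanishes on all lines. -/
lemma vanish_wdg_of_chart {f : ExteriorAlgebra ℂ W → ℂ} (hf : f ∈ PolyFun (ExteriorAlgebra ℂ W))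
    (M : (Fin 4 → ℂ) →ₗ[ℂ] W)
    (h : ∀ (c : ℂ) (y : Fin 4 → ℂ), f (c • wdg (M ![1, 0, y 0, y 1]) (M ![0, 1, y 2, y 3])) = 0)
    (w₀ w₁ : Fin 4 → ℂ) : f (wdg (M w₀) (M w₁)) = 0 := by
  obtain ⟨H, hH⟩ := exists_eval_of_wdg hf (σ := Fin 2 × Fin 4) (fun k => X (0, k))
    (fun k => X (1, k)) fun k => M (Pi.single k 1)
  have hH' : ∀ x : Fin 2 × Fin 4 → ℂ,
      f (wdg (M fun k => x (0, k)) (M fun k => x (1, k))) = eval x H := by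
    intro x
    rw [← hH, map_eq_sum_single M, map_eq_sum_single M]
    simp only [eval_X]
  let δ : MvPolynomial (Fin 2 × Fin 4) ℂ := X (0, 0) * X (1, 1) - X (0, 1) * X (1, 0)
  have hδ : δ ≠ 0 := by
    intro h0
    have h1 := congrArg (eval fun i : Fin 2 × Fin 4 => if i = (0, 0) ∨ i = (1, 1) then (1 : ℂ) else 0) h0
    simp [δ] at h1
  have h0 : δ * H = 0 := by
    apply MvPolynomial.funext
    intro x
    rw [map_mul, map_zero, ← hH']
    have e : eval x δ = x (0, 0) * x (1, 1) - x (0, 1) * x (1, 0) := by simp [δ]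
    by_cases hx : eval x δ = 0
    · rw [hx, zero_mul]
    have hx' := hx
    rw [e] at hx'
    let Δ := x (0, 0) * x (1, 1) - x (0, 1) * x (1, 0)
    let y : Fin 4 → ℂ := ![(x (1, 1) * x (0, 2) - x (0, 1) * x (1, 2)) / Δ,
      (x (1, 1) * x (0, 3) - x (0, 1) * x (1, 3)) / Δ,
      (x (0, 0) * x (1, 2) - x (1, 0) * x (0, 2)) / Δ,
      (x (0, 0) * x (1, 3) - x (1, 0) * x (0, 3)) / Δ]
    have hΔ : Δ ≠ 0 := hx'
    have e0 : (fun k => x (0, k)) = x (0, 0) • (![1, 0, y 0, y 1] : Fin 4 → ℂ) +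
        x (0, 1) • ![0, 1, y 2, y 3] := by
      funext k
      fin_cases k <;> simp [y] <;> field_simp <;> simp only [Δ] <;> ring
    have e1 : (fun k => x (1, k)) = x (1, 0) • (![1, 0, y 0, y 1] : Fin 4 → ℂ) +
        x (1, 1) • ![0, 1, y 2, y 3] := by
      funext k
      fin_cases k <;> simp [y] <;> field_simp <;> simp only [Δ] <;> ring
    rw [e0, e1, map_add, map_add, map_smul, map_smul, map_smul, map_smul, wdg_comb, h, mul_zero]
  have hH0 := (mul_eq_zero.1 h0).resolve_left hδ
  have h1 := hH' fun i => if i.1 = 0 then w₀ i.2 else w₁ i.2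
  rw [hH0, map_zero] at h1
  simpa using h1

/-- The lines in a four-parameter family of three-dimensional spaces depend on eight parameters. -/
lemma not_indepOn_wdg (M : (Fin 4 → ℂ) →ₗ[ℂ] (Fin 4 → ℂ) →ₗ[ℂ] W)
    (f : Fin 9 → ExteriorAlgebra ℂ W → ℂ) (hf : ∀ i, f i ∈ PolyFun (ExteriorAlgebra ℂ W)) :
    ¬ IndepOn f {z | ∃ μ w₀ w₁, z = wdg (M μ w₀) (M μ w₁)} := by
  let P : Fin 4 → MvPolynomial (Fin 8) ℂ := ![1, 0, X 4, X 5]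
  let Q : Fin 4 → MvPolynomial (Fin 8) ℂ := ![0, 1, X 6, X 7]
  choose H hH using fun i => exists_eval_of_wdg (hf i) (σ := Fin 8) (ι := Fin 4 × Fin 4)
    (fun k => X (Fin.castAdd 4 k.1) * P k.2) (fun k => X (Fin.castAdd 4 k.1) * Q k.2)
    fun k => M (Pi.single k.1 1) (Pi.single k.2 1)
  intro hind
  refine not_indepOn_of_poly (A := Fin 8 → ℂ) (fun k x => x k) H fun F hF => hind F ?_
  have hM : ∀ μ w, M μ w = ∑ k : Fin 4 × Fin 4,
      (μ k.1 * w k.2) • M (Pi.single k.1 1) (Pi.single k.2 1) := by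
    intro μ w
    rw [map_eq_sum_single (M μ), Fintype.sum_prod_type_right]
    refine Finset.sum_congr rfl fun l _ => ?_
    have h1 := map_eq_sum_single (M.flip (Pi.single l 1)) μ
    simp only [LinearMap.flip_apply] at h1
    rw [h1, Finset.smul_sum]
    exact Finset.sum_congr rfl fun k _ => by rw [smul_smul, mul_comm]
  rintro _ ⟨μ, w₀, w₁, rfl⟩
  refine vanish_wdg_of_chart (f := fun z => eval (fun i => f i z) F) (polyFun_eval hf F) (M μ)
    (fun c y => ?_) w₀ w₁
  obtain ⟨d, hd⟩ := IsAlgClosed.exists_pow_nat_eq c (n := 2) (by norm_num)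
  let x : Fin 8 → ℂ := Fin.append (d • μ) y
  have h1 := hF x trivial
  have hx : ∀ k : Fin 4, x (Fin.castAdd 4 k) = d * μ k := fun k => by
    simp [x, Fin.append_left]
  have hP : (fun l => eval x (P l)) = ![1, 0, y 0, y 1] := by
    funext l
    fin_cases l
    · exact map_one _
    · exact map_zero _
    · exact eval_X _
    · exact eval_X _
  have hQ : (fun l => eval x (Q l)) = ![0, 1, y 2, y 3] := by
    funext l
    fin_cases l
    · exact map_zero _
    · exact map_one _
    · exact eval_X _
    · exact eval_X _
  have h2 : ∀ i, f i (c • wdg (M μ ![1, 0, y 0, y 1]) (M μ ![0, 1, y 2, y 3])) = eval x (H i) := by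
    intro i
    rw [← hH]
    refine congrArg (f i) ?_
    have h3 : ∀ R : Fin 4 → MvPolynomial (Fin 8) ℂ,
        ∑ k : Fin 4 × Fin 4, eval x (X (Fin.castAdd 4 k.1) * R k.2) •
          M (Pi.single k.1 1) (Pi.single k.2 1) = d • M μ (fun l => eval x (R l)) := by
      intro R
      rw [hM, Finset.smul_sum]
      refine Finset.sum_congr rfl fun k _ => ?_
      rw [map_mul, eval_X, hx, smul_smul, mul_assoc]
    rw [h3, h3, hP, hQ, wdg_smul_left, wdg_smul_right, smul_smul, ← sq, hd]
  simp only [h2]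
  exact h1

end Wedge

section WedgeDensity

open MvPolynomial

variable {W : Type*} [AddCommGroup W] [Module ℂ W]

lemma wdg_add_smul (a b v : W) (s t : ℂ) :
    wdg (a + s • v) (b + t • v) = wdg a b + (t • wdg a v + s • wdg v b) := by
  have hv := wdg_self v
  simp only [wdg] at hv ⊢
  simp only [map_add, map_smul, add_mul, mul_add, smul_mul_assoc, mul_smul_comm, hv]
  module

lemma polyFun_wdg_line {f : ExteriorAlgebra ℂ W → ℂ} (hf : f ∈ PolyFun (ExteriorAlgebra ℂ W))
    (a b : W) (s t : ℂ) : (fun v => f (wdg (a + s • v) (b + t • v))) ∈ PolyFun W := by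
  induction hf using Algebra.adjoin_induction with
  | mem f hf =>
    let L : ExteriorAlgebra ℂ W →ₗ[ℂ] ℂ := hf.mk' f
    have hl : (fun v : W => L (t • wdg a v + s • wdg v b)) ∈ PolyFun W := by
      refine polyFun_of_linear ⟨fun x y => ?_, fun c x => ?_⟩
      · rw [← map_add]
        congr 1
        simp only [wdg, map_add, add_mul, mul_add]
        module
      · rw [← map_smul]
        congr 1
        simp only [wdg, map_smul, smul_mul_assoc, mul_smul_comm]
        module
    have h := (PolyFun W).add_mem ((PolyFun W).algebraMap_mem (L (wdg a b))) hl
    convert h using 1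
    funext v
    change L _ = _
    rw [wdg_add_smul, map_add]
    rfl
  | algebraMap c => exact (PolyFun W).algebraMap_mem c
  | add f h _ _ h1 h2 => exact (PolyFun W).add_mem h1 h2
  | mul f h _ _ h1 h2 => exact (PolyFun W).mul_mem h1 h2

lemma wdg_vanish_of_dense {f : ExteriorAlgebra ℂ W → ℂ} (hf : f ∈ PolyFun (ExteriorAlgebra ℂ W))
    (c d : Fin 3 → ℂ) {A : Set W}
    (h : ∀ p : Fin 3 → W, (∀ i, p i ∈ A) → f (wdg (∑ i, c i • p i) (∑ i, d i • p i)) = 0)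
    (p : Fin 3 → W) (hp : ∀ i, p i ∈ zcl A) :
    f (wdg (∑ i, c i • p i) (∑ i, d i • p i)) = 0 := by
  have key : ∀ (k : Fin 3) (p : Fin 3 → W), p k ∈ zcl A →
      (∀ v ∈ A, f (wdg (∑ i, c i • Function.update p k v i)
        (∑ i, d i • Function.update p k v i)) = 0) →
      f (wdg (∑ i, c i • p i) (∑ i, d i • p i)) = 0 := by
    intro k p hk hv
    have e : ∀ (c : Fin 3 → ℂ) (v : W), ∑ i, c i • Function.update p k v i =
        ∑ i ∈ Finset.univ.erase k, c i • p i + c k • v := by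
      intro c v
      rw [← Finset.sum_erase_add _ _ (Finset.mem_univ k), Function.update_self]
      congr 1
      refine Finset.sum_congr rfl fun i hi => ?_
      rw [Function.update_of_ne (Finset.ne_of_mem_erase hi)]
    have h1 := zcl_vanish (polyFun_wdg_line hf (∑ i ∈ Finset.univ.erase k, c i • p i)
      (∑ i ∈ Finset.univ.erase k, d i • p i) (c k) (d k)) (A := A)
      (fun v hvA => by rw [← e, ← e]; exact hv v hvA) (p k) hk
    rwa [← e, ← e, Function.update_eq_self] at h1
  refine key 0 p (hp 0) fun v0 h0 => key 1 _ (by simpa using hp 1) fun v1 h1 =>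
    key 2 _ (by simpa using hp 2) fun v2 h2 => h _ fun i => ?_
  fin_cases i <;> simpa

lemma exists_coeff_of_mem_span {p : Fin 3 → W} {q : W} (hq : q ∈ span ℂ (Set.range p)) :
    ∃ c : Fin 3 → ℂ, ∑ i, c i • p i = q :=
  (Submodule.mem_span_range_iff_exists_fun ℂ).1 hq

/-- To bound the dimension of the variety of lines in trisecant planes it suffices to look at
trisecant planes spanned by a dense set of points. -/
lemma adim_GhkCone_lt {X A : Set W} (hXA : X ⊆ zcl A)
    (B : Set (ExteriorAlgebra ℂ W))
    (hB : ∀ f : Fin 9 → ExteriorAlgebra ℂ W → ℂ, (∀ i, f i ∈ PolyFun (ExteriorAlgebra ℂ W)) →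
      ¬ IndepOn f B)
    (h : ∀ f ∈ PolyFun (ExteriorAlgebra ℂ W), (∀ z ∈ B, f z = 0) → ∀ p : Fin 3 → W,
      (∀ i, p i ∈ A) → ∀ c d : Fin 3 → ℂ, f (wdg (∑ i, c i • p i) (∑ i, d i • p i)) = 0) :
    adim (GhkCone X 1 2) < 9 := by
  by_contra hlt
  obtain ⟨f, hf, hind⟩ := exists_indepOn_of_le_adim (d := 9) (by norm_num)
    (X := GhkCone X 1 2) (not_lt.1 hlt)
  rw [GhkCone, IndepOn.zcl_iff hf] at hind
  refine hB f hf fun F hF => hind F ?_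
  rintro _ ⟨p, q, hp, hq, rfl⟩
  rw [ιMulti_eq_wdg]
  obtain ⟨c, hc⟩ := exists_coeff_of_mem_span (hq 0)
  obtain ⟨d, hd⟩ := exists_coeff_of_mem_span (hq 1)
  rw [← hc, ← hd]
  exact wdg_vanish_of_dense (polyFun_eval hf F) c d
    (fun p hp => h _ (polyFun_eval hf F) hF p hp c d) p fun i => hXA (hp i)

/-- A parametrized threefold cone whose general trisecant planes lie in a four-parameter linear
family of solids has a small variety of lines in trisecant planes. -/
lemma adim_GhkCone_param_lt (φ : Fin 6 → MvPolynomial (Fin 4) ℂ) (g : (Fin 6 → ℂ) ≃ₗ[ℂ] W)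
    (M : (Fin 4 → ℂ) →ₗ[ℂ] (Fin 4 → ℂ) →ₗ[ℂ] (Fin 6 → ℂ))
    {D : MvPolynomial (Fin 3 × Fin 4) ℂ} (hD : D ≠ 0)
    (h : ∀ x : Fin 3 × Fin 4 → ℂ, eval x D ≠ 0 →
      ∃ μ, ∀ i, ∃ w, M μ w = fun j => eval (fun k => x (i, k)) (φ j)) :
    adim (GhkCone (g '' zcl (Set.range fun (x : Fin 4 → ℂ) j => eval x (φ j))) 1 2) < 9 := by
  rw [image_zcl]
  refine adim_GhkCone_lt subset_rfl _ (fun f hf => not_indepOn_wdg (M.compr₂ g.toLinearMap) f hf)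
    fun f hf hfB p hp c d => ?_
  choose y' hy' hy using hp
  choose y hy' using hy'
  obtain rfl : p = fun i => g fun j => eval (y i) (φ j) :=
    funext fun i => by rw [← hy, ← hy']
  obtain ⟨H, hH⟩ := exists_eval_of_wdg hf (σ := Fin 3 × Fin 4) (ι := Fin 3 × Fin 6)
    (fun k => C (c k.1) * rename (fun l => (k.1, l)) (φ k.2))
    (fun k => C (d k.1) * rename (fun l => (k.1, l)) (φ k.2))
    (fun k => g (Pi.single k.2 1))
  have e : ∀ (c : Fin 3 → ℂ) (x : Fin 3 × Fin 4 → ℂ),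
      ∑ k : Fin 3 × Fin 6, eval x (C (c k.1) * rename (fun l => (k.1, l)) (φ k.2)) •
        g (Pi.single k.2 1) = ∑ i, c i • g fun j => eval (fun k => x (i, k)) (φ j) := by
    intro c x
    rw [Fintype.sum_prod_type]
    refine Finset.sum_congr rfl fun i _ => ?_
    have h1 := map_eq_sum_single g.toLinearMap fun j => eval (fun k => x (i, k)) (φ j)
    simp only [LinearEquiv.coe_coe] at h1
    rw [h1, Finset.smul_sum]
    refine Finset.sum_congr rfl fun j _ => ?_
    rw [map_mul, eval_C, eval_rename, smul_smul]
    rfl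
  have h0 : D * H = 0 := by
    apply MvPolynomial.funext
    intro x
    rw [map_mul, map_zero, ← hH, e, e]
    by_cases hx : eval x D = 0
    · rw [hx, zero_mul]
    obtain ⟨μ, hμ⟩ := h x hx
    choose w hw using hμ
    rw [hfB, mul_zero]
    refine ⟨μ, ∑ i, c i • w i, ∑ i, d i • w i, ?_⟩
    simp [LinearMap.compr₂_apply, map_sum, map_smul, hw]
  have hH0 := (mul_eq_zero.1 h0).resolve_left hD
  have h1 := hH fun k => y k.1 k.2
  rw [hH0, map_zero, e, e] at h1
  exact h1

end WedgeDensity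

section ScrollDegenerate

open MvPolynomial

variable {W : Type*} [AddCommGroup W] [Module ℂ W]

lemma exists_ne_zero_sum_eq_zero (A : Fin 3 → Fin 4 → ℂ) :
    ∃ μ : Fin 4 → ℂ, μ ≠ 0 ∧ ∀ i, ∑ k, A i k * μ k = 0 := by
  have h := LinearMap.ker_ne_bot_of_finrank_lt (f := Matrix.mulVecLin (Matrix.of A)) (by simp)
  obtain ⟨μ, hμ, hne⟩ := Submodule.exists_mem_ne_zero_of_ne_bot h
  exact ⟨μ, hne, fun i => congrFun (LinearMap.mem_ker.1 hμ) i⟩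

lemma pencil_eq_zero {a b s t a₁ b₁ s₁ t₁ a₂ b₂ s₂ t₂ : ℂ} {μ : Fin 4 → ℂ} (hs : s ≠ 0)
    (h₁ : a * b₁ - a₁ * b ≠ 0) (h₂ : a * b₂ - a₂ * b ≠ 0) (h₁₂ : t₁ * s₂ - t₂ * s₁ ≠ 0)
    (e : t * (μ 0 * a + μ 1 * b) = s * (μ 2 * a + μ 3 * b))
    (e₁ : t₁ * (μ 0 * a₁ + μ 1 * b₁) = s₁ * (μ 2 * a₁ + μ 3 * b₁))
    (e₂ : t₂ * (μ 0 * a₂ + μ 1 * b₂) = s₂ * (μ 2 * a₂ + μ 3 * b₂))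
    (h0 : μ 0 * a + μ 1 * b = 0) : μ = 0 := by
  have h0' : μ 2 * a + μ 3 * b = 0 := by
    rw [h0, mul_zero] at e
    exact (mul_eq_zero.1 e.symm).resolve_left hs
  have e₁' : t₁ * (μ 0 * a₂ + μ 1 * b₂) = s₁ * (μ 2 * a₂ + μ 3 * b₂) := by
    apply mul_left_cancel₀ h₁
    linear_combination (a * b₂ - a₂ * b) * e₁ - t₁ * (a₁ * b₂ - a₂ * b₁) * h0 +
      s₁ * (a₁ * b₂ - a₂ * b₁) * h0'
  have hu : μ 0 * a₂ + μ 1 * b₂ = 0 := by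
    apply (mul_eq_zero.1 _).resolve_left h₁₂
    linear_combination s₂ * e₁' - s₁ * e₂
  have hv : μ 2 * a₂ + μ 3 * b₂ = 0 := by
    apply (mul_eq_zero.1 _).resolve_left h₁₂
    linear_combination t₂ * e₁' - t₁ * e₂
  funext k
  apply (mul_eq_zero.1 _).resolve_left h₂
  fin_cases k
  · change (a * b₂ - a₂ * b) * μ 0 = 0
    linear_combination b₂ * h0 - b * hu
  · change (a * b₂ - a₂ * b) * μ 1 = 0
    linear_combination a * hu - a₂ * h0
  · change (a * b₂ - a₂ * b) * μ 2 = 0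
    linear_combination b₂ * h0' - b * hv
  · change (a * b₂ - a₂ * b) * μ 3 = 0
    linear_combination a * hv - a₂ * h0'

lemma adim_GhkCone_scrollS22_lt (g : (Fin 6 → ℂ) ≃ₗ[ℂ] W) :
    adim (GhkCone (g '' ScrollS22) 1 2) < 9 := by
  let M : (Fin 4 → ℂ) →ₗ[ℂ] (Fin 4 → ℂ) →ₗ[ℂ] (Fin 6 → ℂ) := LinearMap.mk₂ ℂ
    (fun μ y => ![μ 0 * y 0 + μ 1 * y 1, μ 0 * y 1 + μ 1 * y 2, μ 0 * y 2 + μ 1 * y 3,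
      μ 2 * y 0 + μ 3 * y 1, μ 2 * y 1 + μ 3 * y 2, μ 2 * y 2 + μ 3 * y 3])
    (fun _ _ _ => by ext j; fin_cases j <;> simp <;> ring)
    (fun _ _ _ => by ext j; fin_cases j <;> simp <;> ring)
    (fun _ _ _ => by ext j; fin_cases j <;> simp <;> ring)
    (fun _ _ _ => by ext j; fin_cases j <;> simp <;> ring)
  have hM : ∀ μ y, M μ y = ![μ 0 * y 0 + μ 1 * y 1, μ 0 * y 1 + μ 1 * y 2, μ 0 * y 2 + μ 1 * y 3,
      μ 2 * y 0 + μ 3 * y 1, μ 2 * y 1 + μ 3 * y 2, μ 2 * y 2 + μ 3 * y 3] := fun _ _ => rfl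
  let d : Fin 3 → Fin 3 → MvPolynomial (Fin 3 × Fin 4) ℂ := fun i j =>
    (X (i, 0) * X (j, 1) - X (j, 0) * X (i, 1)) * (X (i, 3) * X (j, 2) - X (j, 3) * X (i, 2))
  have hd : ∀ x i j, eval x (d i j) = (x (i, 0) * x (j, 1) - x (j, 0) * x (i, 1)) *
      (x (i, 3) * x (j, 2) - x (j, 3) * x (i, 2)) := fun x i j => by simp [d]
  let D := d 0 1 * d 1 2 * d 2 0 * (X (0, 2) * X (1, 2) * X (2, 2))
  have hD : D ≠ 0 := by
    intro h0
    have h1 := congrArg (eval fun k : Fin 3 × Fin 4 => ![1, (k.1 : ℂ), 1, (k.1 : ℂ)] k.2) h0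
    simp only [D, map_mul, hd, eval_X, map_zero] at h1
    simp at h1
    norm_num at h1
  rw [scrollS22_eq]
  refine adim_GhkCone_param_lt polyS22 g M hD fun x hx => ?_
  simp only [D, map_mul, hd, eval_X, mul_ne_zero_iff] at hx
  obtain ⟨⟨⟨⟨a01, t01⟩, a12, t12⟩, a20, t20⟩, ⟨s0, s1⟩, s2⟩ := hx
  obtain ⟨μ, hμ, hrel⟩ := exists_ne_zero_sum_eq_zero fun i =>
    ![x (i, 3) * x (i, 0), x (i, 3) * x (i, 1), -(x (i, 2) * x (i, 0)), -(x (i, 2) * x (i, 1))]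
  have e : ∀ i, x (i, 3) * (μ 0 * x (i, 0) + μ 1 * x (i, 1)) =
      x (i, 2) * (μ 2 * x (i, 0) + μ 3 * x (i, 1)) := by
    intro i
    have h := hrel i
    simp [Fin.sum_univ_four] at h
    linear_combination h
  have hne : ∀ i, μ 0 * x (i, 0) + μ 1 * x (i, 1) ≠ 0 := by
    intro i h0
    refine hμ ?_
    fin_cases i
    · exact pencil_eq_zero s0 a01 (by rwa [← neg_ne_zero, neg_sub]) t12 (e 0) (e 1) (e 2) h0
    · exact pencil_eq_zero s1 a12 (by rwa [← neg_ne_zero, neg_sub]) t20 (e 1) (e 2) (e 0) h0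
    · exact pencil_eq_zero s2 a20 (by rwa [← neg_ne_zero, neg_sub]) t01 (e 2) (e 0) (e 1) h0
  refine ⟨μ, fun i => ⟨(x (i, 2) / (μ 0 * x (i, 0) + μ 1 * x (i, 1))) •
    ![x (i, 0) ^ 3, x (i, 0) ^ 2 * x (i, 1), x (i, 0) * x (i, 1) ^ 2, x (i, 1) ^ 3], ?_⟩⟩
  have hi := hne i
  have ei := e i
  rw [eval_polyS22, map_smul, hM]
  have ht : x (i, 3) = x (i, 2) / (μ 0 * x (i, 0) + μ 1 * x (i, 1)) *
      (μ 2 * x (i, 0) + μ 3 * x (i, 1)) := by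
    field_simp
    linear_combination ei
  have hs : x (i, 2) = x (i, 2) / (μ 0 * x (i, 0) + μ 1 * x (i, 1)) *
      (μ 0 * x (i, 0) + μ 1 * x (i, 1)) := by
    field_simp
  generalize x (i, 2) / (μ 0 * x (i, 0) + μ 1 * x (i, 1)) = l at ht hs ⊢
  rw [ht, hs]
  funext j
  fin_cases j <;> simp <;> ring

lemma adim_GhkCone_scrollS13_lt (g : (Fin 6 → ℂ) ≃ₗ[ℂ] W) :
    adim (GhkCone (g '' ScrollS13) 1 2) < 9 := by
  let M : (Fin 4 → ℂ) →ₗ[ℂ] (Fin 4 → ℂ) →ₗ[ℂ] (Fin 6 → ℂ) := LinearMap.mk₂ ℂ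
    (fun μ y => ![μ 0 * y 0 + μ 1 * y 1 + μ 2 * y 2, μ 0 * y 1 + μ 1 * y 2 + μ 2 * y 3,
      μ 3 * y 0, μ 3 * y 1, μ 3 * y 2, μ 3 * y 3])
    (fun _ _ _ => by ext j; fin_cases j <;> simp <;> ring)
    (fun _ _ _ => by ext j; fin_cases j <;> simp <;> ring)
    (fun _ _ _ => by ext j; fin_cases j <;> simp <;> ring)
    (fun _ _ _ => by ext j; fin_cases j <;> simp <;> ring)
  have hM : ∀ μ y, M μ y = ![μ 0 * y 0 + μ 1 * y 1 + μ 2 * y 2,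
      μ 0 * y 1 + μ 1 * y 2 + μ 2 * y 3, μ 3 * y 0, μ 3 * y 1, μ 3 * y 2, μ 3 * y 3] :=
    fun _ _ => rfl
  let d : Fin 3 → Fin 3 → MvPolynomial (Fin 3 × Fin 4) ℂ := fun i j =>
    X (i, 0) * X (j, 1) - X (j, 0) * X (i, 1)
  have hd : ∀ x i j, eval x (d i j) = x (i, 0) * x (j, 1) - x (j, 0) * x (i, 1) :=
    fun x i j => by simp [d]
  let D := d 0 1 * d 1 2 * d 2 0 * (X (0, 3) * X (1, 3) * X (2, 3))
  have hD : D ≠ 0 := by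
    intro h0
    have h1 := congrArg (eval fun k : Fin 3 × Fin 4 => ![1, (k.1 : ℂ), 1, 1] k.2) h0
    simp only [D, map_mul, hd, eval_X, map_zero] at h1
    norm_num at h1
    simp at h1
  rw [scrollS13_eq]
  refine adim_GhkCone_param_lt polyS13 g M hD fun x hx => ?_
  simp only [D, map_mul, hd, eval_X, mul_ne_zero_iff] at hx
  obtain ⟨⟨⟨a01, a12⟩, a20⟩, ⟨t0, t1⟩, t2⟩ := hx
  obtain ⟨μ, hμ, hrel⟩ := exists_ne_zero_sum_eq_zero fun i =>
    ![x (i, 3) * x (i, 0) ^ 2, x (i, 3) * (x (i, 0) * x (i, 1)), x (i, 3) * x (i, 1) ^ 2,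
      -x (i, 2)]
  have ht : ∀ i, x (i, 3) ≠ 0 := by
    intro i
    fin_cases i
    exacts [t0, t1, t2]
  have e : ∀ i, x (i, 3) * (μ 0 * x (i, 0) ^ 2 + μ 1 * (x (i, 0) * x (i, 1)) +
      μ 2 * x (i, 1) ^ 2) = μ 3 * x (i, 2) := by
    intro i
    have h := hrel i
    simp [Fin.sum_univ_four] at h
    linear_combination h
  have hμ3 : μ 3 ≠ 0 := by
    intro h3
    have e' : ∀ i, μ 0 * x (i, 0) ^ 2 + μ 1 * (x (i, 0) * x (i, 1)) + μ 2 * x (i, 1) ^ 2 = 0 := by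
      intro i
      have h := e i
      rw [h3, zero_mul] at h
      exact (mul_eq_zero.1 h).resolve_left (ht i)
    have e0 := e' 0
    have e1 := e' 1
    have e2 := e' 2
    have hΔ := mul_ne_zero (mul_ne_zero a01 a12) a20
    generalize x (0, 0) = a0 at *
    generalize x (1, 0) = a1 at *
    generalize x (2, 0) = a2 at *
    generalize x (0, 1) = b0 at *
    generalize x (1, 1) = b1 at *
    generalize x (2, 1) = b2 at *
    refine hμ (funext fun k => ?_)
    apply (mul_eq_zero.1 _).resolve_left hΔ
    fin_cases k
    · change _ * μ 0 = 0
      linear_combination -b1 * b2 * (a1 * b2 - a2 * b1) * e0 - b0 * b2 * (a2 * b0 - a0 * b2) * e1 -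
        b0 * b1 * (a0 * b1 - a1 * b0) * e2
    · change _ * μ 1 = 0
      linear_combination (a1 * b2 + a2 * b1) * (a1 * b2 - a2 * b1) * e0 +
        (a0 * b2 + a2 * b0) * (a2 * b0 - a0 * b2) * e1 +
        (a0 * b1 + a1 * b0) * (a0 * b1 - a1 * b0) * e2
    · change _ * μ 2 = 0
      linear_combination -a1 * a2 * (a1 * b2 - a2 * b1) * e0 - a0 * a2 * (a2 * b0 - a0 * b2) * e1 -
        a0 * a1 * (a0 * b1 - a1 * b0) * e2
    · exact (mul_eq_zero_of_right _ h3)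
  refine ⟨μ, fun i => ⟨(x (i, 3) / μ 3) •
    ![x (i, 0) ^ 3, x (i, 0) ^ 2 * x (i, 1), x (i, 0) * x (i, 1) ^ 2, x (i, 1) ^ 3], ?_⟩⟩
  have ei := e i
  rw [eval_polyS13, map_smul, hM]
  have hs : x (i, 2) = x (i, 3) / μ 3 * (μ 0 * x (i, 0) ^ 2 + μ 1 * (x (i, 0) * x (i, 1)) +
      μ 2 * x (i, 1) ^ 2) := by
    field_simp
    linear_combination -ei
  have ht' : x (i, 3) = x (i, 3) / μ 3 * μ 3 := by field_simp
  generalize x (i, 3) / μ 3 = l at ht' hs ⊢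
  rw [ht', hs]
  funext j
  fin_cases j <;> simp <;> ring

end ScrollDegenerate

section Cones

open MvPolynomial

variable {r : ℕ} {S : Set (Fin (r + 1) → ℂ)}

/-- A hyperplane section, not through the vertex `v`, of a chart of a cone. -/
structure IsConeBase (S : Set (Fin (r + 1) → ℂ)) (v : Fin (r + 1) → ℂ)
    (h l : Module.Dual ℂ (Fin (r + 1) → ℂ)) (T : Set (Fin (r + 1) → ℂ)) : Prop where
  apply_vertex : h v = 1
  chart_vertex : l v = 0
  exists_ne : ∃ x ∈ S, l x ≠ 0
  vertex : ∀ x ∈ S, ∀ a b : ℂ, a • v + b • x ∈ S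
  mem_iff : ∀ x, x ∈ T ↔ x ∈ S ∧ h x = 0 ∧ l x = 1

variable {v : Fin (r + 1) → ℂ} {h l : Module.Dual ℂ (Fin (r + 1) → ℂ)}
  {T : Set (Fin (r + 1) → ℂ)}

lemma IsConeVar.exists_isConeBase (hr : 0 < r) (hnd : Nondeg S) (hc : IsConeVar S) :
    ∃ v h l T, IsConeBase S v h l T := by
  obtain ⟨v, -, hv0, hv⟩ := hc
  obtain ⟨i, hi⟩ := Function.ne_iff.1 hv0
  obtain ⟨j, hj⟩ : ∃ j : Fin (r + 1), j ≠ i :=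
    haveI : Nontrivial (Fin (r + 1)) := Fin.nontrivial_iff_two_le.2 (by omega)
    exists_ne i
  let h : Module.Dual ℂ (Fin (r + 1) → ℂ) := (v i)⁻¹ • LinearMap.proj i
  have hhv : h v = 1 := inv_mul_cancel₀ hi
  let l : Module.Dual ℂ (Fin (r + 1) → ℂ) := LinearMap.proj j - v j • h
  refine ⟨v, h, l, _, hhv, ?_, ?_, hv, fun x => Iff.rfl⟩
  · change v j - v j * h v = 0
    rw [hhv, mul_one, sub_self]
  · by_contra! hS
    have h1 : span ℂ S ≤ LinearMap.ker l := span_le.2 hS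
    have h2 : (Pi.single j 1 : Fin (r + 1) → ℂ) ∈ LinearMap.ker l := by
      rw [hnd] at h1
      exact h1 mem_top
    simp [l, h, Pi.single_eq_of_ne hj.symm] at h2

lemma polyFun_inverse_power (l : Module.Dual ℂ (Fin (r + 1) → ℂ))
    (u : Fin (r + 1) → Module.Dual ℂ (Fin (r + 1) → ℂ)) (F : MvPolynomial (Fin (r + 1)) ℂ) :
    ∃ (N : ℕ) (G : (Fin (r + 1) → ℂ) → ℂ), G ∈ PolyFun (Fin (r + 1) → ℂ) ∧
      ∀ x, l x ≠ 0 → G x = l x ^ N * eval (fun k => (l x)⁻¹ * u k x) F := by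
  induction F using MvPolynomial.induction_on with
  | C c => exact ⟨0, fun _ => c, (PolyFun _).algebraMap_mem c, fun x _ => by simp⟩
  | add F₁ F₂ h₁ h₂ =>
    obtain ⟨N₁, G₁, m₁, e₁⟩ := h₁
    obtain ⟨N₂, G₂, m₂, e₂⟩ := h₂
    have ml := polyFun_of_dual l
    refine ⟨N₁ + N₂, _, (PolyFun _).add_mem ((PolyFun _).mul_mem ((PolyFun _).pow_mem ml N₂) m₁)
      ((PolyFun _).mul_mem ((PolyFun _).pow_mem ml N₁) m₂), fun x hx => ?_⟩
    simp only [Pi.add_apply, Pi.mul_apply, Pi.pow_apply]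
    rw [e₁ x hx, e₂ x hx, map_add]
    ring
  | mul_X F k h₁ =>
    obtain ⟨N, G, m, e⟩ := h₁
    refine ⟨N + 1, _, (PolyFun _).mul_mem m (polyFun_of_dual (u k)), fun x hx => ?_⟩
    simp only [Pi.mul_apply]
    rw [e x hx, map_mul, eval_X]
    field_simp
    ring

namespace IsConeBase

lemma proj_mem (hT : IsConeBase S v h l T) {x : Fin (r + 1) → ℂ} (hx : x ∈ S) (hlx : l x ≠ 0) :
    (l x)⁻¹ • (x - h x • v) ∈ T := by
  rw [hT.mem_iff]
  refine ⟨?_, ?_, ?_⟩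
  · convert hT.vertex x hx (-((l x)⁻¹ * h x)) (l x)⁻¹ using 1
    module
  · simp [hT.apply_vertex]
  · simp [hT.chart_vertex, hlx]

lemma vanish_or (hT : IsConeBase S v h l T) (hS : IsIrrAlg S) {F G : MvPolynomial (Fin (r + 1)) ℂ}
    (hFG : ∀ x ∈ T, eval x F * eval x G = 0) :
    (∀ x ∈ T, eval x F = 0) ∨ ∀ x ∈ T, eval x G = 0 := by
  let u : Fin (r + 1) → Module.Dual ℂ (Fin (r + 1) → ℂ) := fun k => LinearMap.proj k - v k • h
  have hu : ∀ x, (fun k => (l x)⁻¹ * u k x) = (l x)⁻¹ • (x - h x • v) := by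
    intro x
    funext k
    simp [u, mul_comm]
  obtain ⟨N, F', mF, eF⟩ := polyFun_inverse_power l u F
  obtain ⟨N', G', mG, eG⟩ := polyFun_inverse_power l u G
  simp only [hu] at eF eG
  have back : ∀ {F : MvPolynomial (Fin (r + 1)) ℂ} {N : ℕ} {F' : (Fin (r + 1) → ℂ) → ℂ},
      (∀ x, l x ≠ 0 → F' x = l x ^ N * eval ((l x)⁻¹ • (x - h x • v)) F) →
      (∀ x ∈ S, F' x = 0) → ∀ x ∈ T, eval x F = 0 := by
    intro F N F' e h0 x hx
    obtain ⟨hxS, hh, hl⟩ := (hT.mem_iff x).1 hx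
    have h1 := e x (by rw [hl]; exact one_ne_zero)
    rw [h0 x hxS, hl, hh, one_pow, one_mul, inv_one, one_smul, zero_smul, sub_zero] at h1
    exact h1.symm
  have hl := polyFun_of_dual l
  have h1 := hS.vanish_or hl ((PolyFun _).mul_mem mF mG) fun x hx => by
    by_cases hlx : l x = 0
    · exact mul_eq_zero_of_left hlx _
    · rw [Pi.mul_apply, eF x hlx, eG x hlx]
      linear_combination l x * l x ^ N * l x ^ N' * hFG _ (hT.proj_mem hx hlx)
  rcases h1 with h1 | h1
  · obtain ⟨x, hx, hlx⟩ := hT.exists_ne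
    exact absurd (h1 x hx) hlx
  · rcases hS.vanish_or mF mG h1 with h2 | h2
    · exact Or.inl (back eF h2)
    · exact Or.inr (back eG h2)

lemma dependent (hT : IsConeBase S v h l T) (hS : IsAlgSet S) (hdim : adim S = 3)
    (i j : Fin (r + 1)) :
    ∃ F : MvPolynomial (Fin 2) ℂ, F ≠ 0 ∧ ∀ x ∈ T, eval ![x i, x j] F = 0 := by
  by_contra! hne
  let u : Fin (r + 1) → Module.Dual ℂ (Fin (r + 1) → ℂ) := fun k => LinearMap.proj k - v k • h
  have h4 := le_adim_of_indepOn hS (d := 4) (f := fun k x => ![l, h, u i, u j] k x)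
    (fun k => polyFun_of_dual _) ?_
  · rw [hdim] at h4
    exact absurd h4 (by norm_num)
  intro F hF
  have hvan : ∀ a b y z : ℂ, a ≠ 0 → eval ![a, b, y, z] F = 0 := by
    intro a b y z ha
    let F' : MvPolynomial (Fin 2) ℂ := aeval ![C a, C b, C a * X 0, C a * X 1] F
    have hF' : ∀ y z, eval ![y, z] F' = eval ![a, b, a * y, a * z] F := by
      intro y z
      rw [eval_aeval]
      refine congrArg (fun w => eval w F) (funext fun k => ?_)
      fin_cases k <;> simp
    have h0 : F' = 0 := by
      by_contra hF0
      obtain ⟨x, hx, hx0⟩ := hne F' hF0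
      obtain ⟨hxS, hh, hl⟩ := (hT.mem_iff x).1 hx
      refine hx0 ?_
      rw [hF', ← hF _ (hT.vertex x hxS b a)]
      refine congrArg (fun w => eval w F) (funext fun k => ?_)
      fin_cases k <;> simp [u, hh, hl, hT.apply_vertex, hT.chart_vertex]
      all_goals ring
    have h1 := hF' (a⁻¹ * y) (a⁻¹ * z)
    rwa [h0, map_zero, mul_inv_cancel_left₀ ha, mul_inv_cancel_left₀ ha, eq_comm] at h1
  have hX : X 0 * F = 0 := by
    apply MvPolynomial.funext
    intro x
    rw [map_mul, eval_X, map_zero]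
    by_cases hx : x 0 = 0
    · rw [hx, zero_mul]
    · have h1 := hvan (x 0) (x 1) (x 2) (x 3) hx
      have h2 : ![x 0, x 1, x 2, x 3] = x := by
        funext k
        fin_cases k <;> rfl
      rw [h2] at h1
      rw [h1, mul_zero]
  exact (mul_eq_zero.1 hX).resolve_left (X_ne_zero _)

end IsConeBase

end Cones

section ConeDegenerate

open MvPolynomial

variable {r : ℕ} {S : Set (Fin (r + 1) → ℂ)}
variable {v : Fin (r + 1) → ℂ} {h l : Module.Dual ℂ (Fin (r + 1) → ℂ)}
  {T : Set (Fin (r + 1) → ℂ)}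

namespace IsConeBase

/-- A bivariate polynomial evaluated at two coordinates. -/
lemma exists_eval_eq_eval_map (i j : Fin (r + 1)) (P : Polynomial (Polynomial ℂ)) :
    ∃ G : MvPolynomial (Fin (r + 1)) ℂ, ∀ x,
      eval x G = (P.map (Polynomial.evalRingHom (x j))).eval (x i) := by
  let φ : Polynomial ℂ →+* MvPolynomial (Fin (r + 1)) ℂ := Polynomial.eval₂RingHom C (X j)
  refine ⟨P.eval₂ φ (X i), fun x => ?_⟩
  rw [Polynomial.hom_eval₂, eval_X, Polynomial.eval_map]
  congr 1
  refine Polynomial.ringHom_ext (fun a => ?_) ?_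
  · simp [φ]
  · simp [φ]

lemma exists_relation_ne_zero (hT : IsConeBase S v h l T) (hS : IsIrrAlg S) (i j : Fin (r + 1))
    (hj : ∀ τ : ℂ, ∃ x ∈ T, x j ≠ τ) {P : Polynomial (Polynomial ℂ)} (hP0 : P ≠ 0)
    (hP : ∀ x ∈ T, (P.map (Polynomial.evalRingHom (x j))).eval (x i) = 0) :
    ∃ P : Polynomial (Polynomial ℂ), (∀ τ, P.map (Polynomial.evalRingHom τ) ≠ 0) ∧
      ∀ x ∈ T, (P.map (Polynomial.evalRingHom (x j))).eval (x i) = 0 := by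
  obtain ⟨P, ⟨hP0, hP⟩, hmin⟩ := WellFounded.has_min
    (wellFounded_dvdNotUnit (α := Polynomial (Polynomial ℂ)))
    {P | P ≠ 0 ∧ ∀ x ∈ T, (P.map (Polynomial.evalRingHom (x j))).eval (x i) = 0} ⟨P, hP0, hP⟩
  refine ⟨P, fun τ hτ => ?_, hP⟩
  obtain ⟨Q, rfl⟩ : Polynomial.C (Polynomial.X - Polynomial.C τ) ∣ P := by
    rw [Polynomial.C_dvd_iff_dvd_coeff]
    intro n
    rw [Polynomial.dvd_iff_isRoot]
    have h1 := congrArg (fun p => p.coeff n) hτ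
    simpa using h1
  have hQ0 : Q ≠ 0 := right_ne_zero_of_mul hP0
  obtain ⟨G, hG⟩ := exists_eval_eq_eval_map i j Q
  have h1 := hT.vanish_or hS (F := X j - C τ) (G := G) fun x hx => by
    have h2 := hP x hx
    rw [hG]
    simpa using h2
  rcases h1 with h1 | h1
  · obtain ⟨x, hx, hne⟩ := hj τ
    exact hne (by simpa [sub_eq_zero] using h1 x hx)
  · refine hmin Q ⟨hQ0, fun x hx => by rw [← hG, h1 x hx]⟩ ⟨hQ0, _, ?_, mul_comm _ _⟩
    rw [Polynomial.isUnit_C]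
    exact (Polynomial.prime_X_sub_C τ).not_isUnit

lemma exists_params (hT : IsConeBase S v h l T) (hS : IsIrrAlg S) (hdim : adim S = 3) :
    ∃ (t : (Fin (r + 1) → ℂ) → ℂ) (P : Fin (r + 1) → Polynomial (Polynomial ℂ)),
      (∀ i τ, (P i).map (Polynomial.evalRingHom τ) ≠ 0) ∧
      ∀ i, ∀ x ∈ T, ((P i).map (Polynomial.evalRingHom (t x))).eval (x i) = 0 := by
  by_cases hc : ∀ j : Fin (r + 1), ∃ τ : ℂ, ∀ x ∈ T, x j = τ
  · choose τ hτ using hc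
    refine ⟨0, fun i => Polynomial.X - Polynomial.C (Polynomial.C (τ i)), fun i c => ?_,
      fun i x hx => ?_⟩
    · simpa using Polynomial.X_sub_C_ne_zero (τ i)
    · simp [hτ i x hx]
  · push Not at hc
    obtain ⟨j, hj⟩ := hc
    have hP : ∀ i : Fin (r + 1), ∃ P : Polynomial (Polynomial ℂ),
        (∀ τ, P.map (Polynomial.evalRingHom τ) ≠ 0) ∧
        ∀ x ∈ T, (P.map (Polynomial.evalRingHom (x j))).eval (x i) = 0 := by
      intro i
      obtain ⟨F, hF0, hF⟩ := hT.dependent hS.2.1 hdim j i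
      obtain ⟨P, hP⟩ : ∃ P : Polynomial (Polynomial ℂ), ∀ a b : ℂ,
          (P.map (Polynomial.evalRingHom a)).eval b = eval ![a, b] F := by
        refine ⟨aeval ![Polynomial.C Polynomial.X, Polynomial.X] F, fun a b => ?_⟩
        clear hF0 hF
        induction F using MvPolynomial.induction_on with
        | C c => simp
        | add p q hp hq => simp_all
        | mul_X p k hp => fin_cases k <;> simp_all
      refine hT.exists_relation_ne_zero hS i j hj (P := P) ?_ fun x hx => by rw [hP, hF x hx]
      rintro rfl
      refine hF0 (MvPolynomial.funext fun x => ?_)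
      have h2 : ![x 0, x 1] = x := by
        funext k
        fin_cases k <;> rfl
      rw [map_zero, ← h2, ← hP, Polynomial.map_zero, Polynomial.eval_zero]
    choose P hP0 hP using hP
    exact ⟨fun x => x j, P, hP0, hP⟩

/-- The lines in solids spanned by the vertex of a cone and three points of the base depend on
eight parameters. -/
lemma not_indepOn_wdg (hT : IsConeBase S v h l T) (hS : IsIrrAlg S) (hdim : adim S = 3)
    (f : Fin 9 → ExteriorAlgebra ℂ (Fin (r + 1) → ℂ) → ℂ)
    (hf : ∀ i, f i ∈ PolyFun (ExteriorAlgebra ℂ (Fin (r + 1) → ℂ))) :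
    ¬ IndepOn f {z | ∃ c : Fin 3 → Fin (r + 1) → ℂ, (∀ i, c i ∈ T) ∧ ∃ w₀ w₁ : Fin 4 → ℂ,
      z = wdg (Fintype.linearCombination ℂ ![v, c 0, c 1, c 2] w₀)
        (Fintype.linearCombination ℂ ![v, c 0, c 1, c 2] w₁)} := by
  obtain ⟨t, P, hP, hrel⟩ := hT.exists_params hS hdim
  let y : Fin 5 → MvPolynomial (Fin 8 ⊕ Fin 3 × Fin (r + 1)) ℂ :=
    fun k => X (Sum.inl (Fin.natAdd 3 k))
  let z : Fin 3 → Fin (r + 1) → MvPolynomial (Fin 8 ⊕ Fin 3 × Fin (r + 1)) ℂ :=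
    fun i k => X (Sum.inr (i, k))
  choose H hH using fun i => exists_eval_of_wdg (hf i)
    (fun k => y 4 * (C (v k) + y 0 * z 1 k + y 1 * z 2 k))
    (fun k => z 0 k + y 2 * z 1 k + y 3 * z 2 k)
    (fun k : Fin (r + 1) => (Pi.single k 1 : Fin (r + 1) → ℂ))
  intro hind
  refine not_indepOn_of_params (A := (Fin 3 → T) × (Fin 5 → ℂ)) (ι := Fin 3 × Fin (r + 1))
    (m := 8) (fun k a => Fin.append (m := 3) (n := 5) (fun i => t (a.1 i)) a.2 k)
    (fun k a => (a.1 k.1).1 k.2) (fun k => P k.2) (fun k => Fin.castAdd 5 k.1)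
    (fun k c => hP k.2 c) (fun k a => ?_) H fun F hF => hind F ?_
  · rw [Fin.append_left]
    exact hrel k.2 _ (a.1 k.1).2
  rintro _ ⟨c, hc, w₀, w₁, rfl⟩
  refine vanish_wdg_of_chart (f := fun z => eval (fun i => f i z) F) (polyFun_eval hf F)
    (Fintype.linearCombination ℂ ![v, c 0, c 1, c 2]) (fun κ x => ?_) w₀ w₁
  have h1 := hF (fun i => ⟨c i, hc i⟩, ![x 0, x 1, x 2, x 3, κ]) trivial
  refine Eq.trans (congrArg (fun w => eval w F) (funext fun i => ?_)) h1
  refine Eq.trans (congrArg (f i) ?_) (hH i _)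
  have e : ∀ (w : Fin (r + 1) → ℂ), ∑ k, w k • (Pi.single k 1 : Fin (r + 1) → ℂ) = w :=
    fun w => (pi_eq_sum_univ' w).symm
  rw [e, e, ← wdg_smul_left]
  simp only [y, z, map_mul, map_add, eval_X, eval_C, Sum.elim_inl, Sum.elim_inr, Fin.append_right]
  congr 2
  · funext k
    simp [Fintype.linearCombination_apply, Fin.sum_univ_four]
  · funext k
    simp [Fintype.linearCombination_apply, Fin.sum_univ_four]

end IsConeBase

/-- Cones have few lines in trisecant planes. -/
lemma adim_GhkCone_cone_lt (hr : 0 < r) (hS : IsIrrAlg S) (hnd : Nondeg S) (hdim : adim S = 3)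
    (hc : IsConeVar S) : adim (GhkCone S 1 2) < 9 := by
  obtain ⟨v, h, l, T, hT⟩ := hc.exists_isConeBase hr hnd
  refine adim_GhkCone_lt (A := {x | x ∈ S ∧ l x ≠ 0}) (fun x hx => ?_) _
    (fun f hf => hT.not_indepOn_wdg hS hdim f hf) fun f hf hfB p hp a b => hfB _ ?_
  · rw [mem_zcl_iff]
    intro f hf hfA
    have h1 := hS.vanish_or (polyFun_of_dual l) hf fun y hy => by
      by_cases hly : l y = 0
      · exact mul_eq_zero_of_left hly _
      · exact mul_eq_zero_of_right _ (hfA y ⟨hy, hly⟩)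
    obtain ⟨y, hy, hly⟩ := hT.exists_ne
    exact (h1.resolve_left fun h0 => hly (h0 y hy)) x hx
  · let c : Fin 3 → Fin (r + 1) → ℂ := fun i => (l (p i))⁻¹ • (p i - h (p i) • v)
    have hpc : ∀ i, p i = l (p i) • c i + h (p i) • v := by
      intro i
      rw [smul_inv_smul₀ (hp i).2, sub_add_cancel]
    refine ⟨c, fun i => hT.proj_mem (hp i).1 (hp i).2, ?_⟩
    have e : ∀ a : Fin 3 → ℂ, ∃ w : Fin 4 → ℂ,
        ∑ i, a i • p i = Fintype.linearCombination ℂ ![v, c 0, c 1, c 2] w := by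
      intro a
      refine ⟨![∑ i, a i * h (p i), a 0 * l (p 0), a 1 * l (p 1), a 2 * l (p 2)], ?_⟩
      have h1 : ∑ i, a i • p i = ∑ i, a i • (l (p i) • c i + h (p i) • v) :=
        Finset.sum_congr rfl fun i _ => by rw [← hpc]
      rw [h1, Fintype.linearCombination_apply, Fin.sum_univ_four, Fin.sum_univ_three,
        Fin.sum_univ_three]
      simp
      module
    obtain ⟨w₀, h₀⟩ := e a
    obtain ⟨w₁, h₁⟩ := e b
    exact ⟨w₀, w₁, by rw [h₀, h₁]⟩

end ConeDegenerate

lemma ENat.sub_one_lt_eight_iff {n : ℕ∞} : n - 1 < 8 ↔ n < 9 := by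
  induction n using ENat.recTopCoe with
  | top => simp
  | coe n =>
    norm_cast
    omega

lemma ENat.eq_three_of_sub_one_eq_two {n : ℕ∞} (h : n - 1 = 2) : n = 3 := by
  induction n using ENat.recTopCoe with
  | top => simp at h
  | coe n =>
    norm_cast at h ⊢
    omega

/-- **Main classification.** An integral non-degenerate surface `S ⊂ P^r`, `r ≥ 5`,
satisfies `dim G_{1,2}(S) < 8` if and only if `S` is a cone, or `r = 5` and `S` is
(projectively equivalent to) a smooth rational normal scroll of degree 4 in `P^5`
(types `S(2,2)` and `S(1,3)`; the degenerate scroll `S(0,4)` is a cone). -/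
theorem classification_degenerate_G12 (r : ℕ) (hr : 5 ≤ r)
    (S : Set (Fin (r + 1) → ℂ)) (hS : IsProjVar S) (hnd : Nondeg S)
    (hdim : pdim S = 2) :
    pdim (GhkCone S 1 2) < 8 ↔
      IsConeVar S ∨
      (r = 5 ∧ ∃ g : (Fin 6 → ℂ) ≃ₗ[ℂ] (Fin (r + 1) → ℂ),
        S = ⇑g '' ScrollS22 ∨ S = ⇑g '' ScrollS13) := by
  have hdim' : adim S = 3 := ENat.eq_three_of_sub_one_eq_two hdim
  rw [pdim, ENat.sub_one_lt_eight_iff]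
  refine ⟨fun h => isConeVar_or_scroll hr hS hnd hdim' h, ?_⟩
  rintro (hc | ⟨-, g, rfl | rfl⟩)
  · exact adim_GhkCone_cone_lt (by omega) hS.2.2.1 hnd hdim' hc
  · exact adim_GhkCone_scrollS22_lt g
  · exact adim_GhkCone_scrollS13_lt g
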